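/- Solvability of the Dirichlet problem: for every measurable g : Γ → ℝ with ‖g‖_H < ∞ there exists u ∈ W, unique up to modification on a Lebesgue-null set, such that Tu = g σ-almost everywhere on Γ and ∫_Ω A∇u·∇φ dx = 0 for every φ ∈ C_c^∞(Ω). Moreover ‖u‖_W ≤ C ‖g‖_H, with C > 0 depending only on n, d, C₀, and C₁. -/

import Mathlib

open MeasureTheory Metric Set Filter
open scoped ENNReal NNReal Topology

noncomputable section

/-- Euclidean space `ℝⁿ`. -/
abbrev Euc (n : ℕ) := EuclideanSpace ℝ (Fin n)

/-- `Γ ⊆ ℝⁿ` is `d`-Ahlfors regular with constant `C₀`. -/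
def AhlforsRegular (n : ℕ) (d C₀ : ℝ) (Γ : Set (Euc n)) : Prop :=
  ∀ x ∈ Γ, ∀ r : ℝ, 0 < r →
    ENNReal.ofReal (C₀⁻¹ * r ^ d) ≤ μH[d] (Γ ∩ ball x r) ∧
      μH[d] (Γ ∩ ball x r) ≤ ENNReal.ofReal (C₀ * r ^ d)

/-- The weight `w(x) = dist(x, Γ) ^ (d + 1 - n)`. -/
def weightW (n : ℕ) (d : ℝ) (Γ : Set (Euc n)) (x : Euc n) : ℝ :=
  infDist x Γ ^ (d + 1 - (n : ℝ))

/-- The measure `m` with density `w` with respect to Lebesgue measure. -/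
def measW (n : ℕ) (d : ℝ) (Γ : Set (Euc n)) : Measure (Euc n) :=
  volume.withDensity fun x => ENNReal.ofReal (weightW n d Γ x)

/-- `v` is a distributional gradient of `u` on the open set `E`: for every smooth
compactly supported test function `φ` with support in `E`, `∫_E u ∇φ = -∫_E φ v`. -/
def IsDistribGradOn {n : ℕ} (u : Euc n → ℝ) (v : Euc n → Euc n) (E : Set (Euc n)) : Prop :=
  ∀ φ : Euc n → ℝ, ContDiff ℝ (⊤ : ℕ∞) φ → HasCompactSupport φ → tsupport φ ⊆ E →
    ∫ x in E, u x • gradient φ x = -∫ x in E, φ x • v x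

/-- The averages of `u` over small balls centered at `x` converge to `t`. -/
def HasTraceAt {n : ℕ} (u : Euc n → ℝ) (x : Euc n) (t : ℝ) : Prop :=
  Tendsto (fun ρ : ℝ => ⨍ y in ball x ρ, u y) (𝓝[>] (0 : ℝ)) (𝓝 t)

/-- `u` belongs to the weighted Sobolev space `W = Ẇ^{1,2}_w(Ω)`, `Ω = Γᶜ`, with
distributional gradient `v` on `Ω` lying in `L²(Ω, m)`. -/
structure MemW (n : ℕ) (d : ℝ) (Γ : Set (Euc n)) (u : Euc n → ℝ) (v : Euc n → Euc n) :
    Prop where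
  locInt : LocallyIntegrableOn u Γᶜ volume
  gradLocInt : LocallyIntegrableOn v Γᶜ volume
  isGrad : IsDistribGradOn u v Γᶜ
  l2 : ∫⁻ x in Γᶜ, ENNReal.ofReal (‖v x‖ ^ 2) ∂(measW n d Γ) < ⊤

/-- `u` belongs to the local space `W_r(E)`: `u ∈ L¹_loc(E)` and `φ u` (extended by `0`)
belongs to `W` for every smooth compactly supported `φ` with support in `E`. -/
def MemWrOn (n : ℕ) (d : ℝ) (Γ : Set (Euc n)) (E : Set (Euc n)) (u : Euc n → ℝ) : Prop :=
  LocallyIntegrableOn u E volume ∧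
    ∀ φ : Euc n → ℝ, ContDiff ℝ (⊤ : ℕ∞) φ → HasCompactSupport φ → tsupport φ ⊆ E →
      ∃ vφ : Euc n → Euc n, MemW n d Γ (fun x => φ x * u x) vφ

/-- Degenerate ellipticity and boundedness conditions for the matrix `A`. -/
def EllipticOn (n : ℕ) (d : ℝ) (Γ : Set (Euc n)) (A : Euc n → Euc n →L[ℝ] Euc n)
    (C₁ : ℝ) : Prop :=
  ∀ x, x ∉ Γ →
    (∀ ξ ζ : Euc n, |∑ i, A x ξ i * ζ i| ≤ C₁ * weightW n d Γ x * ‖ξ‖ * ‖ζ‖) ∧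
      ∀ ξ : Euc n, C₁⁻¹ * weightW n d Γ x * ‖ξ‖ ^ 2 ≤ ∑ i, A x ξ i * ξ i

/-- `u`, with gradient `v`, is a weak subsolution of `- div A ∇u = 0` on `U ⊆ Ω = Γᶜ`. -/
def SubsolOn {n : ℕ} (Γ : Set (Euc n)) (A : Euc n → Euc n →L[ℝ] Euc n)
    (v : Euc n → Euc n) (U : Set (Euc n)) : Prop :=
  ∀ φ : Euc n → ℝ, ContDiff ℝ (⊤ : ℕ∞) φ → HasCompactSupport φ → tsupport φ ⊆ U →
    (∀ x, 0 ≤ φ x) → ∫ x in Γᶜ, ∑ i, A x (v x) i * gradient φ x i ≤ 0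

/-- `u`, with gradient `v`, is a weak supersolution of `- div A ∇u = 0` on `U ⊆ Ω = Γᶜ`. -/
def SupersolOn {n : ℕ} (Γ : Set (Euc n)) (A : Euc n → Euc n →L[ℝ] Euc n)
    (v : Euc n → Euc n) (U : Set (Euc n)) : Prop :=
  ∀ φ : Euc n → ℝ, ContDiff ℝ (⊤ : ℕ∞) φ → HasCompactSupport φ → tsupport φ ⊆ U →
    (∀ x, 0 ≤ φ x) → 0 ≤ ∫ x in Γᶜ, ∑ i, A x (v x) i * gradient φ x i

/-- `u`, with gradient `v`, is a weak solution of `- div A ∇u = 0` on `U ⊆ Ω = Γᶜ`. -/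
def SolOn {n : ℕ} (Γ : Set (Euc n)) (A : Euc n → Euc n →L[ℝ] Euc n)
    (v : Euc n → Euc n) (U : Set (Euc n)) : Prop :=
  ∀ φ : Euc n → ℝ, ContDiff ℝ (⊤ : ℕ∞) φ → HasCompactSupport φ → tsupport φ ⊆ U →
    ∫ x in Γᶜ, ∑ i, A x (v x) i * gradient φ x i = 0

lemma dp_cs {α : Type*} [MeasurableSpace α] (ν : Measure α) {f g : α → ℝ≥0∞}
    (hf : AEMeasurable f ν) (hg : AEMeasurable g ν) :
    (∫⁻ x, f x * g x ∂ν) ^ 2 ≤ (∫⁻ x, f x ^ 2 ∂ν) * ∫⁻ x, g x ^ 2 ∂ν := by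
  have h := ENNReal.lintegral_mul_le_Lp_mul_Lq ν
    (show Real.HolderConjugate 2 2 from Real.HolderConjugate.two_two) hf hg
  simp only [Pi.mul_apply, ENNReal.rpow_ofNat] at h
  calc (∫⁻ x, f x * g x ∂ν) ^ 2
      ≤ ((∫⁻ x, f x ^ 2 ∂ν) ^ (1 / 2 : ℝ) * (∫⁻ x, g x ^ 2 ∂ν) ^ (1 / 2 : ℝ)) ^ 2 := by
        gcongr
    _ = _ := by
        rw [mul_pow, ← ENNReal.rpow_natCast, ← ENNReal.rpow_natCast, ← ENNReal.rpow_mul,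
          ← ENNReal.rpow_mul]
        norm_num

lemma dp_jensen {α : Type*} [MeasurableSpace α] (ν : Measure α) {f : α → ℝ≥0∞}
    (hf : AEMeasurable f ν) :
    (∫⁻ x, f x ∂ν) ^ 2 ≤ ν univ * ∫⁻ x, f x ^ 2 ∂ν := by
  have h := dp_cs ν (f := fun _ => 1) (g := f) aemeasurable_const hf
  simpa using h

lemma dp_far (D q : ℝ) (hD : 0 ≤ D) (hq : D < q) : ∃ C : ℝ≥0, ∀ (n : ℕ) (μ : Measure (Euc n))
    (y : Euc n) (M : ℝ≥0∞), (∀ r : ℝ, 0 < r → μ (ball y r) ≤ M * ENNReal.ofReal (r ^ D)) →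
    ∀ R : ℝ, 0 < R → ∫⁻ x in (ball y R)ᶜ, ENNReal.ofReal (dist x y ^ (-q)) ∂μ
      ≤ C * M * ENNReal.ofReal (R ^ (D - q)) := by
  have hlt : (2 : ℝ) ^ (D - q) < 1 := Real.rpow_lt_one_of_one_lt_of_neg (by norm_num) (by linarith)
  have hs : Summable fun k : ℕ => (2 : ℝ) ^ D * ((2 : ℝ) ^ (D - q)) ^ k :=
    (summable_geometric_of_lt_one (by positivity) hlt).mul_left _
  refine ⟨(∑' k : ℕ, (2 : ℝ) ^ D * ((2 : ℝ) ^ (D - q)) ^ k).toNNReal, ?_⟩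
  intro n μ y M hM R hR
  have hC : (((∑' k : ℕ, (2 : ℝ) ^ D * ((2 : ℝ) ^ (D - q)) ^ k).toNNReal : ℝ≥0) : ℝ≥0∞)
      = ∑' k : ℕ, ENNReal.ofReal ((2 : ℝ) ^ D * ((2 : ℝ) ^ (D - q)) ^ k) :=
    ENNReal.ofReal_tsum_of_nonneg (fun k => by positivity) hs
  rw [hC]
  calc ∫⁻ x in (ball y R)ᶜ, ENNReal.ofReal (dist x y ^ (-q)) ∂μ
      ≤ ∫⁻ x in (ball y R)ᶜ, ∑' k : ℕ, (ball y (2 ^ (k + 1) * R)).indicator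
          (fun _ => ENNReal.ofReal ((2 ^ k * R) ^ (-q))) x ∂μ := by
        refine setLIntegral_mono' measurableSet_ball.compl ?_
        intro x hx
        have hx' : R ≤ dist x y := by simpa using hx
        obtain ⟨k, hk1, hk2⟩ := exists_nat_pow_near (x := dist x y / R) (y := (2 : ℝ))
          (by rw [le_div_iff₀ hR]; linarith) (by norm_num)
        rw [le_div_iff₀ hR] at hk1
        rw [div_lt_iff₀ hR] at hk2
        refine le_trans ?_ (ENNReal.le_tsum k)
        rw [indicator_of_mem (by simpa using hk2)]
        apply ENNReal.ofReal_le_ofReal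
        exact Real.rpow_le_rpow_of_nonpos (by positivity) hk1 (by linarith)
    _ ≤ ∫⁻ x, ∑' k : ℕ, (ball y (2 ^ (k + 1) * R)).indicator
          (fun _ => ENNReal.ofReal ((2 ^ k * R) ^ (-q))) x ∂μ := setLIntegral_le_lintegral _ _
    _ = ∑' k : ℕ, ENNReal.ofReal ((2 ^ k * R) ^ (-q)) * μ (ball y (2 ^ (k + 1) * R)) := by
        rw [lintegral_tsum (fun k => (measurable_const.indicator measurableSet_ball).aemeasurable)]
        congr 1; ext k
        rw [lintegral_indicator measurableSet_ball, setLIntegral_const]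
    _ ≤ ∑' k : ℕ, ENNReal.ofReal ((2 : ℝ) ^ D * ((2 : ℝ) ^ (D - q)) ^ k)
          * (M * ENNReal.ofReal (R ^ (D - q))) := by
        refine ENNReal.tsum_le_tsum fun k => ?_
        calc ENNReal.ofReal ((2 ^ k * R) ^ (-q)) * μ (ball y (2 ^ (k + 1) * R))
            ≤ ENNReal.ofReal ((2 ^ k * R) ^ (-q)) *
              (M * ENNReal.ofReal ((2 ^ (k + 1) * R) ^ D)) := by
              gcongr; exact hM _ (by positivity)
          _ = M * (ENNReal.ofReal (((2 ^ k * R) ^ (-q)) * ((2 ^ (k + 1) * R) ^ D))) := by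
              rw [ENNReal.ofReal_mul (by positivity)]; ring
          _ = M * (ENNReal.ofReal (((2 : ℝ) ^ D * ((2 : ℝ) ^ (D - q)) ^ k) * R ^ (D - q))) := by
              congr 2
              rw [Real.mul_rpow (by positivity) hR.le, Real.mul_rpow (by positivity) hR.le,
                sub_eq_add_neg, Real.rpow_add hR, Real.rpow_add (by norm_num : (0 : ℝ) < 2),
                pow_succ, Real.mul_rpow (by positivity) (by norm_num), mul_pow,
                ← Real.rpow_natCast, ← Real.rpow_natCast, ← Real.rpow_natCast,
                ← Real.rpow_mul (by norm_num), ← Real.rpow_mul (by norm_num),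
                ← Real.rpow_mul (by norm_num), ← Real.rpow_mul (by norm_num),
                mul_comm D, mul_comm (-q)]
              ring
          _ = _ := by rw [ENNReal.ofReal_mul (by positivity)]; ring
    _ = _ := by rw [ENNReal.tsum_mul_right]; ring

lemma dp_near (D a : ℝ) (hD : 0 ≤ D) (ha : 0 < a) (hq : a < D) : ∃ C : ℝ≥0, ∀ (n : ℕ)
    (μ : Measure (Euc n))
    (y : Euc n) (M : ℝ≥0∞), (∀ r : ℝ, 0 < r → μ (ball y r) ≤ M * ENNReal.ofReal (r ^ D)) →
    ∀ R : ℝ, 0 < R → ∫⁻ x in ball y R, ENNReal.ofReal (dist x y ^ (-a)) ∂μ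
      ≤ C * M * ENNReal.ofReal (R ^ (D - a)) := by
  have hlt : (1 / 2 : ℝ) ^ (D - a) < 1 :=
    Real.rpow_lt_one (by norm_num) (by norm_num) (by linarith)
  have hs : Summable fun k : ℕ => (2 : ℝ) ^ a * ((1 / 2 : ℝ) ^ (D - a)) ^ k :=
    (summable_geometric_of_lt_one (by positivity) hlt).mul_left _
  refine ⟨(∑' k : ℕ, (2 : ℝ) ^ a * ((1 / 2 : ℝ) ^ (D - a)) ^ k).toNNReal, ?_⟩
  intro n μ y M hM R hR
  have hC : (((∑' k : ℕ, (2 : ℝ) ^ a * ((1 / 2 : ℝ) ^ (D - a)) ^ k).toNNReal : ℝ≥0) : ℝ≥0∞)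
      = ∑' k : ℕ, ENNReal.ofReal ((2 : ℝ) ^ a * ((1 / 2 : ℝ) ^ (D - a)) ^ k) :=
    ENNReal.ofReal_tsum_of_nonneg (fun k => by positivity) hs
  rw [hC]
  calc ∫⁻ x in ball y R, ENNReal.ofReal (dist x y ^ (-a)) ∂μ
      ≤ ∫⁻ x in ball y R, ∑' k : ℕ, (closedBall y ((1 / 2) ^ k * R)).indicator
          (fun _ => ENNReal.ofReal (((1 / 2) ^ (k + 1) * R) ^ (-a))) x ∂μ := by
        refine setLIntegral_mono' measurableSet_ball ?_
        intro x hx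
        have hx' : dist x y < R := by simpa using hx
        rcases eq_or_lt_of_le (dist_nonneg (x := x) (y := y)) with h0 | h0
        · rw [← h0, Real.zero_rpow (by linarith)]; simp
        obtain ⟨k, hk1, hk2⟩ := exists_nat_pow_near_of_lt_one (x := dist x y / R) (y := (1 / 2 : ℝ))
          (by positivity) (by rw [div_le_iff₀ hR]; linarith) (by norm_num) (by norm_num)
        rw [lt_div_iff₀ hR] at hk1
        rw [div_le_iff₀ hR] at hk2
        refine le_trans ?_ (ENNReal.le_tsum k)
        rw [indicator_of_mem (by simpa using hk2)]
        apply ENNReal.ofReal_le_ofReal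
        exact Real.rpow_le_rpow_of_nonpos (by positivity) hk1.le (by linarith)
    _ ≤ ∫⁻ x, ∑' k : ℕ, (closedBall y ((1 / 2) ^ k * R)).indicator
          (fun _ => ENNReal.ofReal (((1 / 2) ^ (k + 1) * R) ^ (-a))) x ∂μ :=
        setLIntegral_le_lintegral _ _
    _ = ∑' k : ℕ, ENNReal.ofReal (((1 / 2) ^ (k + 1) * R) ^ (-a)) *
          μ (closedBall y ((1 / 2) ^ k * R)) := by
        rw [lintegral_tsum
          (fun k => (measurable_const.indicator measurableSet_closedBall).aemeasurable)]
        congr 1; ext k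
        rw [lintegral_indicator measurableSet_closedBall, setLIntegral_const]
    _ ≤ ∑' k : ℕ, ENNReal.ofReal ((2 : ℝ) ^ a * ((1 / 2 : ℝ) ^ (D - a)) ^ k)
          * (M * ENNReal.ofReal (R ^ (D - a))) := by
        refine ENNReal.tsum_le_tsum fun k => ?_
        have hcb : μ (closedBall y ((1 / 2) ^ k * R)) ≤
            M * ENNReal.ofReal (((1 / 2) ^ k * R) ^ D) := by
          have : Tendsto (fun r : ℝ => M * ENNReal.ofReal (r ^ D)) (𝓝[>] ((1 / 2) ^ k * R))
              (𝓝 (M * ENNReal.ofReal (((1 / 2) ^ k * R) ^ D))) := by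
            refine Tendsto.mono_left ?_ nhdsWithin_le_nhds
            have hp : (0 : ℝ) < (1 / 2) ^ k * R := by positivity
            refine ENNReal.Tendsto.const_mul ?_ (Or.inl ?_)
            · refine (ENNReal.continuous_ofReal.tendsto _).comp ?_
              exact (Real.continuousAt_rpow_const _ _ (Or.inl hp.ne'))
            · simp only [ne_eq, ENNReal.ofReal_eq_zero, not_le]; positivity
          refine ge_of_tendsto this ?_
          filter_upwards [self_mem_nhdsWithin] with r hr
          have hr' : (1 / 2) ^ k * R < r := hr
          exact (measure_mono (closedBall_subset_ball hr')).trans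
            (hM r (lt_trans (by positivity) hr'))
        calc ENNReal.ofReal (((1 / 2) ^ (k + 1) * R) ^ (-a)) * μ (closedBall y ((1 / 2) ^ k * R))
            ≤ ENNReal.ofReal (((1 / 2) ^ (k + 1) * R) ^ (-a)) *
              (M * ENNReal.ofReal (((1 / 2) ^ k * R) ^ D)) := by
              gcongr
          _ = M * (ENNReal.ofReal ((((1 / 2) ^ (k + 1) * R) ^ (-a)) *
                (((1 / 2) ^ k * R) ^ D))) := by
              rw [ENNReal.ofReal_mul (by positivity)]; ring
          _ = M * (ENNReal.ofReal (((2 : ℝ) ^ a * ((1 / 2 : ℝ) ^ (D - a)) ^ k)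
                * R ^ (D - a))) := by
              congr 2
              have h2 : (2 : ℝ) ^ a = (1 / 2 : ℝ) ^ (-a) := by
                rw [one_div, Real.inv_rpow (by norm_num), Real.rpow_neg (by norm_num), inv_inv]
              rw [h2, Real.mul_rpow (by positivity) hR.le, Real.mul_rpow (by positivity) hR.le,
                sub_eq_add_neg, Real.rpow_add hR, Real.rpow_add (by norm_num : (0 : ℝ) < 1 / 2),
                pow_succ, Real.mul_rpow (by positivity) (by norm_num), mul_pow,
                ← Real.rpow_natCast, ← Real.rpow_natCast, ← Real.rpow_natCast,
                ← Real.rpow_mul (by norm_num), ← Real.rpow_mul (by norm_num),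
                ← Real.rpow_mul (by norm_num), ← Real.rpow_mul (by norm_num),
                mul_comm D, mul_comm (-a)]
              ring
          _ = _ := by rw [ENNReal.ofReal_mul (by positivity)]; ring
    _ = _ := by rw [ENNReal.tsum_mul_right]; ring
/-- Standing assumptions. -/
structure DpGood (n : ℕ) (d C₀ : ℝ) (Γ : Set (Euc n)) : Prop where
  hn : 2 ≤ n
  hd0 : 0 < d
  hdn : d < (n : ℝ) - 1
  hC₀ : 1 ≤ C₀
  ne : Γ.Nonempty
  cl : IsClosed Γ
  ar : AhlforsRegular n d C₀ Γ

/-- surface measure -/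
abbrev dpS {n : ℕ} (d : ℝ) (Γ : Set (Euc n)) : Measure (Euc n) := (μH[d]).restrict Γ

lemma DpGood.pos {n : ℕ} {d C₀ : ℝ} {Γ : Set (Euc n)} (h : DpGood n d C₀ Γ) {y : Euc n}
    (hy : y ∉ Γ) : 0 < infDist y Γ :=
  (h.cl.notMem_iff_infDist_pos h.ne).1 hy

lemma DpGood.nearpt {n : ℕ} {d C₀ : ℝ} {Γ : Set (Euc n)} (h : DpGood n d C₀ Γ) (y : Euc n) :
    ∃ p ∈ Γ, dist y p = infDist y Γ := by
  obtain ⟨p, hp, hp'⟩ := h.cl.exists_infDist_eq_dist h.ne y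
  exact ⟨p, hp, hp'.symm⟩

lemma DpGood.sball {n : ℕ} {d C₀ : ℝ} {Γ : Set (Euc n)} (h : DpGood n d C₀ Γ) (y : Euc n)
    (r : ℝ) (hr : 0 < r) :
    dpS d Γ (ball y r) ≤ ENNReal.ofReal (C₀ * 2 ^ d) * ENNReal.ofReal (r ^ d) := by
  rw [Measure.restrict_apply measurableSet_ball]
  rcases (ball y r ∩ Γ).eq_empty_or_nonempty with h0 | ⟨p, hp, hpΓ⟩
  · simp [h0]
  · have hC := h.hC₀
    calc μH[d] (ball y r ∩ Γ) ≤ μH[d] (Γ ∩ ball p (2 * r)) := by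
          apply measure_mono
          rintro z ⟨hz, hzΓ⟩
          refine ⟨hzΓ, ?_⟩
          simp only [mem_ball] at hz hp ⊢
          have := dist_triangle_right z p y
          linarith
      _ ≤ ENNReal.ofReal (C₀ * (2 * r) ^ d) := (h.ar p hpΓ (2 * r) (by positivity)).2
      _ = _ := by
          rw [← ENNReal.ofReal_mul (by positivity), Real.mul_rpow (by norm_num) hr.le]
          ring_nf

lemma DpGood.locfin {n : ℕ} {d C₀ : ℝ} {Γ : Set (Euc n)} (h : DpGood n d C₀ Γ) :
    IsLocallyFiniteMeasure (dpS d Γ) := by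
  refine ⟨fun x => ⟨ball x 1, ball_mem_nhds x one_pos, ?_⟩⟩
  exact (h.sball x 1 one_pos).trans_lt (ENNReal.mul_lt_top ENNReal.ofReal_lt_top
    ENNReal.ofReal_lt_top)

lemma dp_volball {n : ℕ} (y : Euc n) (r : ℝ) (hr : 0 < r) :
    volume (ball y r) = volume (ball (0 : Euc n) 1) * ENNReal.ofReal (r ^ (n : ℝ)) := by
  rw [Measure.addHaar_ball_of_pos _ _ hr]
  simp [mul_comm]

lemma DpGood.null {n : ℕ} {d C₀ : ℝ} {Γ : Set (Euc n)} (h : DpGood n d C₀ Γ) :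
    volume Γ = 0 := by
  obtain ⟨x, hx⟩ := h.ne
  have hcov : Γ = ⋃ k : ℕ, Γ ∩ ball x ((k : ℝ) + 1) := by
    rw [← inter_iUnion]
    ext z
    simp only [mem_inter_iff, mem_iUnion, mem_ball, iff_self_and]
    intro _
    obtain ⟨k, hk⟩ := exists_nat_gt (dist z x)
    exact ⟨k, by linarith⟩
  rw [hcov]
  refine measure_iUnion_null fun k => ?_
  have h1 : μH[(n : ℝ)] (Γ ∩ ball x ((k : ℝ) + 1)) = 0 := by
    have hdn : d < (n : ℝ) := by linarith [h.hdn]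
    refine (Measure.hausdorffMeasure_zero_or_top hdn _).resolve_right ?_
    exact ne_top_of_le_ne_top ENNReal.ofReal_ne_top (h.ar x hx ((k : ℝ) + 1) (by positivity)).2
  have h2 := isAddHaarMeasure_hausdorffMeasure (E := Euc n)
  rw [finrank_euclideanSpace_fin] at h2
  exact (Measure.absolutelyContinuous_isAddHaarMeasure (volume : Measure (Euc n)) μH[(n : ℝ)]) h1

lemma dp_upper (n : ℕ) (d C₀ q : ℝ) (hd : 0 ≤ d) (hq : d < q) : ∃ C : ℝ≥0,
    ∀ Γ : Set (Euc n), DpGood n d C₀ Γ → ∀ y ∉ Γ,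
      ∫⁻ x, ENNReal.ofReal (dist x y ^ (-q)) ∂(dpS d Γ)
        ≤ C * ENNReal.ofReal (infDist y Γ ^ (d - q)) := by
  obtain ⟨C, hC⟩ := dp_far d q hd hq
  refine ⟨C * (C₀ * 2 ^ d).toNNReal, fun Γ h y hy => ?_⟩
  have h1 := hC n (dpS d Γ) y _ (h.sball y) (infDist y Γ) (h.pos hy)
  have h2 : (dpS d Γ).restrict (ball y (infDist y Γ))ᶜ = dpS d Γ := by
    apply Measure.restrict_eq_self_of_ae_mem
    rw [ae_restrict_iff' h.cl.measurableSet]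
    refine ae_of_all _ fun x hx => ?_
    simp only [mem_compl_iff, mem_ball, not_lt]
    rw [dist_comm]; exact infDist_le_dist_of_mem hx
  rw [h2] at h1
  refine h1.trans (le_of_eq ?_)
  rw [ENNReal.coe_mul]; rfl

lemma dp_lower (n : ℕ) (d C₀ q : ℝ) (hq : 0 ≤ q) : ∃ C : ℝ≥0, 0 < C ∧
    ∀ Γ : Set (Euc n), DpGood n d C₀ Γ → ∀ y ∉ Γ,
      ENNReal.ofReal (infDist y Γ ^ (d - q)) ≤
      C * ∫⁻ x in ball y (2 * infDist y Γ), ENNReal.ofReal (dist x y ^ (-q)) ∂(dpS d Γ) := by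
  refine ⟨Real.toNNReal (max 1 (C₀ * 2 ^ q)), by simp, fun Γ h y hy => ?_⟩
  have hp := h.pos hy
  have hC := h.hC₀
  rw [max_eq_right (by
    have : (1 : ℝ) ≤ 2 ^ q := Real.one_le_rpow (by norm_num) hq
    nlinarith)]
  obtain ⟨p, hpΓ, hpd⟩ := h.nearpt y
  set r := infDist y Γ with hr
  have hsub : ball p r ⊆ ball y (2 * r) := by
    intro z hz
    simp only [mem_ball] at hz ⊢
    have := dist_triangle z p y
    rw [dist_comm p y] at this
    linarith
  have h1 : ENNReal.ofReal ((2 * r) ^ (-q)) * dpS d Γ (ball p r) ≤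
      ∫⁻ x in ball y (2 * r), ENNReal.ofReal (dist x y ^ (-q)) ∂(dpS d Γ) := by
    rw [← setLIntegral_const]
    refine (lintegral_mono_set hsub).trans (lintegral_mono_ae ?_)
    rw [ae_restrict_iff' measurableSet_ball, ae_restrict_iff' h.cl.measurableSet]
    refine ae_of_all _ fun x hxΓ hx => ?_
    apply ENNReal.ofReal_le_ofReal
    have hxy : 0 < dist x y := dist_pos.2 (fun hh => hy (hh ▸ hxΓ))
    exact Real.rpow_le_rpow_of_nonpos hxy (mem_ball.1 hx).le (by linarith)
  have h2 := (h.ar p hpΓ r hp).1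
  have h3 : dpS d Γ (ball p r) = μH[d] (Γ ∩ ball p r) := by
    rw [Measure.restrict_apply measurableSet_ball, inter_comm]
  calc ENNReal.ofReal (r ^ (d - q))
      = ENNReal.ofReal (C₀ * 2 ^ q) *
        (ENNReal.ofReal ((2 * r) ^ (-q)) * ENNReal.ofReal (C₀⁻¹ * r ^ d)) := by
        rw [← ENNReal.ofReal_mul (by positivity), ← ENNReal.ofReal_mul (by positivity)]
        congr 1
        rw [Real.mul_rpow (by norm_num) hp.le, sub_eq_add_neg, Real.rpow_add hp,
          Real.rpow_neg (by norm_num : (0 : ℝ) ≤ 2)]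
        have : (2 : ℝ) ^ q ≠ 0 := by positivity
        field_simp
    _ ≤ ENNReal.ofReal (C₀ * 2 ^ q) *
        (ENNReal.ofReal ((2 * r) ^ (-q)) * dpS d Γ (ball p r)) := by
        rw [h3]; gcongr
    _ ≤ _ := mul_le_mul' le_rfl h1

lemma DpGood.invint {n : ℕ} {d C₀ : ℝ} {Γ : Set (Euc n)} (h : DpGood n d C₀ Γ) (x₀ : Euc n)
    (hx₀ : x₀ ∈ Γ) (R : ℝ) (hR : 0 < R) :
    ∫⁻ y in ball x₀ R, ENNReal.ofReal ((infDist y Γ)⁻¹) < ⊤ := by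
  have hd0 := h.hd0
  have hdn := h.hdn
  haveI := h.locfin
  obtain ⟨C, -, hC⟩ := dp_lower n d C₀ (d + 1) (by linarith)
  obtain ⟨C', hC'⟩ := dp_near n (d + 1) (by positivity) (by linarith) (by linarith)
  calc ∫⁻ y in ball x₀ R, ENNReal.ofReal ((infDist y Γ)⁻¹)
      ≤ ∫⁻ y in ball x₀ R, C * ∫⁻ x in ball x₀ (3 * R),
          ENNReal.ofReal (dist x y ^ (-(d + 1))) ∂(dpS d Γ) := by
        refine setLIntegral_mono' measurableSet_ball fun y hy => ?_
        by_cases hyΓ : y ∈ Γ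
        · rw [infDist_zero_of_mem hyΓ]; simp
        have h1 := hC Γ h y hyΓ
        rw [show d - (d + 1) = -1 by ring, Real.rpow_neg_one] at h1
        refine h1.trans ?_
        gcongr
        intro z hz
        simp only [mem_ball] at hz hy ⊢
        have h2 : infDist y Γ ≤ dist y x₀ := infDist_le_dist_of_mem hx₀
        have := dist_triangle z y x₀
        linarith
    _ = C * ∫⁻ x in ball x₀ (3 * R), ∫⁻ y in ball x₀ R,
          ENNReal.ofReal (dist x y ^ (-(d + 1))) ∂volume ∂(dpS d Γ) := by
        rw [lintegral_const_mul' _ _ (by simp), lintegral_lintegral_swap]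
        have : Measurable (Function.uncurry fun (y x : Euc n) =>
            ENNReal.ofReal (dist x y ^ (-(d + 1)))) := by
          unfold Function.uncurry; fun_prop
        exact this.aemeasurable
    _ ≤ C * ∫⁻ x in ball x₀ (3 * R), (C' * volume (ball (0 : Euc n) 1) *
          ENNReal.ofReal ((4 * R) ^ ((n : ℝ) - (d + 1)))) ∂(dpS d Γ) := by
        gcongr 1
        refine setLIntegral_mono' measurableSet_ball fun x hx => ?_
        refine le_trans ?_ (hC' n volume x _ (fun r hr => (dp_volball x r hr).le) (4 * R)
          (by positivity))
        simp_rw [dist_comm x]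
        apply lintegral_mono_set
        intro z hz
        simp only [mem_ball] at hz hx ⊢
        have := dist_triangle_right z x x₀
        linarith
    _ < ⊤ := by
        rw [setLIntegral_const]
        refine ENNReal.mul_lt_top (by simp) (ENNReal.mul_lt_top (ENNReal.mul_lt_top
          (ENNReal.mul_lt_top (by simp) measure_ball_lt_top) (by simp)) measure_ball_lt_top)

lemma dp_invdiv (s₀ c : ℝ) (hs : s₀ ∈ Icc (0 : ℝ) 1) (hc : 0 ≤ c) :
    ∫⁻ s in Icc (0 : ℝ) 1, ENNReal.ofReal ((|s - s₀| * (c + 1))⁻¹) = ⊤ := by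
  by_contra hne
  have h1 : IntervalIntegrable (fun x : ℝ => (x - s₀)⁻¹) volume 0 1 := by
    rw [intervalIntegrable_iff_integrableOn_Icc_of_le zero_le_one]
    have h2 : IntegrableOn (fun s => (|s - s₀| * (c + 1))⁻¹) (Icc (0 : ℝ) 1) := by
      refine ⟨Measurable.aestronglyMeasurable (by fun_prop), ?_⟩
      rw [hasFiniteIntegral_iff_ofReal (ae_of_all _ fun s => by positivity)]
      exact lt_top_iff_ne_top.2 hne
    have h3 := h2.mul_const (c + 1)
    refine Integrable.mono' h3 (Measurable.aestronglyMeasurable (by fun_prop))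
      (ae_of_all _ fun s => le_of_eq ?_)
    rw [norm_inv, Real.norm_eq_abs, mul_inv, mul_assoc, inv_mul_cancel₀ (by positivity), mul_one]
  rw [intervalIntegrable_sub_inv_iff] at h1
  rcases h1 with h1 | h1
  · norm_num at h1
  · rw [uIcc_of_le zero_le_one] at h1; exact h1 hs

lemma DpGood.segnull {n : ℕ} {d C₀ : ℝ} {Γ : Set (Euc n)} (h : DpGood n d C₀ Γ) (e : Euc n) :
    ∀ᵐ z : Euc n, ∀ s ∈ Icc (0 : ℝ) 1, z + s • e ∉ Γ := by
  obtain ⟨x₀, hx₀⟩ := h.ne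
  have hmeas : Measurable (Function.uncurry fun (z : Euc n) (s : ℝ) =>
      ENNReal.ofReal ((infDist (z + s • e) Γ)⁻¹)) := by
    unfold Function.uncurry
    have : Measurable fun y : Euc n => infDist y Γ := measurable_infDist
    fun_prop
  have hA : ∀ k : ℕ, ∀ᵐ z ∂(volume.restrict (ball x₀ ((k : ℝ) + 1))),
      ∫⁻ s in Icc (0 : ℝ) 1, ENNReal.ofReal ((infDist (z + s • e) Γ)⁻¹) < ⊤ := by
    intro k
    refine ae_lt_top' (Measurable.lintegral_prod_right' hmeas).aemeasurable ?_
    rw [lintegral_lintegral_swap hmeas.aemeasurable]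
    refine ne_top_of_le_ne_top ?_ (lintegral_mono_ae (g := fun _ =>
      ∫⁻ y in ball x₀ ((k : ℝ) + 1 + ‖e‖), ENNReal.ofReal ((infDist y Γ)⁻¹)) ?_)
    · rw [setLIntegral_const]
      exact (ENNReal.mul_lt_top (h.invint x₀ hx₀ _ (by positivity)) (by simp)).ne
    · rw [ae_restrict_iff' measurableSet_Icc]
      refine ae_of_all _ fun s hs => ?_
      have hmp : MeasurePreserving (fun z : Euc n => z + s • e) volume volume :=
        measurePreserving_add_right volume (s • e)
      have : Measurable fun y : Euc n => infDist y Γ := measurable_infDist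
      rw [← hmp.setLIntegral_comp_preimage (f := fun y => ENNReal.ofReal ((infDist y Γ)⁻¹))
        measurableSet_ball (by fun_prop)]
      apply lintegral_mono_set (f := fun a => ENNReal.ofReal ((infDist (a + s • e) Γ)⁻¹))
      intro z hz
      simp only [mem_preimage, mem_ball] at hz ⊢
      rw [dist_eq_norm] at hz ⊢
      have h1 : ‖z + s • e - x₀‖ ≤ ‖z - x₀‖ + ‖s • e‖ := by
        rw [add_sub_right_comm]; exact norm_add_le _ _
      have h2 : ‖s • e‖ ≤ ‖e‖ := by
        rw [norm_smul, Real.norm_eq_abs, abs_of_nonneg hs.1]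
        nlinarith [norm_nonneg e, hs.2]
      linarith
  have hA' : ∀ᵐ z : Euc n,
      ∫⁻ s in Icc (0 : ℝ) 1, ENNReal.ofReal ((infDist (z + s • e) Γ)⁻¹) < ⊤ := by
    have h2 : ∀ᵐ z : Euc n, ∀ k : ℕ, z ∈ ball x₀ ((k : ℝ) + 1) →
      ∫⁻ s in Icc (0 : ℝ) 1, ENNReal.ofReal ((infDist (z + s • e) Γ)⁻¹) < ⊤ := by
      rw [ae_all_iff]
      intro k
      exact (ae_restrict_iff' measurableSet_ball).1 (hA k)
    filter_upwards [h2] with z hz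
    obtain ⟨k, hk⟩ := exists_nat_gt (dist z x₀)
    exact hz k (by simp only [mem_ball]; linarith)
  have hB : ∀ᵐ z : Euc n, ∀ᵐ s ∂(volume.restrict (Icc (0 : ℝ) 1)), z + s • e ∉ Γ := by
    have hm : MeasurableSet {p : Euc n × ℝ | p.1 + p.2 • e ∉ Γ} := by
      have : Measurable fun p : Euc n × ℝ => p.1 + p.2 • e := by fun_prop
      exact (this h.cl.measurableSet).compl
    have hsw : ∀ᵐ s ∂(volume.restrict (Icc (0 : ℝ) 1)), ∀ᵐ z : Euc n, z + s • e ∉ Γ := by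
      refine ae_of_all _ fun s => ?_
      have hmp : MeasurePreserving (fun z : Euc n => z + s • e) volume volume :=
        measurePreserving_add_right volume (s • e)
      exact hmp.quasiMeasurePreserving.ae (p := fun y => y ∉ Γ)
        (by rw [ae_iff]; simpa using h.null)
    have := (Measure.ae_ae_comm (p := fun (z : Euc n) (s : ℝ) => z + s • e ∉ Γ)
      (μ := volume) (ν := volume.restrict (Icc (0 : ℝ) 1)) hm).2 hsw
    exact this
  filter_upwards [hA', hB] with z hz1 hz2 s₀ hs₀ hmem
  refine absurd hz1 (not_lt.2 ?_)
  rw [← dp_invdiv s₀ ‖e‖ hs₀ (norm_nonneg e)]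
  refine lintegral_mono_ae ?_
  filter_upwards [hz2] with s hs
  apply ENNReal.ofReal_le_ofReal
  refine inv_anti₀ (h.pos hs) ?_
  calc infDist (z + s • e) Γ ≤ dist (z + s • e) (z + s₀ • e) := infDist_le_dist_of_mem hmem
    _ = |s - s₀| * ‖e‖ := by
        rw [dist_eq_norm, add_sub_add_left_eq_sub, ← sub_smul, norm_smul, Real.norm_eq_abs]
    _ ≤ _ := by gcongr; linarith
lemma DpGood.restr {n : ℕ} {d C₀ : ℝ} {Γ : Set (Euc n)} (h : DpGood n d C₀ Γ) :
    (volume : Measure (Euc n)).restrict Γᶜ = volume :=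
  Measure.restrict_eq_self_of_ae_mem (by rw [ae_iff]; simpa using h.null)

/-- scalar form of the distributional gradient -/
def DpGrad {n : ℕ} (u : Euc n → ℝ) (v : Euc n → Euc n) (Γ : Set (Euc n)) : Prop :=
  ∀ φ : Euc n → ℝ, ContDiff ℝ (⊤ : ℕ∞) φ → HasCompactSupport φ → tsupport φ ⊆ Γᶜ →
    ∀ e : Euc n, ∫ x, u x * fderiv ℝ φ x e = -∫ x, φ x * inner ℝ (v x) e

lemma dp_cont_gradient {n : ℕ} {φ : Euc n → ℝ} (hφ : ContDiff ℝ (⊤ : ℕ∞) φ) :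
    Continuous (gradient φ) := by
  have h1 : Continuous (fderiv ℝ φ) := hφ.continuous_fderiv (by simp)
  unfold gradient
  exact (LinearIsometryEquiv.continuous _).comp h1

lemma dp_cs_gradient {n : ℕ} {φ : Euc n → ℝ} (hφ : HasCompactSupport φ) :
    HasCompactSupport (gradient φ) := by
  have h1 : HasCompactSupport (fderiv ℝ φ) := hφ.fderiv ℝ
  unfold gradient
  exact h1.comp_left (g := fun L => (InnerProductSpace.toDual ℝ (Euc n)).symm L) (by simp)

lemma dp_grad_iff {n : ℕ} {d C₀ : ℝ} {Γ : Set (Euc n)} (h : DpGood n d C₀ Γ)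
    {u : Euc n → ℝ} {v : Euc n → Euc n} (hu : LocallyIntegrable u) (hv : LocallyIntegrable v) :
    IsDistribGradOn u v Γᶜ ↔ DpGrad u v Γ := by
  unfold IsDistribGradOn DpGrad
  rw [h.restr]
  have key : ∀ φ : Euc n → ℝ, ContDiff ℝ (⊤ : ℕ∞) φ → HasCompactSupport φ → ∀ e : Euc n,
      inner ℝ (∫ x, u x • gradient φ x) e = ∫ x, u x * fderiv ℝ φ x e ∧
      inner ℝ (-∫ x, φ x • v x) e = -∫ x, φ x * inner ℝ (v x) e := by
    intro φ h1 h2 e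
    have i1 : Integrable (fun x => u x • gradient φ x) :=
      hu.integrable_smul_right_of_hasCompactSupport (dp_cont_gradient h1) (dp_cs_gradient h2)
    have i2 : Integrable (fun x => φ x • v x) :=
      hv.integrable_smul_left_of_hasCompactSupport h1.continuous h2
    constructor
    · rw [real_inner_comm, ← integral_inner i1]
      congr 1; ext x
      rw [real_inner_smul_right, real_inner_comm, inner_gradient_left]
    · rw [inner_neg_left, real_inner_comm, ← integral_inner i2]
      congr 2; ext x
      rw [real_inner_smul_right, real_inner_comm]
  constructor
  · intro H φ h1 h2 h3 e
    rw [← (key φ h1 h2 e).1, ← (key φ h1 h2 e).2, H φ h1 h2 h3]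
  · intro H φ h1 h2 h3
    refine ext_inner_right ℝ fun e => ?_
    rw [(key φ h1 h2 e).1, (key φ h1 h2 e).2, H φ h1 h2 h3]

lemma dp_shear {n : ℕ} {E : Type*} [NormedAddCommGroup E] {v : Euc n → E}
    (hm : StronglyMeasurable v) (hv : LocallyIntegrable v) (c : Euc n) (R : ℝ) (e : Euc n) :
    Integrable (fun p : Euc n × ℝ => v (p.1 + p.2 • e))
      ((volume.restrict (ball c R)).prod (volume.restrict (Icc (0 : ℝ) 1))) := by
  have hmeas : Measurable fun p : Euc n × ℝ => p.1 + p.2 • e := by fun_prop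
  have hm1 : StronglyMeasurable fun p : Euc n × ℝ => v (p.1 + p.2 • e) :=
    hm.comp_measurable hmeas
  refine ⟨hm1.aestronglyMeasurable, ?_⟩
  unfold HasFiniteIntegral
  rw [lintegral_prod_symm _ hm1.enorm.aemeasurable]
  have hfin : ∫⁻ y in ball c (R + ‖e‖), ‖v y‖ₑ < ⊤ := by
    have : IntegrableOn v (ball c (R + ‖e‖)) :=
      (hv.integrableOn_isCompact (isCompact_closedBall c (R + ‖e‖))).mono_set ball_subset_closedBall
    exact this.2
  refine lt_of_le_of_lt (lintegral_mono_ae (g := fun _ =>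
      ∫⁻ y in ball c (R + ‖e‖), ‖v y‖ₑ) ?_) ?_
  · rw [ae_restrict_iff' measurableSet_Icc]
    refine ae_of_all _ fun s hs => ?_
    have hmp : MeasurePreserving (fun z : Euc n => z + s • e) volume volume :=
      measurePreserving_add_right volume (s • e)
    rw [← hmp.setLIntegral_comp_preimage (f := fun y => ‖v y‖ₑ)
      measurableSet_ball hm.enorm]
    apply lintegral_mono_set (f := fun z => ‖v (z + s • e)‖ₑ)
    intro z hz
    simp only [mem_preimage, mem_ball] at hz ⊢
    rw [dist_eq_norm] at hz ⊢
    have h1 : ‖z + s • e - c‖ ≤ ‖z - c‖ + ‖s • e‖ := by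
      rw [add_sub_right_comm]; exact norm_add_le _ _
    have h2 : ‖s • e‖ ≤ ‖e‖ := by
      rw [norm_smul, Real.norm_eq_abs, abs_of_nonneg hs.1]
      nlinarith [norm_nonneg e, hs.2]
    linarith
  · rw [setLIntegral_const]
    exact ENNReal.mul_lt_top hfin (by simp)

open scoped Pointwise in
lemma dp_diff {n : ℕ} {d C₀ : ℝ} {Γ : Set (Euc n)} (h : DpGood n d C₀ Γ)
    {u : Euc n → ℝ} {v : Euc n → Euc n} (hum : StronglyMeasurable u) (hvm : StronglyMeasurable v)
    (hu : LocallyIntegrable u) (hv : LocallyIntegrable v) (hg : DpGrad u v Γ) (e : Euc n) :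
    ∀ᵐ z, u (z + e) - u z = ∫ s in Icc (0 : ℝ) 1, inner ℝ (v (z + s • e)) e := by
  set U : Set (Euc n) := {z | ∀ s ∈ Icc (0 : ℝ) 1, z + s • e ∉ Γ} with hU
  have hUo : IsOpen U := by
    have hK : IsCompact ((fun s : ℝ => -(s • e)) '' Icc (0 : ℝ) 1) :=
      isCompact_Icc.image (by fun_prop)
    have hcl := h.cl.add_right_of_isCompact hK
    have : U = (Γ + (fun s : ℝ => -(s • e)) '' Icc (0 : ℝ) 1)ᶜ := by
      ext z
      simp only [hU, mem_setOf_eq, mem_compl_iff, Set.mem_add, not_exists, not_and]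
      constructor
      · rintro H x hx y ⟨s, hs, rfl⟩ hz
        apply H s hs
        have : z + s • e = x := by rw [← hz]; simp
        rwa [this]
      · intro H s hs hz
        exact H _ hz _ ⟨s, hs, rfl⟩ (by simp)
    rw [this]; exact hcl.isOpen_compl
  have huint : ∀ R, IntegrableOn (fun z => u (z + e)) (ball (0 : Euc n) R) := by
    intro R
    have hmp : MeasurePreserving (fun z : Euc n => z + e) volume volume :=
      measurePreserving_add_right volume e
    have h1 : IntegrableOn u (closedBall 0 (R + ‖e‖)) :=
      hu.integrableOn_isCompact (isCompact_closedBall _ _)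
    have h2 := (hmp.integrableOn_comp_preimage (measurableEmbedding_addRight e)).2 h1
    refine h2.mono_set ?_
    intro z hz
    simp only [mem_preimage, mem_ball, mem_closedBall, dist_zero_right] at hz ⊢
    exact (norm_add_le _ _).trans (by linarith)
  have hvint := fun R => dp_shear hvm hv 0 R e
  have hvint' : ∀ R, Integrable (fun p : Euc n × ℝ => inner ℝ (v (p.1 + p.2 • e)) e)
      ((volume.restrict (ball (0 : Euc n) R)).prod (volume.restrict (Icc (0 : ℝ) 1))) :=
    fun R => (hvint R).inner_const e
  have hli : LocallyIntegrable fun z => u (z + e) - u z -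
      ∫ s in Icc (0 : ℝ) 1, inner ℝ (v (z + s • e)) e := by
    rw [locallyIntegrable_iff]
    intro K hK
    obtain ⟨R, hR⟩ := hK.isBounded.subset_ball 0
    refine IntegrableOn.mono_set ?_ hR
    exact ((huint R).sub ((hu.integrableOn_isCompact (isCompact_closedBall 0 R)).mono_set
      ball_subset_closedBall)).sub (hvint' R).integral_prod_left
  have main := hUo.ae_eq_zero_of_integral_contDiff_smul_eq_zero (μ := volume)
    (hli.locallyIntegrableOn U) ?_
  · filter_upwards [main, h.segnull e] with z h1 h2
    have := h1 h2
    linarith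
  intro φ hφ hφc hφs
  obtain ⟨R, hR⟩ := hφc.isCompact.isBounded.subset_ball 0
  obtain ⟨M, hM⟩ := hφc.exists_bound_of_continuous hφ.continuous
  have hfc : Continuous (fderiv ℝ φ) := hφ.continuous_fderiv (by simp)
  obtain ⟨M', hM'⟩ := (hφc.fderiv ℝ).exists_bound_of_continuous hfc
  have hφ0 : ∀ z ∉ ball (0 : Euc n) R, φ z = 0 := fun z hz =>
    image_eq_zero_of_notMem_tsupport (fun hh => hz (hR hh))
  have hdφ0 : ∀ z ∉ ball (0 : Euc n) R, fderiv ℝ φ z = 0 := fun z hz =>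
    image_eq_zero_of_notMem_tsupport (fun hh => hz (hR (tsupport_fderiv_subset ℝ hh)))
  -- shifted test functions
  have hshift : ∀ s ∈ Icc (0 : ℝ) 1, ∫ z, u z * fderiv ℝ φ (z - s • e) e =
      - ∫ z, φ z * inner ℝ (v (z + s • e)) e := by
    intro s hs
    have t1 : ContDiff ℝ (⊤ : ℕ∞) (fun z => φ (z - s • e)) := hφ.comp (by fun_prop)
    have t2 : HasCompactSupport (fun z => φ (z - s • e)) :=
      hφc.comp_homeomorph (Homeomorph.subRight (s • e))
    have t3 : tsupport (fun z => φ (z - s • e)) ⊆ Γᶜ := by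
      have : tsupport (fun z => φ (z - s • e)) ⊆ (fun z => z - s • e) ⁻¹' tsupport φ :=
        closure_minimal (fun z hz => subset_tsupport φ hz)
          ((isClosed_tsupport φ).preimage (by fun_prop))
      intro z hz
      have := hφs (this hz) s hs
      simpa using this
    have t4 := hg _ t1 t2 t3 e
    have t5 : ∀ z, fderiv ℝ (fun z => φ (z - s • e)) z = fderiv ℝ φ (z - s • e) := fun z =>
      by simpa [sub_eq_add_neg] using fderiv_comp_add_right (𝕜 := ℝ) (f := φ) (x := z) (-(s • e))
    simp_rw [t5] at t4
    rw [t4, ← integral_add_right_eq_self (fun z => φ (z - s • e) * inner ℝ (v z) e) (s • e)]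
    simp
  have hftc : ∀ z, φ (z - e) - φ z = - ∫ s in Icc (0 : ℝ) 1, fderiv ℝ φ (z - s • e) e := by
    intro z
    have hd : ∀ s : ℝ, HasDerivAt (fun s : ℝ => φ (z - s • e)) (-(fderiv ℝ φ (z - s • e) e)) s := by
      intro s
      have a1 : HasFDerivAt φ (fderiv ℝ φ (z - s • e)) (z - s • e) :=
        (hφ.differentiable (by simp) _).hasFDerivAt
      have a2 : HasDerivAt (fun s : ℝ => z - s • e) (-e) s := by
        simpa using ((hasDerivAt_id s).smul_const e).const_sub z
      have := a1.comp_hasDerivAt s a2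
      rw [map_neg] at this
      exact this
    have hcont : Continuous fun s : ℝ => -(fderiv ℝ φ (z - s • e) e) := by fun_prop
    have := intervalIntegral.integral_eq_sub_of_hasDerivAt (a := 0) (b := 1)
      (fun s _ => hd s) (hcont.intervalIntegrable 0 1)
    simp only [one_smul, zero_smul, sub_zero] at this
    rw [← this, intervalIntegral.integral_of_le zero_le_one, integral_Icc_eq_integral_Ioc,
      integral_neg]
  have hI1 : Integrable (fun p : Euc n × ℝ => u p.1 * fderiv ℝ φ (p.1 - p.2 • e) e)
      (volume.prod (volume.restrict (Icc (0 : ℝ) 1))) := by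
    have hb : Integrable ((ball (0 : Euc n) (R + ‖e‖)).indicator u) :=
      ((hu.integrableOn_isCompact (isCompact_closedBall 0 (R + ‖e‖))).mono_set
        ball_subset_closedBall).integrable_indicator measurableSet_ball
    have hb2 : Integrable (fun p : Euc n × ℝ => ‖(ball (0 : Euc n) (R + ‖e‖)).indicator u p.1‖ *
        (M' * ‖e‖)) (volume.prod (volume.restrict (Icc (0 : ℝ) 1))) :=
      (hb.norm.mul_prod (integrable_const (M' * ‖e‖)))
    refine hb2.mono' ?_ ?_
    · refine StronglyMeasurable.aestronglyMeasurable ?_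
      have : Continuous fun p : Euc n × ℝ => fderiv ℝ φ (p.1 - p.2 • e) e := by fun_prop
      exact (hum.comp_measurable measurable_fst).mul this.stronglyMeasurable
    · have hae : ∀ᵐ p : Euc n × ℝ ∂(volume.prod (volume.restrict (Icc (0 : ℝ) 1))),
          p.2 ∈ Icc (0 : ℝ) 1 :=
        Measure.quasiMeasurePreserving_snd.ae (ae_restrict_mem measurableSet_Icc)
      filter_upwards [hae] with p hp
      by_cases hpb : p.1 ∈ ball (0 : Euc n) (R + ‖e‖)
      · rw [indicator_of_mem hpb, norm_mul]
        gcongr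
        exact (ContinuousLinearMap.le_opNorm _ _).trans (by gcongr; exact hM' _)
      · have : p.1 - p.2 • e ∉ ball (0 : Euc n) R := by
          intro hh
          apply hpb
          simp only [mem_ball, dist_zero_right] at hh ⊢
          have h2 : ‖p.2 • e‖ ≤ ‖e‖ := by
            rw [norm_smul, Real.norm_eq_abs, abs_of_nonneg hp.1]
            nlinarith [norm_nonneg e, hp.2]
          have h3 := norm_add_le (p.1 - p.2 • e) (p.2 • e)
          rw [sub_add_cancel] at h3
          linarith
        rw [hdφ0 _ this]
        simp only [ContinuousLinearMap.zero_apply, mul_zero, norm_zero]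
        have : 0 ≤ M' := (norm_nonneg _).trans (hM' 0)
        positivity
  have hI2 : Integrable (fun p : Euc n × ℝ => φ p.1 * inner ℝ (v (p.1 + p.2 • e)) e)
      (volume.prod (volume.restrict (Icc (0 : ℝ) 1))) := by
    have h1 : Integrable (fun p : Euc n × ℝ => φ p.1 * inner ℝ (v (p.1 + p.2 • e)) e)
      ((volume.restrict (ball (0 : Euc n) R)).prod (volume.restrict (Icc (0 : ℝ) 1))) :=
      (hvint' R).bdd_mul (c := M) (by
        have : Continuous fun p : Euc n × ℝ => φ p.1 := hφ.continuous.comp continuous_fst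
        exact this.aestronglyMeasurable) (ae_of_all _ fun p => hM p.1)
    have h2 : (volume.restrict (ball (0 : Euc n) R)).prod (volume.restrict (Icc (0 : ℝ) 1)) =
        (volume.prod (volume.restrict (Icc (0 : ℝ) 1))).restrict (ball (0 : Euc n) R ×ˢ univ) := by
      rw [← Measure.prod_restrict, Measure.restrict_univ]
    rw [h2] at h1
    refine (integrableOn_iff_integrable_of_support_subset ?_).1 h1
    intro p hp
    refine ⟨?_, mem_univ _⟩
    by_contra hh
    exact hp (by simp [hφ0 _ hh])
  have hLu : Integrable fun z => φ z * u z :=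
    hu.integrable_smul_left_of_hasCompactSupport hφ.continuous hφc
  have hLu2 : Integrable fun z => φ (z - e) * u z :=
    hu.integrable_smul_left_of_hasCompactSupport (hφ.continuous.comp (by fun_prop))
      (hφc.comp_homeomorph (Homeomorph.subRight e))
  have hLu3 : Integrable fun z => φ z * u (z + e) := by
    have := hLu2.comp_add_right e
    simpa using this
  have hLv : Integrable fun z => φ z * ∫ s in Icc (0 : ℝ) 1, inner ℝ (v (z + s • e)) e := by
    have := hI2.integral_prod_left
    simpa only [integral_const_mul] using this
  have e1 : ∫ z, φ z * u (z + e) = ∫ z, φ (z - e) * u z := by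
    rw [← integral_add_right_eq_self (fun z => φ (z - e) * u z) e]
    simp
  have e2 : ∫ z, (φ (z - e) - φ z) * u z =
      ∫ z, φ z * ∫ s in Icc (0 : ℝ) 1, inner ℝ (v (z + s • e)) e := by
    calc ∫ z, (φ (z - e) - φ z) * u z
        = ∫ z, - ∫ s in Icc (0 : ℝ) 1, u z * fderiv ℝ φ (z - s • e) e := by
          congr 1; ext z
          rw [hftc, integral_const_mul]; ring
      _ = - ∫ s in Icc (0 : ℝ) 1, ∫ z, u z * fderiv ℝ φ (z - s • e) e := by
          rw [integral_neg, integral_integral_swap hI1]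
      _ = - ∫ s in Icc (0 : ℝ) 1, - ∫ z, φ z * inner ℝ (v (z + s • e)) e := by
          congr 1
          exact setIntegral_congr_fun measurableSet_Icc hshift
      _ = ∫ z, ∫ s in Icc (0 : ℝ) 1, φ z * inner ℝ (v (z + s • e)) e := by
          rw [integral_neg, neg_neg, ← integral_integral_swap hI2]
      _ = _ := by simp_rw [integral_const_mul]
  have e3 : ∫ z, (φ (z - e) - φ z) * u z = (∫ z, φ (z - e) * u z) - ∫ z, φ z * u z := by
    rw [← integral_sub hLu2 hLu]
    congr 1; ext z; ring
  calc ∫ z, φ z • (u (z + e) - u z - ∫ s in Icc (0 : ℝ) 1, inner ℝ (v (z + s • e)) e)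
      = ∫ z, (φ z * u (z + e) - φ z * u z -
          φ z * ∫ s in Icc (0 : ℝ) 1, inner ℝ (v (z + s • e)) e) := by
        congr 1; ext z; rw [smul_eq_mul]; ring
    _ = 0 := by
        rw [integral_sub _ hLv, integral_sub hLu3 hLu, e1, ← e2, e3, sub_self]
        exact hLu3.sub hLu
lemma dp_scale {n : ℕ} {f : Euc n → ℝ≥0∞} (hf : Measurable f) (s : ℝ) (hs : 0 < s) :
    ∫⁻ e, f (s • e) = ENNReal.ofReal ((s ^ n)⁻¹) * ∫⁻ p, f p := by
  have h1 := Measure.map_addHaar_smul (volume : Measure (Euc n)) hs.ne'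
  rw [← lintegral_map hf (by fun_prop : Measurable fun e : Euc n => s • e), h1, lintegral_smul_measure]
  rw [finrank_euclideanSpace_fin, abs_of_pos (by positivity), smul_eq_mul]

lemma dp_l2loc {n : ℕ} {E : Type*} [NormedAddCommGroup E] {f : Euc n → E} (x₀ : Euc n)
    (hf : AEStronglyMeasurable f volume)
    (h : ∀ R : ℝ, 0 < R → ∫⁻ y in ball x₀ R, ‖f y‖ₑ ^ 2 < ⊤) : LocallyIntegrable f := by
  rw [locallyIntegrable_iff]
  intro K hK
  obtain ⟨R, hR⟩ := hK.isBounded.subset_ball x₀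
  have hR' : K ⊆ ball x₀ (max R 1) := hR.trans (ball_subset_ball (le_max_left _ _))
  refine IntegrableOn.mono_set ⟨hf.restrict, ?_⟩ hR'
  have h1 := dp_jensen (volume.restrict (ball x₀ (max R 1))) (f := fun y => ‖f y‖ₑ) hf.enorm.restrict
  have h2 : (∫⁻ y in ball x₀ (max R 1), ‖f y‖ₑ) ^ 2 < ⊤ := by
    refine h1.trans_lt (ENNReal.mul_lt_top ?_ (h _ (by positivity)))
    rw [Measure.restrict_apply_univ]
    exact measure_ball_lt_top
  unfold HasFiniteIntegral
  by_contra h3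
  rw [not_lt_top_iff] at h3
  rw [h3] at h2
  simp at h2

lemma dp_wball {n : ℕ} {d C₀ : ℝ} {Γ : Set (Euc n)} (h : DpGood n d C₀ Γ) {a : ℝ} (ha : a ≤ 0)
    {f : Euc n → ℝ≥0∞} {x₀ : Euc n} (hx₀ : x₀ ∈ Γ) {R : ℝ} (hR : 0 < R) :
    ∫⁻ y in ball x₀ R, f y ≤ ENNReal.ofReal (R ^ (-a)) *
      ∫⁻ y, f y * ENNReal.ofReal (infDist y Γ ^ a) := by
  have hnull : ∀ᵐ y : Euc n, y ∉ Γ := by rw [ae_iff]; simpa using h.null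
  calc ∫⁻ y in ball x₀ R, f y ≤ ∫⁻ y in ball x₀ R, ENNReal.ofReal (R ^ (-a)) *
      (f y * ENNReal.ofReal (infDist y Γ ^ a)) := by
        refine lintegral_mono_ae ?_
        filter_upwards [ae_restrict_mem measurableSet_ball, ae_restrict_of_ae hnull] with y hy hyΓ
        have hp := h.pos hyΓ
        have hle : infDist y Γ ≤ R := (infDist_le_dist_of_mem hx₀).trans hy.le
        have h1 : (1 : ℝ≥0∞) ≤ ENNReal.ofReal (R ^ (-a)) * ENNReal.ofReal (infDist y Γ ^ a) := by
          rw [← ENNReal.ofReal_mul (by positivity), ENNReal.one_le_ofReal]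
          have : R ^ a ≤ infDist y Γ ^ a := Real.rpow_le_rpow_of_nonpos hp hle ha
          calc (1 : ℝ) = R ^ (-a) * R ^ a := by rw [← Real.rpow_add hR]; simp
            _ ≤ _ := by gcongr
        calc f y = 1 * f y := by rw [one_mul]
          _ ≤ (ENNReal.ofReal (R ^ (-a)) * ENNReal.ofReal (infDist y Γ ^ a)) * f y := by gcongr
          _ = _ := by ring
    _ ≤ ∫⁻ y, ENNReal.ofReal (R ^ (-a)) * (f y * ENNReal.ofReal (infDist y Γ ^ a)) :=
        setLIntegral_le_lintegral _ _
    _ = _ := lintegral_const_mul' _ _ ENNReal.ofReal_ne_top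

lemma dp_wloc {n : ℕ} {d C₀ : ℝ} {Γ : Set (Euc n)} (h : DpGood n d C₀ Γ) {a : ℝ} (ha : a ≤ 0)
    {E : Type*} [NormedAddCommGroup E] {f : Euc n → E} (hf : AEStronglyMeasurable f volume)
    (hfi : ∫⁻ y, ‖f y‖ₑ ^ 2 * ENNReal.ofReal (infDist y Γ ^ a) < ⊤) : LocallyIntegrable f := by
  obtain ⟨x₀, hx₀⟩ := h.ne
  exact dp_l2loc x₀ hf fun R hR => (dp_wball h ha hx₀ hR).trans_lt
    (ENNReal.mul_lt_top ENNReal.ofReal_lt_top hfi)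

lemma dp_ne {n : ℕ} (hn : 2 ≤ n) (x : Euc n) : ∀ᵐ y : Euc n, y ≠ x := by
  haveI : Nonempty (Fin n) := ⟨⟨0, by omega⟩⟩
  rw [ae_iff]; simp

lemma dp_traceT {n : ℕ} (hn : 2 ≤ n) {f : Euc n → ℝ} (x : Euc n) (c : ℝ)
    (hf : AEStronglyMeasurable f volume)
    (hF : ∫⁻ y, ‖f y - c‖ₑ ^ 2 * ENNReal.ofReal (dist x y ^ (-((n : ℝ) + 1))) < ⊤) :
    LocallyIntegrable f ∧ HasTraceAt f x c := by
  set F := ∫⁻ y, ‖f y - c‖ₑ ^ 2 * ENNReal.ofReal (dist x y ^ (-((n : ℝ) + 1))) with hFd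
  have hfc : AEStronglyMeasurable (fun y => f y - c) volume := hf.sub aestronglyMeasurable_const
  have hb : ∀ R : ℝ, 0 < R → ∫⁻ y in ball x R, ‖f y - c‖ₑ ^ 2 ≤
      ENNReal.ofReal (R ^ ((n : ℝ) + 1)) * F := by
    intro R hR
    calc ∫⁻ y in ball x R, ‖f y - c‖ₑ ^ 2 ≤ ∫⁻ y in ball x R, ENNReal.ofReal (R ^ ((n : ℝ) + 1)) *
        (‖f y - c‖ₑ ^ 2 * ENNReal.ofReal (dist x y ^ (-((n : ℝ) + 1)))) := by
          refine lintegral_mono_ae ?_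
          filter_upwards [ae_restrict_mem measurableSet_ball, ae_restrict_of_ae (dp_ne hn x)]
            with y hy hyΓ
          have hp : 0 < dist x y := dist_pos.2 hyΓ.symm
          have hle : dist x y ≤ R := by rw [dist_comm]; exact hy.le
          have h1 : (1 : ℝ≥0∞) ≤ ENNReal.ofReal (R ^ ((n : ℝ) + 1)) *
              ENNReal.ofReal (dist x y ^ (-((n : ℝ) + 1))) := by
            rw [← ENNReal.ofReal_mul (by positivity), ENNReal.one_le_ofReal]
            have : R ^ (-((n : ℝ) + 1)) ≤ dist x y ^ (-((n : ℝ) + 1)) :=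
              Real.rpow_le_rpow_of_nonpos hp hle (by linarith [(Nat.cast_nonneg n : (0:ℝ) ≤ n)])
            calc (1 : ℝ) = R ^ ((n : ℝ) + 1) * R ^ (-((n : ℝ) + 1)) := by
                  rw [← Real.rpow_add hR]; simp
              _ ≤ _ := by gcongr
          calc ‖f y - c‖ₑ ^ 2 = 1 * ‖f y - c‖ₑ ^ 2 := by rw [one_mul]
            _ ≤ (ENNReal.ofReal (R ^ ((n : ℝ) + 1)) *
              ENNReal.ofReal (dist x y ^ (-((n : ℝ) + 1)))) * ‖f y - c‖ₑ ^ 2 := by gcongr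
            _ = _ := by ring
      _ ≤ _ := setLIntegral_le_lintegral _ _
      _ = _ := lintegral_const_mul' _ _ ENNReal.ofReal_ne_top
  have hli0 : LocallyIntegrable fun y => f y - c :=
    dp_l2loc x hfc fun R hR => (hb R hR).trans_lt (ENNReal.mul_lt_top ENNReal.ofReal_lt_top hF)
  have hli : LocallyIntegrable f := by
    have := hli0.add (locallyIntegrable_const (c : ℝ))
    have e : ((fun y => f y - c) + fun _ => c) = f := by ext y; simp
    rwa [e] at this
  refine ⟨hli, ?_⟩
  have hv0 : (volume (ball (0 : Euc n) 1)) ≠ 0 := (measure_ball_pos _ _ one_pos).ne'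
  have hvt : (volume (ball (0 : Euc n) 1)) ≠ ⊤ := measure_ball_lt_top.ne
  unfold HasTraceAt
  rw [tendsto_iff_edist_tendsto_0]
  have hlim : Tendsto (fun ρ : ℝ => ((volume (ball (0 : Euc n) 1))⁻¹ * ENNReal.ofReal ρ * F) ^ (1/2 : ℝ))
      (𝓝[>] 0) (𝓝 0) := by
    have h1 : Tendsto (fun ρ : ℝ => ENNReal.ofReal ρ) (𝓝[>] 0) (𝓝 0) := by
      have := (ENNReal.continuous_ofReal.tendsto 0).mono_left (nhdsWithin_le_nhds (s := Ioi (0:ℝ)))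
      simpa using this
    have h2 : Tendsto (fun ρ : ℝ => (volume (ball (0 : Euc n) 1))⁻¹ * ENNReal.ofReal ρ) (𝓝[>] 0)
        (𝓝 0) := by
      have := ENNReal.Tendsto.const_mul (a := (volume (ball (0 : Euc n) 1))⁻¹) h1
        (Or.inr (ENNReal.inv_ne_top.2 hv0))
      simpa using this
    have h3 := ENNReal.Tendsto.mul_const (b := F) h2 (Or.inr hF.ne)
    have h4 := h3.ennrpow_const (1/2 : ℝ)
    simpa using h4
  refine tendsto_of_tendsto_of_tendsto_of_le_of_le' tendsto_const_nhds hlim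
    (Eventually.of_forall fun _ => zero_le) ?_
  filter_upwards [self_mem_nhdsWithin] with ρ hρ
  have hρ : 0 < ρ := hρ
  have hV0 : volume (ball x ρ) ≠ 0 := (measure_ball_pos _ _ hρ).ne'
  have hVt : volume (ball x ρ) ≠ ⊤ := measure_ball_lt_top.ne
  have hi : IntegrableOn f (ball x ρ) :=
    (hli.integrableOn_isCompact (isCompact_closedBall x ρ)).mono_set ball_subset_closedBall
  have e1 : (⨍ y in ball x ρ, f y) - c = ⨍ y in ball x ρ, (f y - c) := by
    rw [setAverage_eq, setAverage_eq, integral_sub hi (integrableOn_const hVt)]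
    rw [setIntegral_const, smul_sub, smul_smul]
    rw [Measure.real, inv_mul_cancel₀ (ENNReal.toReal_ne_zero.2 ⟨hV0, hVt⟩), one_smul]
  rw [edist_eq_enorm_sub, e1]
  have e2 : ‖⨍ y in ball x ρ, (f y - c)‖ₑ ≤ (volume (ball x ρ))⁻¹ * ∫⁻ y in ball x ρ, ‖f y - c‖ₑ := by
    rw [setAverage_eq, enorm_smul]
    gcongr
    · rw [Real.enorm_eq_ofReal (by positivity), Measure.real, ← ENNReal.toReal_inv,
        ENNReal.ofReal_toReal (ENNReal.inv_ne_top.2 hV0)]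
    · exact enorm_integral_le_lintegral_enorm _
  have e3 := dp_jensen (volume.restrict (ball x ρ)) (f := fun y => ‖f y - c‖ₑ) hfc.enorm.restrict
  rw [Measure.restrict_apply_univ] at e3
  have e4 : (‖⨍ y in ball x ρ, (f y - c)‖ₑ) ^ 2 ≤
      (volume (ball (0 : Euc n) 1))⁻¹ * ENNReal.ofReal ρ * F := by
    calc (‖⨍ y in ball x ρ, (f y - c)‖ₑ) ^ 2
        ≤ ((volume (ball x ρ))⁻¹ * ∫⁻ y in ball x ρ, ‖f y - c‖ₑ) ^ 2 := by gcongr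
      _ ≤ ((volume (ball x ρ))⁻¹) ^ 2 * (volume (ball x ρ) *
          (ENNReal.ofReal (ρ ^ ((n : ℝ) + 1)) * F)) := by
          rw [mul_pow]; gcongr
          exact e3.trans (by gcongr; exact hb ρ hρ)
      _ = ((volume (ball x ρ))⁻¹ * volume (ball x ρ)) * ((volume (ball x ρ))⁻¹ *
          ENNReal.ofReal (ρ ^ ((n : ℝ) + 1))) * F := by ring
      _ = _ := by
          rw [ENNReal.inv_mul_cancel hV0 hVt, one_mul, dp_volball x ρ hρ,
            ENNReal.mul_inv (Or.inl hv0) (Or.inl hvt), mul_assoc _ _ (ENNReal.ofReal _),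
            Real.rpow_add hρ, Real.rpow_one, ENNReal.ofReal_mul (by positivity),
            ← mul_assoc (ENNReal.ofReal (ρ ^ (n : ℝ)))⁻¹, ENNReal.inv_mul_cancel, one_mul]
          · simpa using pow_pos hρ n
          · exact ENNReal.ofReal_ne_top
  calc ‖⨍ y in ball x ρ, (f y - c)‖ₑ = ((‖⨍ y in ball x ρ, (f y - c)‖ₑ) ^ 2) ^ (1/2 : ℝ) := by
        rw [← ENNReal.rpow_natCast, ← ENNReal.rpow_mul]; norm_num
    _ ≤ _ := by gcongr
lemma dp_kernavg (n : ℕ) (hn : 2 ≤ n) : ∃ C : ℝ≥0, ∀ (x q : Euc n) (ρ : ℝ), 0 < ρ → q ≠ x →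
    (volume (ball (0 : Euc n) ρ))⁻¹ * ∫⁻ y in ball q ρ, ENNReal.ofReal (dist y x ^ (-((n : ℝ) - 1)))
      ≤ C * ENNReal.ofReal (dist q x ^ (-((n : ℝ) - 1))) := by
  have hn' : (2 : ℝ) ≤ n := by exact_mod_cast hn
  obtain ⟨C, hC⟩ := dp_near n ((n : ℝ) - 1) (by linarith) (by linarith) (by linarith)
  refine ⟨(1 + 3 * C) * 2 ^ n, fun x q ρ hρ hq => ?_⟩
  have hqx : 0 < dist q x := dist_pos.2 hq
  have hV0 : volume (ball (0 : Euc n) ρ) ≠ 0 := (measure_ball_pos _ _ hρ).ne'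
  have hVt : volume (ball (0 : Euc n) ρ) ≠ ⊤ := measure_ball_lt_top.ne
  have hv0 : (volume (ball (0 : Euc n) 1)) ≠ 0 := (measure_ball_pos _ _ one_pos).ne'
  have hvt : (volume (ball (0 : Euc n) 1)) ≠ ⊤ := measure_ball_lt_top.ne
  have hhalf : ∀ t : ℝ, 0 < t → dist q x ≤ 2 * t → ENNReal.ofReal (t ^ (-((n : ℝ) - 1))) ≤
      2 ^ n * ENNReal.ofReal (dist q x ^ (-((n : ℝ) - 1))) := by
    intro t ht hle
    have e : (2 : ℝ≥0∞) ^ n = ENNReal.ofReal (2 ^ n) := by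
      rw [ENNReal.ofReal_pow (by norm_num)]; simp
    rw [e, ← ENNReal.ofReal_mul (by positivity)]
    apply ENNReal.ofReal_le_ofReal
    have h1 : (2 * t) ^ (-((n : ℝ) - 1)) ≤ dist q x ^ (-((n : ℝ) - 1)) :=
      Real.rpow_le_rpow_of_nonpos hqx hle (by linarith)
    rw [Real.mul_rpow (by norm_num) ht.le] at h1
    have h2 : (1 : ℝ) ≤ 2 ^ n * 2 ^ (-((n : ℝ) - 1)) := by
      rw [← Real.rpow_natCast, ← Real.rpow_add (by norm_num)]
      apply Real.one_le_rpow (by norm_num) (by linarith)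
    have h3 : 0 ≤ t ^ (-((n : ℝ) - 1)) := by positivity
    calc t ^ (-((n : ℝ) - 1)) ≤ (2 ^ n * 2 ^ (-((n : ℝ) - 1))) * t ^ (-((n : ℝ) - 1)) := by
          nlinarith
      _ = 2 ^ n * (2 ^ (-((n : ℝ) - 1)) * t ^ (-((n : ℝ) - 1))) := by ring
      _ ≤ _ := by gcongr
  have hcoe : (((1 + 3 * C) * 2 ^ n : ℝ≥0) : ℝ≥0∞) = (1 + 3 * (C : ℝ≥0∞)) * 2 ^ n := by push_cast; rfl
  rw [hcoe]
  by_cases hcase : 2 * ρ ≤ dist q x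
  · calc (volume (ball (0 : Euc n) ρ))⁻¹ * ∫⁻ y in ball q ρ, ENNReal.ofReal (dist y x ^ (-((n : ℝ) - 1)))
        ≤ (volume (ball (0 : Euc n) ρ))⁻¹ * ∫⁻ y in ball q ρ,
          2 ^ n * ENNReal.ofReal (dist q x ^ (-((n : ℝ) - 1))) := by
          gcongr 1
          refine setLIntegral_mono' measurableSet_ball fun y hy => ?_
          have hy' : dist y q < ρ := hy
          have := dist_triangle q y x
          rw [dist_comm q y] at this
          apply hhalf <;> linarith
      _ = (2 ^ n * ENNReal.ofReal (dist q x ^ (-((n : ℝ) - 1)))) := by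
          rw [setLIntegral_const, mul_comm _ (volume (ball q ρ)), ← mul_assoc]
          have : volume (ball q ρ) = volume (ball (0 : Euc n) ρ) := by
            rw [dp_volball q ρ hρ, dp_volball 0 ρ hρ]
          rw [this, ENNReal.inv_mul_cancel hV0 hVt, one_mul]
      _ ≤ _ := by
          gcongr
          calc (2 : ℝ≥0∞) ^ n = 1 * 2 ^ n := by rw [one_mul]
            _ ≤ _ := by gcongr; exact le_self_add
  · push Not at hcase
    have hsub : ball q ρ ⊆ ball x (3 * ρ) := by
      intro y hy
      have hy' : dist y q < ρ := hy
      have := dist_triangle y q x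
      simp only [mem_ball]; linarith
    have h1 := hC n volume x (volume (ball (0 : Euc n) 1))
      (fun r hr => (dp_volball x r hr).le) (3 * ρ) (by positivity)
    rw [show (n : ℝ) - (n - 1) = 1 by ring, Real.rpow_one] at h1
    calc (volume (ball (0 : Euc n) ρ))⁻¹ * ∫⁻ y in ball q ρ, ENNReal.ofReal (dist y x ^ (-((n : ℝ) - 1)))
        ≤ (volume (ball (0 : Euc n) ρ))⁻¹ * (C * volume (ball (0 : Euc n) 1) *
          ENNReal.ofReal (3 * ρ)) := by
          gcongr
          exact (lintegral_mono_set hsub).trans h1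
      _ = 3 * C * ENNReal.ofReal (ρ ^ (-((n : ℝ) - 1))) := by
          rw [dp_volball 0 ρ hρ, ENNReal.mul_inv (Or.inl hv0) (Or.inl hvt),
            ← ENNReal.ofReal_inv_of_pos (by positivity), ENNReal.ofReal_mul (by norm_num)]
          have e1 : ENNReal.ofReal (ρ ^ (-((n : ℝ) - 1))) =
              ENNReal.ofReal ((ρ ^ (n : ℝ))⁻¹) * ENNReal.ofReal ρ := by
            rw [← ENNReal.ofReal_mul (by positivity), ← Real.rpow_neg hρ.le]
            congr 1
            nth_rw 3 [← Real.rpow_one ρ]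
            rw [← Real.rpow_add hρ]; congr 1; ring
          rw [e1]
          have e2 : ENNReal.ofReal 3 = 3 := by simp
          rw [e2]
          calc _ = ((volume (ball (0 : Euc n) 1))⁻¹ * volume (ball (0 : Euc n) 1)) *
              (3 * C * (ENNReal.ofReal ((ρ ^ (n : ℝ))⁻¹) * ENNReal.ofReal ρ)) := by ring
            _ = _ := by rw [ENNReal.inv_mul_cancel hv0 hvt, one_mul]
      _ ≤ 3 * C * (2 ^ n * ENNReal.ofReal (dist q x ^ (-((n : ℝ) - 1)))) := by
          gcongr
          exact hhalf ρ hρ hcase.le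
      _ ≤ _ := by
          rw [← mul_assoc]
          gcongr
          exact le_add_self
def dpK : ℝ≥0∞ := ∫⁻ s in Icc (0 : ℝ) 1, ENNReal.ofReal (s ^ (-(1/2) : ℝ))

lemma dpK_lt : dpK < ⊤ := by
  have h1 : IntervalIntegrable (fun x : ℝ => x ^ (-(1/2) : ℝ)) volume 0 1 :=
    intervalIntegral.intervalIntegrable_rpow' (by norm_num)
  rw [intervalIntegrable_iff_integrableOn_Icc_of_le zero_le_one] at h1
  have h2 := h1.2
  rw [hasFiniteIntegral_iff_ofReal] at h2
  · exact h2
  · filter_upwards [ae_restrict_mem measurableSet_Icc] with s hs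
    exact Real.rpow_nonneg hs.1 _

lemma dp_pos01 : ∀ᵐ s ∂(volume.restrict (Icc (0 : ℝ) 1)), 0 < s := by
  have h0 : ∀ᵐ s : ℝ, s ≠ 0 := by rw [ae_iff]; simp
  filter_upwards [ae_restrict_mem measurableSet_Icc, ae_restrict_of_ae h0] with s h1 h2
  exact lt_of_le_of_ne h1.1 (Ne.symm h2)

lemma dp_h1 {n : ℕ} {d C₀ : ℝ} {Γ : Set (Euc n)} (h : DpGood n d C₀ Γ)
    {u : Euc n → ℝ} {v : Euc n → Euc n} (hum : StronglyMeasurable u) (hvm : StronglyMeasurable v)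
    (hu : LocallyIntegrable u) (hv : LocallyIntegrable v) (hg : DpGrad u v Γ) (x e : Euc n)
    (ρ : ℝ) (hρ : 0 < ρ) :
    ‖⨍ z in ball x ρ, (u (z + e) - u z)‖ₑ ^ 2 ≤ dpK * ‖e‖ₑ ^ 2 *
      ∫⁻ s in Icc (0 : ℝ) 1, ENNReal.ofReal (s ^ (1/2 : ℝ)) *
        ((volume (ball (0 : Euc n) ρ))⁻¹ * ∫⁻ z in ball x ρ, ‖v (z + s • e)‖ₑ ^ 2) := by
  have hV : volume (ball x ρ) = volume (ball (0 : Euc n) ρ) := by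
    rw [dp_volball x ρ hρ, dp_volball 0 ρ hρ]
  have hV0 : volume (ball (0 : Euc n) ρ) ≠ 0 := (measure_ball_pos _ _ hρ).ne'
  have hVt : volume (ball (0 : Euc n) ρ) ≠ ⊤ := measure_ball_lt_top.ne
  set V := volume (ball (0 : Euc n) ρ) with hVd
  set P := (volume.restrict (ball x ρ)).prod (volume.restrict (Icc (0 : ℝ) 1)) with hP
  have hmf : Measurable fun p : Euc n × ℝ => ‖v (p.1 + p.2 • e)‖ₑ :=
    (hvm.comp_measurable (by fun_prop : Measurable fun p : Euc n × ℝ => p.1 + p.2 • e)).enorm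
  have a1 : ‖⨍ z in ball x ρ, (u (z + e) - u z)‖ₑ ≤ V⁻¹ * (‖e‖ₑ *
      ∫⁻ p, ‖v (p.1 + p.2 • e)‖ₑ ∂P) := by
    rw [setAverage_eq, enorm_smul, Real.enorm_eq_ofReal (by positivity), Measure.real,
      ← ENNReal.toReal_inv, hV, ENNReal.ofReal_toReal (ENNReal.inv_ne_top.2 hV0)]
    gcongr
    refine (enorm_integral_le_lintegral_enorm _).trans ?_
    rw [hP, lintegral_prod _ hmf.aemeasurable, ← lintegral_const_mul' _ _ enorm_ne_top]
    refine lintegral_mono_ae ?_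
    filter_upwards [ae_restrict_of_ae (dp_diff h hum hvm hu hv hg e)] with z hz
    rw [hz]
    refine (enorm_integral_le_lintegral_enorm _).trans ?_
    rw [← lintegral_const_mul' _ _ enorm_ne_top]
    refine lintegral_mono fun s => ?_
    rw [mul_comm]
    rw [← ofReal_norm_eq_enorm, ← ofReal_norm_eq_enorm, ← ofReal_norm_eq_enorm,
      ← ENNReal.ofReal_mul (norm_nonneg _)]
    exact ENNReal.ofReal_le_ofReal (norm_inner_le_norm _ _)
  have hs0 : ∀ᵐ p ∂P, 0 < p.2 := Measure.quasiMeasurePreserving_snd.ae dp_pos01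
  have a2 : (∫⁻ p, ‖v (p.1 + p.2 • e)‖ₑ ∂P) ^ 2 ≤ (V * dpK) *
      ∫⁻ p, ENNReal.ofReal (p.2 ^ (1/2 : ℝ)) * ‖v (p.1 + p.2 • e)‖ₑ ^ 2 ∂P := by
    have b1 : ∫⁻ p, ‖v (p.1 + p.2 • e)‖ₑ ∂P = ∫⁻ p, ENNReal.ofReal (p.2 ^ (-(1/4) : ℝ)) *
        (ENNReal.ofReal (p.2 ^ (1/4 : ℝ)) * ‖v (p.1 + p.2 • e)‖ₑ) ∂P := by
      refine lintegral_congr_ae ?_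
      filter_upwards [hs0] with p hp
      rw [← mul_assoc, ← ENNReal.ofReal_mul (by positivity), ← Real.rpow_add hp]
      norm_num
    rw [b1]
    refine (dp_cs P (by fun_prop) (by fun_prop)).trans ?_
    gcongr 1
    · apply le_of_eq
      have : ∫⁻ p, ENNReal.ofReal (p.2 ^ (-(1/4) : ℝ)) ^ 2 ∂P =
          ∫⁻ p, ENNReal.ofReal (p.2 ^ (-(1/2) : ℝ)) ∂P := by
        refine lintegral_congr_ae ?_
        filter_upwards [hs0] with p hp
        rw [pow_two, ← ENNReal.ofReal_mul (by positivity), ← Real.rpow_add hp]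
        norm_num
      rw [this, hP, lintegral_prod _ (by fun_prop)]
      simp only []
      rw [lintegral_const, Measure.restrict_apply_univ, hV, mul_comm]
      rfl
    · refine lintegral_mono_ae ?_
      filter_upwards [hs0] with p hp
      rw [mul_pow, pow_two (ENNReal.ofReal _), ← ENNReal.ofReal_mul (by positivity),
        ← Real.rpow_add hp]
      norm_num
  calc ‖⨍ z in ball x ρ, (u (z + e) - u z)‖ₑ ^ 2
      ≤ (V⁻¹ * (‖e‖ₑ * ∫⁻ p, ‖v (p.1 + p.2 • e)‖ₑ ∂P)) ^ 2 := by gcongr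
    _ = V⁻¹ ^ 2 * ‖e‖ₑ ^ 2 * (∫⁻ p, ‖v (p.1 + p.2 • e)‖ₑ ∂P) ^ 2 := by ring
    _ ≤ V⁻¹ ^ 2 * ‖e‖ₑ ^ 2 * ((V * dpK) *
      ∫⁻ p, ENNReal.ofReal (p.2 ^ (1/2 : ℝ)) * ‖v (p.1 + p.2 • e)‖ₑ ^ 2 ∂P) := by gcongr
    _ = (V⁻¹ * V) * (dpK * ‖e‖ₑ ^ 2 * (V⁻¹ *
      ∫⁻ p, ENNReal.ofReal (p.2 ^ (1/2 : ℝ)) * ‖v (p.1 + p.2 • e)‖ₑ ^ 2 ∂P)) := by ring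
    _ = _ := by
      rw [ENNReal.inv_mul_cancel hV0 hVt, one_mul]
      congr 1
      rw [hP, lintegral_prod_symm _ (by fun_prop), ← lintegral_const_mul' _ _
        (ENNReal.inv_ne_top.2 hV0)]
      refine lintegral_congr fun s => ?_
      simp only []
      rw [lintegral_const_mul' _ _ ENNReal.ofReal_ne_top]
      ring

lemma dp_h2 {n : ℕ} (hn : 2 ≤ n) {v : Euc n → Euc n} (hvm : StronglyMeasurable v) (x : Euc n)
    (ρ : ℝ) (hρ : 0 < ρ) :
    ∫⁻ e, (dpK * ‖e‖ₑ ^ 2 *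
      ∫⁻ s in Icc (0 : ℝ) 1, ENNReal.ofReal (s ^ (1/2 : ℝ)) *
        ((volume (ball (0 : Euc n) ρ))⁻¹ * ∫⁻ z in ball x ρ, ‖v (z + s • e)‖ₑ ^ 2)) *
        ENNReal.ofReal (‖e‖ ^ (-((n : ℝ) + 1))) ≤
    dpK * dpK * ∫⁻ q, ‖v q‖ₑ ^ 2 * ((volume (ball (0 : Euc n) ρ))⁻¹ *
      ∫⁻ z in ball x ρ, ENNReal.ofReal (dist z q ^ (-((n : ℝ) - 1)))) := by
  have hV0 : volume (ball (0 : Euc n) ρ) ≠ 0 := (measure_ball_pos _ _ hρ).ne'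
  set V := volume (ball (0 : Euc n) ρ) with hVd
  have hm2 : Measurable fun p : Euc n × Euc n => ‖v (p.1 + p.2)‖ₑ ^ 2 :=
    (hvm.comp_measurable (by fun_prop : Measurable fun p : Euc n × Euc n => p.1 + p.2)).enorm.pow_const 2
  set G : Euc n → ℝ≥0∞ := fun p => V⁻¹ * ∫⁻ z in ball x ρ, ‖v (z + p)‖ₑ ^ 2 with hG
  have hGm : Measurable G := (Measurable.lintegral_prod_left' hm2).const_mul _
  have hne := dp_ne hn (0 : Euc n)
  have s1 : ∫⁻ e, (dpK * ‖e‖ₑ ^ 2 *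
      ∫⁻ s in Icc (0 : ℝ) 1, ENNReal.ofReal (s ^ (1/2 : ℝ)) * G (s • e)) *
        ENNReal.ofReal (‖e‖ ^ (-((n : ℝ) + 1))) =
      dpK * ∫⁻ e, ∫⁻ s in Icc (0 : ℝ) 1, ENNReal.ofReal (s ^ (1/2 : ℝ)) *
        (ENNReal.ofReal (‖e‖ ^ (-((n : ℝ) - 1))) * G (s • e)) := by
    rw [← lintegral_const_mul' _ _ dpK_lt.ne]
    refine lintegral_congr_ae ?_
    filter_upwards [hne] with e he
    have he' : 0 < ‖e‖ := norm_pos_iff.2 he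
    have e1 : ENNReal.ofReal (‖e‖ ^ (-((n : ℝ) - 1))) = ‖e‖ₑ ^ 2 *
        ENNReal.ofReal (‖e‖ ^ (-((n : ℝ) + 1))) := by
      rw [← ofReal_norm_eq_enorm, ← ENNReal.ofReal_pow (norm_nonneg _),
        ← ENNReal.ofReal_mul (by positivity), ← Real.rpow_natCast, ← Real.rpow_add he']
      congr 2; push_cast; ring
    have e2 : ∫⁻ s in Icc (0 : ℝ) 1, ENNReal.ofReal (s ^ (1/2 : ℝ)) *
        (ENNReal.ofReal (‖e‖ ^ (-((n : ℝ) - 1))) * G (s • e)) =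
        ENNReal.ofReal (‖e‖ ^ (-((n : ℝ) - 1))) *
        ∫⁻ s in Icc (0 : ℝ) 1, ENNReal.ofReal (s ^ (1/2 : ℝ)) * G (s • e) := by
      rw [← lintegral_const_mul' _ _ ENNReal.ofReal_ne_top]
      refine lintegral_congr fun s => ?_
      ring
    rw [e2, e1]; ring
  have s2 : ∫⁻ e, ∫⁻ s in Icc (0 : ℝ) 1, ENNReal.ofReal (s ^ (1/2 : ℝ)) *
        (ENNReal.ofReal (‖e‖ ^ (-((n : ℝ) - 1))) * G (s • e)) =
      dpK * ∫⁻ p, ENNReal.ofReal (‖p‖ ^ (-((n : ℝ) - 1))) * G p := by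
    rw [lintegral_lintegral_swap]
    · unfold dpK
      rw [← lintegral_mul_const _ (by fun_prop)]
      refine lintegral_congr_ae ?_
      filter_upwards [dp_pos01] with s hs
      rw [lintegral_const_mul' _ _ ENNReal.ofReal_ne_top]
      have c1 : ∀ e : Euc n, ENNReal.ofReal (‖e‖ ^ (-((n : ℝ) - 1))) * G (s • e) =
          ENNReal.ofReal (s ^ ((n : ℝ) - 1)) *
          (ENNReal.ofReal (‖s • e‖ ^ (-((n : ℝ) - 1))) * G (s • e)) := by
        intro e
        generalize G (s • e) = g₀
        rw [← mul_assoc, ← ENNReal.ofReal_mul (by positivity), norm_smul, Real.norm_eq_abs,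
          abs_of_pos hs, Real.mul_rpow hs.le (norm_nonneg _), ← mul_assoc, ← Real.rpow_add hs]
        simp
      simp_rw [c1]
      rw [lintegral_const_mul' _ _ ENNReal.ofReal_ne_top,
        dp_scale (f := fun p => ENNReal.ofReal (‖p‖ ^ (-((n : ℝ) - 1))) * G p) (by fun_prop) s hs,
        ← mul_assoc, ← mul_assoc]
      congr 1
      rw [← ENNReal.ofReal_mul (by positivity), ← ENNReal.ofReal_mul (by positivity),
        ← Real.rpow_natCast, ← Real.rpow_neg hs.le, ← Real.rpow_add hs, ← Real.rpow_add hs]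
      congr 2; ring
    · have : Measurable fun p : Euc n × ℝ => G (p.2 • p.1) := hGm.comp (by fun_prop)
      refine Measurable.aemeasurable ?_
      unfold Function.uncurry
      fun_prop
  have s3 : ∫⁻ p, ENNReal.ofReal (‖p‖ ^ (-((n : ℝ) - 1))) * G p =
      ∫⁻ q, ‖v q‖ₑ ^ 2 * (V⁻¹ *
      ∫⁻ z in ball x ρ, ENNReal.ofReal (dist z q ^ (-((n : ℝ) - 1)))) := by
    have t1 : ∀ p, ENNReal.ofReal (‖p‖ ^ (-((n : ℝ) - 1))) * G p = V⁻¹ *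
        ∫⁻ z in ball x ρ, ENNReal.ofReal (‖p‖ ^ (-((n : ℝ) - 1))) * ‖v (z + p)‖ₑ ^ 2 := by
      intro p
      rw [lintegral_const_mul' _ _ ENNReal.ofReal_ne_top, hG]; ring
    have t2 : ∀ q, ‖v q‖ₑ ^ 2 * (V⁻¹ *
      ∫⁻ z in ball x ρ, ENNReal.ofReal (dist z q ^ (-((n : ℝ) - 1)))) = V⁻¹ *
      ∫⁻ z in ball x ρ, ENNReal.ofReal (dist z q ^ (-((n : ℝ) - 1))) * ‖v q‖ₑ ^ 2 := by
      intro q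
      rw [lintegral_mul_const' _ _ (by simp)]; ring
    simp_rw [t1, t2]
    rw [lintegral_const_mul' _ _ (ENNReal.inv_ne_top.2 hV0),
      lintegral_const_mul' _ _ (ENNReal.inv_ne_top.2 hV0)]
    congr 1
    refine (lintegral_lintegral_swap ?_).trans (Eq.trans ?_ (lintegral_lintegral_swap ?_).symm)
    rotate_left
    · refine lintegral_congr fun z => ?_
      rw [← lintegral_add_left_eq_self (fun q => ENNReal.ofReal (dist z q ^ (-((n : ℝ) - 1))) *
        ‖v q‖ₑ ^ 2) z]
      simp
    · have := hvm.measurable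
      refine Measurable.aemeasurable ?_
      unfold Function.uncurry
      fun_prop
    · have h3 := hm2.comp measurable_swap
      refine Measurable.aemeasurable ?_
      unfold Function.uncurry
      refine Measurable.mul (by fun_prop) h3
  rw [s1, s2, s3, mul_assoc]

lemma dp_hardypt (n : ℕ) (hn : 2 ≤ n) : ∃ C : ℝ≥0, ∀ (d C₀ : ℝ) (Γ : Set (Euc n)),
    DpGood n d C₀ Γ → ∀ (u : Euc n → ℝ) (v : Euc n → Euc n), StronglyMeasurable u →
    StronglyMeasurable v → LocallyIntegrable u → LocallyIntegrable v → DpGrad u v Γ →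
    ∀ x : Euc n, HasTraceAt u x 0 →
    ∫⁻ y, ‖u y‖ₑ ^ 2 * ENNReal.ofReal (dist x y ^ (-((n : ℝ) + 1))) ≤
      C * ∫⁻ y, ‖v y‖ₑ ^ 2 * ENNReal.ofReal (dist x y ^ (-((n : ℝ) - 1))) := by
  obtain ⟨C, hC⟩ := dp_kernavg n hn
  refine ⟨(dpK * dpK * C).toNNReal, fun d C₀ Γ h u v hum hvm hu hv hg x hx => ?_⟩
  haveI : Nonempty (Fin n) := ⟨⟨0, by omega⟩⟩
  rw [ENNReal.coe_toNNReal (ENNReal.mul_ne_top (ENNReal.mul_ne_top dpK_lt.ne dpK_lt.ne)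
    ENNReal.coe_ne_top)]
  set r : ℕ → ℝ := fun k => 1 / ((k : ℝ) + 1) with hr
  have hr0 : ∀ k, 0 < r k := fun k => by simp only [hr]; positivity
  have hrt : Tendsto r atTop (𝓝[>] 0) := by
    refine tendsto_nhdsWithin_iff.2 ⟨tendsto_one_div_add_atTop_nhds_zero_nat, ?_⟩
    exact Eventually.of_forall hr0
  set D : ℕ → Euc n → ℝ≥0∞ := fun k e => ‖⨍ z in ball x (r k), (u (z + e) - u z)‖ₑ ^ 2 *
    ENNReal.ofReal (‖e‖ ^ (-((n : ℝ) + 1))) with hD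
  have hDm : ∀ k, Measurable (D k) := by
    intro k
    have : StronglyMeasurable fun e => ⨍ z in ball x (r k), (u (z + e) - u z) := by
      simp_rw [setAverage_eq, smul_eq_mul]
      refine StronglyMeasurable.const_mul ?_ _
      have hh : StronglyMeasurable fun p : Euc n × Euc n => u (p.2 + p.1) - u p.2 :=
        (hum.comp_measurable (by fun_prop : Measurable fun p : Euc n × Euc n => p.2 + p.1)).sub
          (hum.comp_measurable measurable_snd)
      exact hh.integral_prod_right
    have := this.enorm
    simp only [hD]
    fun_prop
  have hDle : ∀ k, ∫⁻ e, D k e ≤ dpK * dpK * C *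
      ∫⁻ y, ‖v y‖ₑ ^ 2 * ENNReal.ofReal (dist x y ^ (-((n : ℝ) - 1))) := by
    intro k
    calc ∫⁻ e, D k e ≤ _ := lintegral_mono fun e => by
          simp only [hD]
          gcongr
          exact dp_h1 h hum hvm hu hv hg x e (r k) (hr0 k)
      _ ≤ _ := dp_h2 hn hvm x (r k) (hr0 k)
      _ ≤ dpK * dpK * ∫⁻ q, C * (‖v q‖ₑ ^ 2 * ENNReal.ofReal (dist x q ^ (-((n : ℝ) - 1)))) := by
          gcongr 1
          refine lintegral_mono_ae ?_
          filter_upwards [dp_ne hn x] with q hq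
          calc _ ≤ ‖v q‖ₑ ^ 2 * (C * ENNReal.ofReal (dist x q ^ (-((n : ℝ) - 1)))) :=
                mul_le_mul' le_rfl (hC q x (r k) (hr0 k) hq.symm)
            _ = _ := by ring
      _ = _ := by
          rw [lintegral_const_mul' _ _ ENNReal.coe_ne_top]; ring
  have hleb : ∀ᵐ y, Tendsto (fun k => ⨍ z in ball y (r k), u z) atTop (𝓝 (u y)) := by
    filter_upwards [IsUnifLocDoublingMeasure.ae_tendsto_average volume hu 1] with y hy
    have := hy (l := atTop) (w := fun _ => y) r hrt (Eventually.of_forall fun k =>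
      mem_closedBall_self (by simpa using (hr0 k).le))
    refine this.congr fun k => ?_
    refine setAverage_congr ?_
    refine (ae_eq_of_subset_of_measure_ge ball_subset_closedBall ?_ 
      measurableSet_ball.nullMeasurableSet measure_closedBall_lt_top.ne).symm
    exact (Measure.addHaar_closedBall_eq_addHaar_ball _ _ _).le
  have hleb' : ∀ᵐ e, Tendsto (fun k => ⨍ z in ball (x + e) (r k), u z) atTop (𝓝 (u (x + e))) :=
    (measurePreserving_add_left volume x).quasiMeasurePreserving.ae hleb
  have hshift : ∀ e k, ⨍ z in ball x (r k), (u (z + e) - u z) =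
      (⨍ z in ball (x + e) (r k), u z) - ⨍ z in ball x (r k), u z := by
    intro e k
    have hmp : MeasurePreserving (fun z : Euc n => z + e) volume volume :=
      measurePreserving_add_right volume e
    have hpre : (fun z : Euc n => z + e) ⁻¹' ball (x + e) (r k) = ball x (r k) := by
      ext z; simp
    have i1 : IntegrableOn u (ball x (r k)) :=
      (hu.integrableOn_isCompact (isCompact_closedBall x (r k))).mono_set ball_subset_closedBall
    have i2 : IntegrableOn u (ball (x + e) (r k)) :=
      (hu.integrableOn_isCompact (isCompact_closedBall _ (r k))).mono_set ball_subset_closedBall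
    have i3 : IntegrableOn (fun z => u (z + e)) ((fun z : Euc n => z + e) ⁻¹' ball (x + e) (r k)) :=
      (hmp.integrableOn_comp_preimage (measurableEmbedding_addRight e)).2 i2
    have i4 := hmp.setIntegral_preimage_emb (measurableEmbedding_addRight e) u (ball (x + e) (r k))
    rw [hpre] at i3 i4
    rw [setAverage_eq, setAverage_eq, setAverage_eq]
    rw [integral_sub i3 i1, smul_sub, i4]
    congr 2
    rw [Measure.real, Measure.real, dp_volball _ _ (hr0 k), dp_volball _ _ (hr0 k)]
  calc ∫⁻ y, ‖u y‖ₑ ^ 2 * ENNReal.ofReal (dist x y ^ (-((n : ℝ) + 1)))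
      = ∫⁻ e, ‖u (x + e)‖ₑ ^ 2 * ENNReal.ofReal (‖e‖ ^ (-((n : ℝ) + 1))) := by
        rw [← lintegral_add_left_eq_self _ x]
        simp
    _ ≤ ∫⁻ e, liminf (fun k => D k e) atTop := by
        refine lintegral_mono_ae ?_
        filter_upwards [hleb'] with e he
        refine le_of_eq (Tendsto.liminf_eq ?_).symm
        simp only [hD, hshift]
        have h0 : Tendsto (fun k => ⨍ z in ball x (r k), u z) atTop (𝓝 0) := hx.comp hrt
        have h1 := (he.sub h0).enorm
        rw [sub_zero] at h1
        exact ENNReal.Tendsto.mul_const (ENNReal.Tendsto.pow h1) (Or.inr ENNReal.ofReal_ne_top)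
    _ ≤ liminf (fun k => ∫⁻ e, D k e) atTop := lintegral_liminf_le hDm
    _ ≤ _ := liminf_le_of_le (by isBoundedDefault) (fun b hb => by
        obtain ⟨k, hk⟩ := hb.exists
        exact hk.trans (hDle k))
lemma dp_fub {n : ℕ} {d C₀ : ℝ} {Γ : Set (Euc n)} (h : DpGood n d C₀ Γ) {F : Euc n → ℝ≥0∞}
    (hF : AEMeasurable F volume) (q : ℝ) :
    ∫⁻ x, (∫⁻ y, F y * ENNReal.ofReal (dist x y ^ (-q))) ∂(dpS d Γ) =
      ∫⁻ y, F y * ∫⁻ x, ENNReal.ofReal (dist x y ^ (-q)) ∂(dpS d Γ) := by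
  haveI := h.locfin
  rw [lintegral_lintegral_swap]
  · refine lintegral_congr fun y => ?_
    rw [lintegral_const_mul _ (by fun_prop)]
  · unfold Function.uncurry
    refine AEMeasurable.mul ?_ (Measurable.aemeasurable (by fun_prop))
    exact hF.comp_quasiMeasurePreserving Measure.quasiMeasurePreserving_snd

lemma DpGood.aenot {n : ℕ} {d C₀ : ℝ} {Γ : Set (Euc n)} (h : DpGood n d C₀ Γ) :
    ∀ᵐ y : Euc n, y ∉ Γ := by rw [ae_iff]; simpa using h.null

lemma dp_grad_congr {n : ℕ} {Γ : Set (Euc n)} {u u' : Euc n → ℝ} {v v' : Euc n → Euc n}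
    (h1 : u =ᵐ[volume] u') (h2 : v =ᵐ[volume] v') (hg : DpGrad u v Γ) : DpGrad u' v' Γ := by
  intro φ a b c e
  have := hg φ a b c e
  have e1 : ∫ x, u x * fderiv ℝ φ x e = ∫ x, u' x * fderiv ℝ φ x e :=
    integral_congr_ae (by filter_upwards [h1] with x hx; rw [hx])
  have e2 : ∫ x, φ x * inner ℝ (v x) e = ∫ x, φ x * inner ℝ (v' x) e :=
    integral_congr_ae (by filter_upwards [h2] with x hx; rw [hx])
  rw [← e1, ← e2, this]

lemma dp_trace_congr {n : ℕ} {u u' : Euc n → ℝ} {x : Euc n} {c : ℝ}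
    (h1 : u =ᵐ[volume] u') (hg : HasTraceAt u x c) : HasTraceAt u' x c := by
  unfold HasTraceAt at *
  refine hg.congr fun ρ => ?_
  rw [setAverage_eq, setAverage_eq, integral_congr_ae (ae_restrict_of_ae h1)]

lemma dp_hardy (n : ℕ) (d C₀ : ℝ) (hn : 2 ≤ n) (hd0 : 0 < d) (hdn : d < (n : ℝ) - 1) :
    ∃ C : ℝ≥0, ∀ (Γ : Set (Euc n)),
    DpGood n d C₀ Γ → ∀ (u : Euc n → ℝ) (v : Euc n → Euc n), 
    LocallyIntegrable u → LocallyIntegrable v → DpGrad u v Γ →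
    (∀ᵐ x ∂(dpS d Γ), HasTraceAt u x 0) →
    ∫⁻ y, ‖u y‖ₑ ^ 2 * ENNReal.ofReal (infDist y Γ ^ (d - 1 - n)) ≤
      C * ∫⁻ y, ‖v y‖ₑ ^ 2 * ENNReal.ofReal (infDist y Γ ^ (d + 1 - n)) := by
  obtain ⟨C1, hC1⟩ := dp_hardypt n hn
  obtain ⟨C2, -, hC2⟩ := dp_lower n d C₀ (n + 1) (by positivity)
  obtain ⟨C3, hC3⟩ := dp_upper n d C₀ (n - 1) hd0.le (by linarith)
  refine ⟨C2 * (C1 * C3), fun Γ h u v hu hv hg ht => ?_⟩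
  have hum := hu.aestronglyMeasurable
  have hvm := hv.aestronglyMeasurable
  have hu' : LocallyIntegrable (hum.mk u) := hu.congr hum.ae_eq_mk
  have hv' : LocallyIntegrable (hvm.mk v) := hv.congr hvm.ae_eq_mk
  have hg' := dp_grad_congr hum.ae_eq_mk hvm.ae_eq_mk hg
  have key : ∀ᵐ x ∂(dpS d Γ),
      ∫⁻ y, ‖u y‖ₑ ^ 2 * ENNReal.ofReal (dist x y ^ (-((n : ℝ) + 1))) ≤
      C1 * ∫⁻ y, ‖v y‖ₑ ^ 2 * ENNReal.ofReal (dist x y ^ (-((n : ℝ) - 1))) := by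
    filter_upwards [ht] with x hx
    have := hC1 d C₀ Γ h _ _ hum.stronglyMeasurable_mk hvm.stronglyMeasurable_mk hu' hv' hg' x
      (dp_trace_congr hum.ae_eq_mk hx)
    have e1 : ∫⁻ y, ‖u y‖ₑ ^ 2 * ENNReal.ofReal (dist x y ^ (-((n : ℝ) + 1))) =
        ∫⁻ y, ‖hum.mk u y‖ₑ ^ 2 * ENNReal.ofReal (dist x y ^ (-((n : ℝ) + 1))) :=
      lintegral_congr_ae (by filter_upwards [hum.ae_eq_mk] with y hy; rw [hy])
    have e2 : ∫⁻ y, ‖v y‖ₑ ^ 2 * ENNReal.ofReal (dist x y ^ (-((n : ℝ) - 1))) =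
        ∫⁻ y, ‖hvm.mk v y‖ₑ ^ 2 * ENNReal.ofReal (dist x y ^ (-((n : ℝ) - 1))) :=
      lintegral_congr_ae (by filter_upwards [hvm.ae_eq_mk] with y hy; rw [hy])
    rw [e1, e2]; exact this
  calc ∫⁻ y, ‖u y‖ₑ ^ 2 * ENNReal.ofReal (infDist y Γ ^ (d - 1 - n))
      ≤ ∫⁻ y, C2 * (‖u y‖ₑ ^ 2 * ∫⁻ x, ENNReal.ofReal (dist x y ^ (-((n : ℝ) + 1))) ∂(dpS d Γ)) := by
        refine lintegral_mono_ae ?_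
        filter_upwards [h.aenot] with y hy
        have h1 := hC2 Γ h y hy
        rw [show d - ((n : ℝ) + 1) = d - 1 - n by ring] at h1
        calc _ ≤ ‖u y‖ₑ ^ 2 * (C2 * ∫⁻ x, ENNReal.ofReal (dist x y ^ (-((n : ℝ) + 1))) ∂(dpS d Γ)) := by
              gcongr
              exact h1.trans (by gcongr; exact Measure.restrict_le_self)
          _ = _ := by ring
    _ = C2 * ∫⁻ x, (∫⁻ y, ‖u y‖ₑ ^ 2 * ENNReal.ofReal (dist x y ^ (-((n : ℝ) + 1)))) ∂(dpS d Γ) := by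
        rw [lintegral_const_mul' _ _ ENNReal.coe_ne_top, dp_fub h (hum.enorm.pow_const 2)]
    _ ≤ C2 * ∫⁻ x, (C1 * ∫⁻ y, ‖v y‖ₑ ^ 2 * ENNReal.ofReal (dist x y ^ (-((n : ℝ) - 1)))) ∂(dpS d Γ) := by
        gcongr 1
        exact lintegral_mono_ae key
    _ = C2 * (C1 * ∫⁻ y, ‖v y‖ₑ ^ 2 *
        ∫⁻ x, ENNReal.ofReal (dist x y ^ (-((n : ℝ) - 1))) ∂(dpS d Γ)) := by
        rw [lintegral_const_mul' _ _ ENNReal.coe_ne_top, dp_fub h (hvm.enorm.pow_const 2)]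
    _ ≤ C2 * (C1 * ∫⁻ y, C3 * (‖v y‖ₑ ^ 2 * ENNReal.ofReal (infDist y Γ ^ (d + 1 - n)))) := by
        gcongr 2
        refine lintegral_mono_ae ?_
        filter_upwards [h.aenot] with y hy
        have h1 := hC3 Γ h y hy
        rw [show d - ((n : ℝ) - 1) = d + 1 - n by ring] at h1
        calc _ ≤ ‖v y‖ₑ ^ 2 * (C3 * ENNReal.ofReal (infDist y Γ ^ (d + 1 - n))) :=
              mul_le_mul' le_rfl h1
          _ = _ := by ring
    _ = _ := by
        rw [lintegral_const_mul' _ _ ENNReal.coe_ne_top]; push_cast; ring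

lemma dp_trace0 {n : ℕ} {d C₀ : ℝ} {Γ : Set (Euc n)} (h : DpGood n d C₀ Γ) {u : Euc n → ℝ}
    (hu : AEStronglyMeasurable u volume)
    (hf : ∫⁻ y, ‖u y‖ₑ ^ 2 * ENNReal.ofReal (infDist y Γ ^ (d - 1 - n)) < ⊤) :
    ∀ᵐ x ∂(dpS d Γ), HasTraceAt u x 0 := by
  haveI := h.locfin
  have hdn := h.hdn
  obtain ⟨C, hC⟩ := dp_upper n d C₀ (n + 1) h.hd0.le (by linarith)
  have hfin : ∫⁻ x, (∫⁻ y, ‖u y‖ₑ ^ 2 * ENNReal.ofReal (dist x y ^ (-((n : ℝ) + 1)))) ∂(dpS d Γ) < ⊤ := by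
    rw [dp_fub h (hu.enorm.pow_const 2)]
    calc _ ≤ ∫⁻ y, C * (‖u y‖ₑ ^ 2 * ENNReal.ofReal (infDist y Γ ^ (d - 1 - n))) := by
          refine lintegral_mono_ae ?_
          filter_upwards [h.aenot] with y hy
          have h1 := hC Γ h y hy
          rw [show d - ((n : ℝ) + 1) = d - 1 - n by ring] at h1
          calc _ ≤ ‖u y‖ₑ ^ 2 * (C * ENNReal.ofReal (infDist y Γ ^ (d - 1 - n))) :=
                mul_le_mul' le_rfl h1
            _ = _ := by ring
      _ < ⊤ := by
          rw [lintegral_const_mul' _ _ ENNReal.coe_ne_top]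
          exact ENNReal.mul_lt_top ENNReal.coe_lt_top hf
  have hae : ∀ᵐ x ∂(dpS d Γ),
      ∫⁻ y, ‖u y‖ₑ ^ 2 * ENNReal.ofReal (dist x y ^ (-((n : ℝ) + 1))) < ⊤ := by
    refine ae_lt_top' ?_ hfin.ne
    refine AEMeasurable.lintegral_prod_right' (f := fun p : Euc n × Euc n => ‖u p.2‖ₑ ^ 2 *
      ENNReal.ofReal (dist p.1 p.2 ^ (-((n : ℝ) + 1)))) ?_
    have hm : Measurable fun p : Euc n × Euc n =>
      ENNReal.ofReal (dist p.1 p.2 ^ (-((n : ℝ) + 1))) := by fun_prop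
    refine AEMeasurable.mul ?_ hm.aemeasurable
    exact (hu.enorm.pow_const 2).comp_quasiMeasurePreserving Measure.quasiMeasurePreserving_snd
  filter_upwards [hae] with x hx
  exact (dp_traceT h.hn x 0 hu (by simpa using hx)).2
lemma dp_half (d R : ℝ) (hR : 0 < R) : ENNReal.ofReal ((R / 2) ^ (-(d + 1))) =
    ENNReal.ofReal (2 ^ (d + 1)) * ENNReal.ofReal (R ^ (-(d + 1))) := by
  rw [← ENNReal.ofReal_mul (by positivity), Real.div_rpow hR.le (by norm_num),
    Real.rpow_neg (by norm_num : (0:ℝ) ≤ 2)]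
  congr 1
  field_simp

lemma dp_farv (n : ℕ) (d : ℝ) (hd0 : 0 < d) : ∃ C : ℝ≥0, ∀ (x : Euc n) (R : ℝ), 0 < R →
    ∫⁻ y in (ball x (R / 2))ᶜ, ENNReal.ofReal (dist x y ^ (-((n : ℝ) + d + 1))) ≤
      C * ENNReal.ofReal (R ^ (-(d + 1))) := by
  obtain ⟨C, hC⟩ := dp_far n ((n : ℝ) + d + 1) (by positivity) (by linarith)
  refine ⟨C * (volume (ball (0 : Euc n) 1)).toNNReal * (2 ^ (d + 1) : ℝ).toNNReal, fun x R hR => ?_⟩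
  have h1 := hC n volume x _ (fun r hr => (dp_volball x r hr).le) (R / 2) (by positivity)
  rw [show (n : ℝ) - (n + d + 1) = -(d + 1) by ring, dp_half d R hR] at h1
  simp_rw [dist_comm x]
  refine h1.trans (le_of_eq ?_)
  push_cast
  rw [ENNReal.coe_toNNReal measure_ball_lt_top.ne]
  simp only [ENNReal.ofReal]
  ring

lemma dp_ker1 (n : ℕ) (d C₀ : ℝ) (hd0 : 0 < d) (hdn : d < (n : ℝ) - 1) : ∃ C : ℝ≥0,
    ∀ Γ : Set (Euc n), DpGood n d C₀ Γ → ∀ x ∈ Γ, ∀ x' ∈ Γ, x ≠ x' →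
    ∫⁻ y, ENNReal.ofReal (infDist y Γ ^ (4 * (n : ℝ) - d - 1 - n)) *
      ENNReal.ofReal (dist x y ^ (-(2 * (n : ℝ)))) * ENNReal.ofReal (dist x' y ^ (-(2 * (n : ℝ)))) ≤
      C * ENNReal.ofReal (dist x x' ^ (-(d + 1))) := by
  obtain ⟨C, hC⟩ := dp_farv n d hd0
  refine ⟨C + C, fun Γ h x hx x' hx' hne => ?_⟩
  set R := dist x x' with hRd
  have hR : 0 < R := dist_pos.2 hne
  have alg : ∀ t a b : ℝ, 0 < t → t ≤ a → t ≤ b → t ^ (4 * (n : ℝ) - d - 1 - n) *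
      a ^ (-(2 * (n : ℝ))) * b ^ (-(2 * (n : ℝ))) ≤ b ^ (-((n : ℝ) + d + 1)) := by
    intro t a b ht hta htb
    have ha : 0 < a := ht.trans_le hta
    have hb : 0 < b := ht.trans_le htb
    have e1 : t ^ (4 * (n : ℝ) - d - 1 - n) = t ^ (2 * (n : ℝ)) * t ^ ((n : ℝ) - d - 1) := by
      rw [← Real.rpow_add ht]; congr 1; ring
    have e2 : t ^ (2 * (n : ℝ)) ≤ a ^ (2 * (n : ℝ)) :=
      Real.rpow_le_rpow ht.le hta (by positivity)
    have e3 : t ^ ((n : ℝ) - d - 1) ≤ b ^ ((n : ℝ) - d - 1) :=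
      Real.rpow_le_rpow ht.le htb (by linarith)
    calc _ ≤ (a ^ (2 * (n : ℝ)) * b ^ ((n : ℝ) - d - 1)) *
          a ^ (-(2 * (n : ℝ))) * b ^ (-(2 * (n : ℝ))) := by
          rw [e1]; gcongr
      _ = (a ^ (2 * (n : ℝ)) * a ^ (-(2 * (n : ℝ)))) *
          (b ^ ((n : ℝ) - d - 1) * b ^ (-(2 * (n : ℝ)))) := by ring
      _ = _ := by
          rw [← Real.rpow_add ha, ← Real.rpow_add hb]
          simp only [add_neg_cancel, Real.rpow_zero, one_mul]
          congr 1; ring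
  calc _ ≤ ∫⁻ y, ((ball x' (R / 2))ᶜ.indicator
          (fun y => ENNReal.ofReal (dist x' y ^ (-((n : ℝ) + d + 1)))) y +
        (ball x (R / 2))ᶜ.indicator
          (fun y => ENNReal.ofReal (dist x y ^ (-((n : ℝ) + d + 1)))) y) := by
        refine lintegral_mono_ae ?_
        filter_upwards [h.aenot] with y hy
        have hp := h.pos hy
        have ha : infDist y Γ ≤ dist x y := by rw [dist_comm]; exact infDist_le_dist_of_mem hx
        have hb : infDist y Γ ≤ dist x' y := by rw [dist_comm]; exact infDist_le_dist_of_mem hx'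
        rw [← ENNReal.ofReal_mul (by positivity), ← ENNReal.ofReal_mul (by positivity)]
        by_cases hc : R / 2 ≤ dist x' y
        · have hm : y ∈ (ball x' (R / 2))ᶜ := by
            simp only [mem_compl_iff, mem_ball, not_lt]; rwa [dist_comm]
          rw [indicator_of_mem hm]
          exact (ENNReal.ofReal_le_ofReal (alg _ _ _ hp ha hb)).trans le_self_add
        · have hm : y ∈ (ball x (R / 2))ᶜ := by
            simp only [mem_compl_iff, mem_ball, not_lt]
            have := dist_triangle x y x'
            rw [dist_comm y x'] at this
            rw [dist_comm]; linarith
          rw [indicator_of_mem hm]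
          refine le_trans (ENNReal.ofReal_le_ofReal ?_) le_add_self
          have := alg _ _ _ hp hb ha
          linarith
    _ = _ := by
        rw [lintegral_add_left (Measurable.indicator (by fun_prop) measurableSet_ball.compl),
          lintegral_indicator measurableSet_ball.compl, lintegral_indicator measurableSet_ball.compl]
    _ ≤ C * ENNReal.ofReal (R ^ (-(d + 1))) + C * ENNReal.ofReal (R ^ (-(d + 1))) :=
        add_le_add (hC _ _ hR) (hC _ _ hR)
    _ = _ := by push_cast; ring

lemma dp_ker2 (n : ℕ) (d C₀ : ℝ) (hd0 : 0 < d) (hdn : d < (n : ℝ) - 1) : ∃ C : ℝ≥0,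
    ∀ Γ : Set (Euc n), DpGood n d C₀ Γ → ∀ x ∈ Γ, ∀ x' ∈ Γ, x ≠ x' →
    ∫⁻ y, ENNReal.ofReal (infDist y Γ ^ (2 * (n : ℝ) - d)) *
      ENNReal.ofReal (dist x' y ^ (-(2 * (n : ℝ)))) * ENNReal.ofReal (dist x y ^ (-((n : ℝ) + 1))) ≤
      C * ENNReal.ofReal (dist x x' ^ (-(d + 1))) := by
  obtain ⟨C, hC⟩ := dp_farv n d hd0
  obtain ⟨C', hC'⟩ := dp_near n d (by positivity) hd0 (by linarith)
  refine ⟨C + C' * (volume (ball (0 : Euc n) 1)).toNNReal * (2 ^ (d + 1) : ℝ).toNNReal,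
    fun Γ h x hx x' hx' hne => ?_⟩
  set R := dist x x' with hRd
  have hR : 0 < R := dist_pos.2 hne
  have hnear := hC' n volume x' _ (fun r hr => (dp_volball x' r hr).le) (R / 2) (by positivity)
  calc _ ≤ ∫⁻ y, ((ball x' (R / 2))ᶜ.indicator
          (fun y => ENNReal.ofReal (dist x' y ^ (-((n : ℝ) + d + 1)))) y +
        (ball x' (R / 2)).indicator
          (fun y => ENNReal.ofReal ((R / 2) ^ (-((n : ℝ) + 1))) *
            ENNReal.ofReal (dist y x' ^ (-d))) y) := by
        refine lintegral_mono_ae ?_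
        filter_upwards [h.aenot] with y hy
        have hp := h.pos hy
        have ha : infDist y Γ ≤ dist x y := by rw [dist_comm]; exact infDist_le_dist_of_mem hx
        have hb : infDist y Γ ≤ dist x' y := by rw [dist_comm]; exact infDist_le_dist_of_mem hx'
        have ha0 := hp.trans_le ha
        have hb0 := hp.trans_le hb
        rw [← ENNReal.ofReal_mul (by positivity), ← ENNReal.ofReal_mul (by positivity)]
        by_cases hc : R / 2 ≤ dist x' y
        · have hm : y ∈ (ball x' (R / 2))ᶜ := by
            simp only [mem_compl_iff, mem_ball, not_lt]; rwa [dist_comm]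
          rw [indicator_of_mem hm]
          refine le_trans (ENNReal.ofReal_le_ofReal ?_) le_self_add
          have e1 : infDist y Γ ^ (2 * (n : ℝ) - d) = infDist y Γ ^ ((n : ℝ) + 1) *
              infDist y Γ ^ ((n : ℝ) - d - 1) := by
            rw [← Real.rpow_add hp]; congr 1; ring
          have e2 : infDist y Γ ^ ((n : ℝ) + 1) ≤ dist x y ^ ((n : ℝ) + 1) :=
            Real.rpow_le_rpow hp.le ha (by positivity)
          have e3 : infDist y Γ ^ ((n : ℝ) - d - 1) ≤ dist x' y ^ ((n : ℝ) - d - 1) :=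
            Real.rpow_le_rpow hp.le hb (by linarith)
          calc _ ≤ (dist x y ^ ((n : ℝ) + 1) * dist x' y ^ ((n : ℝ) - d - 1)) *
                dist x' y ^ (-(2 * (n : ℝ))) * dist x y ^ (-((n : ℝ) + 1)) := by
                rw [e1]; gcongr
            _ = (dist x y ^ ((n : ℝ) + 1) * dist x y ^ (-((n : ℝ) + 1))) *
                (dist x' y ^ ((n : ℝ) - d - 1) * dist x' y ^ (-(2 * (n : ℝ)))) := by ring
            _ = _ := by
                rw [← Real.rpow_add ha0, ← Real.rpow_add hb0]
                simp only [add_neg_cancel, Real.rpow_zero, one_mul]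
                congr 1; ring
        · have hm : y ∈ ball x' (R / 2) := by
            simp only [mem_ball]; rw [dist_comm]; linarith
          have ha' : R / 2 ≤ dist x y := by
            have := dist_triangle x y x'
            rw [dist_comm y x'] at this
            linarith
          rw [indicator_of_mem hm]
          refine le_trans ?_ le_add_self
          rw [← ENNReal.ofReal_mul (by positivity)]
          refine ENNReal.ofReal_le_ofReal ?_
          rw [dist_comm y x']
          have e2 : dist x y ^ (-((n : ℝ) + 1)) ≤ (R / 2) ^ (-((n : ℝ) + 1)) :=
            Real.rpow_le_rpow_of_nonpos (by positivity) ha'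
              (by linarith [(Nat.cast_nonneg n : (0:ℝ) ≤ n)])
          have e3 : infDist y Γ ^ (2 * (n : ℝ) - d) ≤ dist x' y ^ (2 * (n : ℝ) - d) :=
            Real.rpow_le_rpow hp.le hb (by linarith [(Nat.cast_nonneg n : (0:ℝ) ≤ n)])
          calc _ ≤ dist x' y ^ (2 * (n : ℝ) - d) * dist x' y ^ (-(2 * (n : ℝ))) *
                (R / 2) ^ (-((n : ℝ) + 1)) := by gcongr
            _ = _ := by
              rw [← Real.rpow_add hb0, mul_comm]; congr 2; ring
    _ = _ := by
        rw [lintegral_add_left (Measurable.indicator (by fun_prop) measurableSet_ball.compl),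
          lintegral_indicator measurableSet_ball.compl, lintegral_indicator measurableSet_ball,
          lintegral_const_mul' _ _ ENNReal.ofReal_ne_top]
    _ ≤ C * ENNReal.ofReal (R ^ (-(d + 1))) + ENNReal.ofReal ((R / 2) ^ (-((n : ℝ) + 1))) *
        (C' * volume (ball (0 : Euc n) 1) * ENNReal.ofReal ((R / 2) ^ ((n : ℝ) - d))) :=
        add_le_add (hC _ _ hR) (mul_le_mul' le_rfl hnear)
    _ = _ := by
        have : ENNReal.ofReal ((R / 2) ^ (-((n : ℝ) + 1))) * ENNReal.ofReal ((R / 2) ^ ((n : ℝ) - d)) =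
          ENNReal.ofReal (2 ^ (d + 1)) * ENNReal.ofReal (R ^ (-(d + 1))) := by
          rw [← ENNReal.ofReal_mul (by positivity), ← Real.rpow_add (by positivity), ← dp_half d R hR]
          congr 2; ring
        calc _ = C * ENNReal.ofReal (R ^ (-(d + 1))) + (C' * volume (ball (0 : Euc n) 1)) *
              (ENNReal.ofReal ((R / 2) ^ (-((n : ℝ) + 1))) *
                ENNReal.ofReal ((R / 2) ^ ((n : ℝ) - d))) := by ring
          _ = _ := by
            rw [this]; push_cast
            rw [ENNReal.coe_toNNReal measure_ball_lt_top.ne]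
            simp only [ENNReal.ofReal]
            ring
/-- derivative of the kernel -/
def dpk' {n : ℕ} (x y : Euc n) : Euc n →L[ℝ] ℝ :=
  (-(2 * (n : ℝ)) * dist x y ^ (-(2 * (n : ℝ)) - 2)) • innerSL ℝ (y - x)

lemma dp_kder {n : ℕ} {x y : Euc n} (hxy : x ≠ y) :
    HasFDerivAt (fun y' => dist x y' ^ (-(2 * (n : ℝ)))) (dpk' x y) y := by
  have h0 : 0 < dist x y := dist_pos.2 hxy
  have h1 : HasFDerivAt (fun y' : Euc n => ‖y' - x‖ ^ 2) (2 • (innerSL ℝ (y - x))) y := by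
    have := ((hasFDerivAt_id y).sub_const x).norm_sq
    simpa using this
  have h2 := h1.rpow_const (p := -(n : ℝ)) (Or.inl (by
    rw [← dist_eq_norm, dist_comm]; positivity))
  have e1 : ∀ y' : Euc n, ∀ a : ℝ, (‖y' - x‖ ^ 2) ^ a = dist x y' ^ (2 * a) := by
    intro y' a
    rw [← dist_eq_norm, dist_comm, Real.rpow_mul dist_nonneg]; norm_num
  simp only [e1] at h2
  have e2 : (fun y' : Euc n => dist x y' ^ (-(2 * (n : ℝ)))) = fun y' => dist x y' ^ (2 * -(n : ℝ)) := by
    funext y'; ring_nf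
  have e3 : dpk' x y = (-(n : ℝ) * dist x y ^ (2 * (-(n : ℝ) - 1))) • 2 • (innerSL ℝ) (y - x) := by
    unfold dpk'
    rw [← Nat.cast_smul_eq_nsmul ℝ, smul_smul]
    congr 1
    push_cast
    ring_nf
  rw [e2, e3]
  exact h2

lemma dp_knorm {n : ℕ} {x y : Euc n} (hxy : x ≠ y) :
    ‖dpk' x y‖ ≤ 2 * n * dist x y ^ (-(2 * (n : ℝ)) - 1) := by
  have h0 : 0 < dist x y := dist_pos.2 hxy
  unfold dpk'
  rw [norm_smul, innerSL_apply_norm, norm_mul, norm_neg, ← dist_eq_norm, dist_comm y x]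
  rw [Real.norm_of_nonneg (by positivity), Real.norm_of_nonneg (by positivity), mul_assoc]
  have : dist x y ^ (-(2 * (n : ℝ)) - 2) * dist x y = dist x y ^ (-(2 * (n : ℝ)) - 1) := by
    rw [← Real.rpow_add_one h0.ne']; ring_nf
  rw [this]

lemma DpGood.dpos {n : ℕ} {d C₀ : ℝ} {Γ : Set (Euc n)} (h : DpGood n d C₀ Γ) {x y : Euc n}
    (hx : x ∈ Γ) (hy : y ∉ Γ) : infDist y Γ ≤ dist x y ∧ x ≠ y ∧ 0 < dist x y := by
  have h1 : infDist y Γ ≤ dist x y := by rw [dist_comm]; exact infDist_le_dist_of_mem hx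
  have h2 : 0 < dist x y := (h.pos hy).trans_le h1
  exact ⟨h1, dist_pos.1 h2, h2⟩

lemma DpGood.aemem {n : ℕ} {d C₀ : ℝ} {Γ : Set (Euc n)} (h : DpGood n d C₀ Γ) :
    ∀ᵐ x ∂(dpS d Γ), x ∈ Γ := ae_restrict_mem h.cl.measurableSet

lemma dp_knorm2 {n : ℕ} {d C₀ : ℝ} {Γ : Set (Euc n)} (h : DpGood n d C₀ Γ) {x y : Euc n}
    (hx : x ∈ Γ) (hy : y ∉ Γ) :
    ‖dpk' x y‖ ≤ 2 * n * (infDist y Γ)⁻¹ * dist x y ^ (-(2 * (n : ℝ))) := by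
  obtain ⟨h1, h2, h3⟩ := h.dpos hx hy
  have hp := h.pos hy
  refine (dp_knorm h2).trans ?_
  rw [Real.rpow_sub_one h3.ne', mul_assoc (2 * (n : ℝ))]
  gcongr
  rw [div_eq_inv_mul]
  gcongr

lemma dp_kmeas {n : ℕ} (y : Euc n) : Measurable (fun x : Euc n => dpk' x y) := by
  unfold dpk'
  have h1 : Continuous fun x : Euc n => innerSL ℝ (y - x) :=
    (innerSL ℝ).continuous.comp (by fun_prop)
  have h2 : Measurable fun x : Euc n => -(2 * (n : ℝ)) * dist x y ^ (-(2 * (n : ℝ)) - 2) := by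
    fun_prop
  exact h2.smul h1.measurable

lemma dp_deriv {n : ℕ} {d C₀ : ℝ} {Γ : Set (Euc n)} (h : DpGood n d C₀ Γ) {G : Euc n → ℝ}
    (hG : Measurable G) {y : Euc n} (hy : y ∉ Γ)
    (hI : Integrable (fun x => G x * dist x y ^ (-(2 * (n : ℝ)))) (dpS d Γ)) :
    HasFDerivAt (fun y' => ∫ x, G x * dist x y' ^ (-(2 * (n : ℝ))) ∂(dpS d Γ))
      (∫ x, G x • dpk' x y ∂(dpS d Γ)) y := by
  have hp := h.pos hy
  have hle : ∀ x ∈ Γ, ∀ y' ∈ ball y (infDist y Γ / 2), dist x y / 2 ≤ dist x y' ∧ x ≠ y' := by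
    intro x hx y' hy'
    obtain ⟨h1, h2, h3⟩ := h.dpos hx hy
    have h4 := dist_triangle x y' y
    rw [mem_ball] at hy'
    have h5 : dist x y / 2 ≤ dist x y' := by linarith
    exact ⟨h5, dist_pos.1 (by linarith)⟩
  refine hasFDerivAt_integral_of_dominated_of_fderiv_le
    (s := ball y (infDist y Γ / 2)) (F' := fun y' x => G x • dpk' x y')
    (bound := fun x => (2 * n * (2 ^ (2 * (n : ℝ) + 1) * (infDist y Γ)⁻¹)) *
      ‖G x * dist x y ^ (-(2 * (n : ℝ)))‖)
    (ball_mem_nhds y (by positivity)) ?_ hI ?_ ?_ ?_ ?_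
  · exact Eventually.of_forall fun y' => (by fun_prop : Measurable _).aestronglyMeasurable
  · exact (hG.smul (dp_kmeas y)).aestronglyMeasurable
  · filter_upwards [h.aemem] with x hx y' hy'
    obtain ⟨h1, h2, h3⟩ := h.dpos hx hy
    obtain ⟨h4, h5⟩ := hle x hx y' hy'
    rw [norm_smul, norm_mul, Real.norm_of_nonneg (by positivity : 0 ≤ dist x y ^ (-(2 * (n : ℝ))))]
    have h6 := dp_knorm h5
    have h7 : dist x y' ^ (-(2 * (n : ℝ)) - 1) ≤ (dist x y / 2) ^ (-(2 * (n : ℝ)) - 1) :=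
      Real.rpow_le_rpow_of_nonpos (by positivity) h4 (by
        have : (0 : ℝ) ≤ n := by positivity
        linarith)
    have h8 : (dist x y / 2) ^ (-(2 * (n : ℝ)) - 1) =
        2 ^ (2 * (n : ℝ) + 1) * ((dist x y)⁻¹ * dist x y ^ (-(2 * (n : ℝ)))) := by
      rw [Real.div_rpow h3.le (by norm_num), Real.rpow_sub_one h3.ne', div_eq_mul_inv _ ((2 : ℝ) ^ _),
        ← Real.rpow_neg (by norm_num)]
      ring_nf
    calc ‖G x‖ * ‖dpk' x y'‖ ≤ ‖G x‖ * (2 * n * (2 ^ (2 * (n : ℝ) + 1) *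
          ((dist x y)⁻¹ * dist x y ^ (-(2 * (n : ℝ)))))) := by
            gcongr
            refine h6.trans ?_
            rw [← h8]
            gcongr
      _ ≤ ‖G x‖ * (2 * n * (2 ^ (2 * (n : ℝ) + 1) *
          ((infDist y Γ)⁻¹ * dist x y ^ (-(2 * (n : ℝ)))))) := by gcongr
      _ = _ := by ring
  · exact hI.norm.const_mul _
  · filter_upwards [h.aemem] with x hx y' hy'
    exact (dp_kder (hle x hx y' hy').2).const_mul (G x)
lemma dp_wj {α : Type*} [MeasurableSpace α] (σ : Measure α) {a κ : α → ℝ≥0∞}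
    (ha : Measurable a) (hκ : Measurable κ) :
    (∫⁻ x, a x * κ x ∂σ) ^ 2 ≤ (∫⁻ x, κ x ∂σ) * ∫⁻ x, a x ^ 2 * κ x ∂σ := by
  have h1 := dp_jensen (σ.withDensity κ) (f := a) ha.aemeasurable
  rw [lintegral_withDensity_eq_lintegral_mul _ hκ ha,
    lintegral_withDensity_eq_lintegral_mul _ hκ (ha.pow_const 2),
    withDensity_apply _ MeasurableSet.univ, Measure.restrict_univ] at h1
  simpa only [Pi.mul_apply, mul_comm] using h1

lemma dp_kint {n : ℕ} {d C₀ : ℝ} {Γ : Set (Euc n)} (h : DpGood n d C₀ Γ) {q : ℝ} (hq : d < q)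
    {y : Euc n} (hy : y ∉ Γ) : ∫⁻ x, ENNReal.ofReal (dist x y ^ (-q)) ∂(dpS d Γ) < ⊤ := by
  obtain ⟨C, hC⟩ := dp_upper n d C₀ q h.hd0.le hq
  exact (hC Γ h y hy).trans_lt (ENNReal.mul_lt_top ENNReal.coe_lt_top ENNReal.ofReal_lt_top)

lemma dp_kI {n : ℕ} {d C₀ : ℝ} {Γ : Set (Euc n)} (h : DpGood n d C₀ Γ)
    {y : Euc n} (hy : y ∉ Γ) :
    Integrable (fun x => dist x y ^ (-(2 * (n : ℝ)))) (dpS d Γ) := by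
  have hdn := h.hdn
  have hd0 := h.hd0
  refine ⟨(by fun_prop : Measurable _).aestronglyMeasurable, ?_⟩
  rw [hasFiniteIntegral_iff_ofReal (Eventually.of_forall fun x => by positivity)]
  exact dp_kint h (by linarith) hy

lemma dp_gk {n : ℕ} {d C₀ : ℝ} {Γ : Set (Euc n)} (h : DpGood n d C₀ Γ) {g : Euc n → ℝ}
    (hg : Measurable g) {x₀ : Euc n} (hx₀ : x₀ ∈ Γ)
    (hN : ∫⁻ x, ‖g x - g x₀‖ₑ ^ 2 * ENNReal.ofReal (dist x₀ x ^ (-(d + 1))) ∂(dpS d Γ) < ⊤)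
    {y : Euc n} (hy : y ∉ Γ) (c : ℝ) :
    Integrable (fun x => (g x - c) * dist x y ^ (-(2 * (n : ℝ)))) (dpS d Γ) := by
  have hdn := h.hdn
  have hd0 := h.hd0
  have hp := h.pos hy
  suffices H : Integrable (fun x => (g x - g x₀) * dist x y ^ (-(2 * (n : ℝ)))) (dpS d Γ) by
    have := H.add ((dp_kI h hy).const_mul (g x₀ - c))
    refine this.congr (Eventually.of_forall fun x => ?_)
    simp only [Pi.add_apply]; ring
  refine ⟨(by fun_prop : Measurable _).aestronglyMeasurable, ?_⟩
  set K : ℝ := 1 + dist x₀ y / infDist y Γ with hK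
  have hK0 : 0 < K := by positivity
  have hq := dp_kint h (q := 4 * (n : ℝ) - (d + 1)) (by linarith) hy
  refine lt_of_le_of_lt (b := (∫⁻ x, ‖g x - g x₀‖ₑ ^ 2 * ENNReal.ofReal (dist x₀ x ^ (-(d + 1))) ∂(dpS d Γ))
     + ENNReal.ofReal (K ^ (d + 1)) * ∫⁻ x, ENNReal.ofReal (dist x y ^ (-(4 * (n : ℝ) - (d + 1)))) ∂(dpS d Γ)) ?_
    (ENNReal.add_lt_top.2 ⟨hN, ENNReal.mul_lt_top ENNReal.ofReal_lt_top hq⟩)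
  rw [← lintegral_const_mul' _ _ ENNReal.ofReal_ne_top, ← lintegral_add_left (by fun_prop)]
  refine lintegral_mono_ae ?_
  filter_upwards [h.aemem] with x hx
  obtain ⟨h1, h2, h3⟩ := h.dpos hx hy
  rw [← ofReal_norm, ← ofReal_norm, ← ENNReal.ofReal_pow (norm_nonneg _),
    ← ENNReal.ofReal_mul (by positivity), ← ENNReal.ofReal_mul (by positivity),
    ← ENNReal.ofReal_add (by positivity) (by positivity)]
  apply ENNReal.ofReal_le_ofReal
  rw [norm_mul, Real.norm_of_nonneg (by positivity : 0 ≤ dist x y ^ (-(2 * (n : ℝ))))]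
  rcases eq_or_ne x x₀ with rfl | hne
  · simp; positivity
  have hr : 0 < dist x₀ x := dist_pos.2 hne.symm
  have hrK : dist x₀ x ≤ K * dist x y := by
    have := dist_triangle_right x₀ x y
    have h4 : dist x₀ y ≤ dist x₀ y / infDist y Γ * dist x y := by
      rw [div_mul_eq_mul_div, le_div_iff₀ hp]; gcongr
    rw [hK]; linarith
  have hP : 0 < dist x₀ x ^ (d + 1) := by positivity
  have e1 : dist x₀ x ^ (d + 1) * (dist x y ^ (-(2 * (n : ℝ)))) ^ 2 ≤
      K ^ (d + 1) * dist x y ^ (-(4 * (n : ℝ) - (d + 1))) := by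
    have e2 : dist x y ^ (-(4 * (n : ℝ) - (d + 1))) =
        dist x y ^ (d + 1) * (dist x y ^ (-(2 * (n : ℝ)))) ^ 2 := by
      rw [← Real.rpow_natCast (dist x y ^ (-(2 * (n : ℝ)))), ← Real.rpow_mul h3.le, ← Real.rpow_add h3]
      congr 1; push_cast; ring
    rw [e2, ← mul_assoc, ← Real.mul_rpow hK0.le h3.le]
    gcongr
  refine le_trans ?_ (add_le_add le_rfl e1)
  rw [Real.rpow_neg hr.le]
  generalize ‖g x - g x₀‖ = a
  generalize dist x y ^ (-(2 * (n : ℝ))) = k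
  generalize dist x₀ x ^ (d + 1) = P at hP
  have : a ^ 2 * P⁻¹ + P * k ^ 2 - a * k = P⁻¹ * ((a - P * k / 2) ^ 2 + 3 / 4 * (P * k) ^ 2) := by
    field_simp; ring
  have : 0 ≤ P⁻¹ * ((a - P * k / 2) ^ 2 + 3 / 4 * (P * k) ^ 2) := by positivity
  linarith

/-- the extension -/
def dpU {n : ℕ} (d : ℝ) (Γ : Set (Euc n)) (g : Euc n → ℝ) (y : Euc n) : ℝ :=
  (∫ x, g x * dist x y ^ (-(2 * (n : ℝ))) ∂(dpS d Γ)) * (∫ x, dist x y ^ (-(2 * (n : ℝ))) ∂(dpS d Γ))⁻¹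

/-- total kernel mass -/
def dpD {n : ℕ} (d : ℝ) (Γ : Set (Euc n)) (y : Euc n) : ℝ≥0∞ :=
  ∫⁻ x, ENNReal.ofReal (dist x y ^ (-(2 * (n : ℝ)))) ∂(dpS d Γ)

lemma dp_Dinv (n : ℕ) (d C₀ : ℝ) : ∃ C : ℝ≥0, ∀ Γ : Set (Euc n), DpGood n d C₀ Γ →
    ∀ y, y ∉ Γ → (dpD d Γ y)⁻¹ ≤ C * ENNReal.ofReal (infDist y Γ ^ (2 * (n : ℝ) - d)) := by
  obtain ⟨C, hC0, hC⟩ := dp_lower n d C₀ (2 * (n : ℝ)) (by positivity)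
  refine ⟨C, fun Γ h y hy => ?_⟩
  have hp := h.pos hy
  have h1 := (hC Γ h y hy).trans (mul_le_mul_right (setLIntegral_le_lintegral _ _) _)
  change _ ≤ _ * dpD d Γ y at h1
  rw [ENNReal.inv_le_iff_le_mul]
  · have e : (1 : ℝ≥0∞) = ENNReal.ofReal (infDist y Γ ^ (d - 2 * (n : ℝ))) *
        ENNReal.ofReal (infDist y Γ ^ (2 * (n : ℝ) - d)) := by
      rw [← ENNReal.ofReal_mul (by positivity), ← Real.rpow_add hp]; simp
    rw [e]
    calc _ ≤ C * dpD d Γ y * ENNReal.ofReal (infDist y Γ ^ (2 * (n : ℝ) - d)) := by gcongr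
      _ = _ := by ring
  · intro h0
    exact absurd h0 (ENNReal.mul_ne_top ENNReal.coe_ne_top ENNReal.ofReal_ne_top)
  · intro _
    have : 0 < infDist y Γ ^ (2 * (n : ℝ) - d) := by positivity
    simp [hC0.ne', this]
lemma dp_D {n : ℕ} {d C₀ : ℝ} {Γ : Set (Euc n)} (h : DpGood n d C₀ Γ) {y : Euc n} (hy : y ∉ Γ) :
    dpD d Γ y ≠ 0 ∧ dpD d Γ y ≠ ⊤ ∧
      (∫ x, dist x y ^ (-(2 * (n : ℝ))) ∂(dpS d Γ)) = (dpD d Γ y).toReal ∧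
      0 < (dpD d Γ y).toReal := by
  have hdn := h.hdn
  have hd0 := h.hd0
  have h1 : dpD d Γ y ≠ ⊤ := (dp_kint h (q := 2 * (n : ℝ)) (by linarith) hy).ne
  have h0 : dpD d Γ y ≠ 0 := by
    intro h0
    obtain ⟨C, hC⟩ := dp_Dinv n d C₀
    have := hC Γ h y hy
    rw [h0, ENNReal.inv_zero, top_le_iff] at this
    exact ENNReal.mul_ne_top ENNReal.coe_ne_top ENNReal.ofReal_ne_top this
  refine ⟨h0, h1, ?_, ENNReal.toReal_pos h0 h1⟩
  rw [integral_eq_lintegral_of_nonneg_ae (Eventually.of_forall fun x => by positivity)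
    (dp_kI h hy).1]
  rfl

lemma dp_Dsq (D J P : ℝ≥0∞) (h0 : D ≠ 0) (h1 : D ≠ ⊤) (hP : P ≤ D * J) :
    (D⁻¹) ^ 2 * P ≤ D⁻¹ * J := by
  calc (D⁻¹) ^ 2 * P ≤ (D⁻¹) ^ 2 * (D * J) := by gcongr
    _ = D⁻¹ * ((D⁻¹ * D) * J) := by ring
    _ = _ := by rw [ENNReal.inv_mul_cancel h0 h1, one_mul]

lemma dp_Dinve {D : ℝ≥0∞} (h0 : 0 < D.toReal) : ‖(D.toReal)⁻¹‖ₑ = D⁻¹ := by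
  have h1 : D ≠ ⊤ := by rintro rfl; simp at h0
  rw [Real.enorm_of_nonneg (by positivity), ENNReal.ofReal_inv_of_pos h0, ENNReal.ofReal_toReal h1]

lemma dp_Usub {n : ℕ} {d C₀ : ℝ} {Γ : Set (Euc n)} (h : DpGood n d C₀ Γ) {g : Euc n → ℝ}
    {y : Euc n} (hy : y ∉ Γ)
    (hI : Integrable (fun x => g x * dist x y ^ (-(2 * (n : ℝ)))) (dpS d Γ)) (c : ℝ) :
    dpU d Γ g y - c = (∫ x, (g x - c) * dist x y ^ (-(2 * (n : ℝ))) ∂(dpS d Γ)) *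
      ((dpD d Γ y).toReal)⁻¹ := by
  obtain ⟨h0, h1, h2, h3⟩ := dp_D h hy
  simp only [sub_mul]
  rw [integral_sub hI ((dp_kI h hy).const_mul c), integral_const_mul, dpU, h2]
  field_simp

lemma dp_U1 {n : ℕ} {d C₀ : ℝ} {Γ : Set (Euc n)} (h : DpGood n d C₀ Γ) {g : Euc n → ℝ}
    (hg : Measurable g) {y : Euc n} (hy : y ∉ Γ)
    (hI : Integrable (fun x => g x * dist x y ^ (-(2 * (n : ℝ)))) (dpS d Γ)) (c : ℝ) :
    ‖dpU d Γ g y - c‖ₑ ^ 2 ≤ (dpD d Γ y)⁻¹ *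
      ∫⁻ x, ‖g x - c‖ₑ ^ 2 * ENNReal.ofReal (dist x y ^ (-(2 * (n : ℝ)))) ∂(dpS d Γ) := by
  obtain ⟨h0, h1, h2, h3⟩ := dp_D h hy
  rw [dp_Usub h hy hI, enorm_mul, dp_Dinve h3, mul_pow, mul_comm]
  refine dp_Dsq _ _ _ h0 h1 (le_trans ?_ (dp_wj (dpS d Γ) (by fun_prop) (by fun_prop)))
  gcongr
  refine (enorm_integral_le_lintegral_enorm _).trans (le_of_eq ?_)
  congr with x
  rw [enorm_mul, Real.enorm_of_nonneg (by positivity : 0 ≤ dist x y ^ (-(2 * (n : ℝ))))]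

lemma dp_U2 {n : ℕ} {d C₀ : ℝ} {Γ : Set (Euc n)} (h : DpGood n d C₀ Γ) {g : Euc n → ℝ}
    (hg : Measurable g)
    (hI : ∀ y ∉ Γ, ∀ c, Integrable (fun x => (g x - c) * dist x y ^ (-(2 * (n : ℝ)))) (dpS d Γ))
    {y : Euc n} (hy : y ∉ Γ) :
    ∃ L : Euc n →L[ℝ] ℝ, HasFDerivAt (dpU d Γ g) L y ∧
    ‖L‖ₑ ^ 2 ≤ ENNReal.ofReal ((2 * n * (infDist y Γ)⁻¹) ^ 2) * ((dpD d Γ y)⁻¹ *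
      ∫⁻ x, ‖g x - dpU d Γ g y‖ₑ ^ 2 * ENNReal.ofReal (dist x y ^ (-(2 * (n : ℝ)))) ∂(dpS d Γ)) := by
  obtain ⟨h0, h1, h2, h3⟩ := dp_D h hy
  have hI0 : ∀ y ∉ Γ, Integrable (fun x => g x * dist x y ^ (-(2 * (n : ℝ)))) (dpS d Γ) :=
    fun y hy => by simpa using hI y hy 0
  set c := dpU d Γ g y with hc
  have hM := dp_deriv h (hg.sub_const c) hy (hI y hy c)
  have hD := dp_deriv h (G := fun _ => 1) measurable_const hy (by simpa using dp_kI h hy)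
  have hM0 : ∫ x, (g x - c) * dist x y ^ (-(2 * (n : ℝ))) ∂(dpS d Γ) = 0 := by
    have := dp_Usub h hy (hI0 y hy) c
    rw [hc, sub_self] at this
    rcases mul_eq_zero.1 this.symm with h4 | h4
    · exact h4
    · exact absurd (inv_eq_zero.1 h4) h3.ne'
  simp only [one_mul] at hD
  have hDi := (hasFDerivAt_inv (𝕜 := ℝ) (by rw [h2]; exact h3.ne')).comp y hD
  have hmul := (hM.mul hDi).const_add c
  simp only [Function.comp_apply] at hmul
  rw [hM0, zero_smul, zero_add] at hmul
  refine ⟨_, hmul.congr_of_eventuallyEq ?_, ?_⟩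
  · filter_upwards [h.cl.isOpen_compl.mem_nhds hy] with y' hy'
    have := dp_Usub h hy' (hI0 y' hy') c
    rw [← (dp_D h hy').2.2.1] at this
    simp only [Pi.mul_apply, Function.comp_apply]
    linarith
  · rw [h2, enorm_smul, dp_Dinve h3, mul_pow]
    have hp := h.pos hy
    have key : ‖∫ x, (g x - c) • dpk' x y ∂(dpS d Γ)‖ₑ ≤ ENNReal.ofReal (2 * n * (infDist y Γ)⁻¹) *
        ∫⁻ x, ‖g x - c‖ₑ * ENNReal.ofReal (dist x y ^ (-(2 * (n : ℝ)))) ∂(dpS d Γ) := by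
      refine (enorm_integral_le_lintegral_enorm _).trans ?_
      rw [← lintegral_const_mul' _ _ ENNReal.ofReal_ne_top]
      refine lintegral_mono_ae ?_
      filter_upwards [h.aemem] with x hx
      rw [enorm_smul, ← ofReal_norm (dpk' x y), mul_left_comm, ← ENNReal.ofReal_mul (by positivity)]
      gcongr
      exact dp_knorm2 h hx hy
    rw [ENNReal.ofReal_pow (by positivity)]
    calc _ ≤ (dpD d Γ y)⁻¹ ^ 2 * (ENNReal.ofReal (2 * n * (infDist y Γ)⁻¹) *
        ∫⁻ x, ‖g x - c‖ₑ * ENNReal.ofReal (dist x y ^ (-(2 * (n : ℝ)))) ∂(dpS d Γ)) ^ 2 := by gcongr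
      _ = ENNReal.ofReal (2 * n * (infDist y Γ)⁻¹) ^ 2 * ((dpD d Γ y)⁻¹ ^ 2 *
        (∫⁻ x, ‖g x - c‖ₑ * ENNReal.ofReal (dist x y ^ (-(2 * (n : ℝ)))) ∂(dpS d Γ)) ^ 2) := by ring
      _ ≤ _ := by
        refine mul_le_mul_right (dp_Dsq _ _ _ h0 h1 (dp_wj (dpS d Γ) (a := fun x => ‖g x - c‖ₑ)
          (κ := fun x => ENNReal.ofReal (dist x y ^ (-(2 * (n : ℝ))))) ?_ ?_)) _
        · exact (hg.sub_const c).enorm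
        · fun_prop
lemma dp_ibp {n : ℕ} {Γ : Set (Euc n)} {u : Euc n → ℝ}
    (hu : LocallyIntegrable u) (hd : ∀ y ∉ Γ, DifferentiableAt ℝ u y)
    (hv : LocallyIntegrable (gradient u)) : DpGrad u (gradient u) Γ := by
  intro φ hφ hc hs e
  have hφd : ∀ x, DifferentiableAt ℝ φ x := fun x => (hφ.differentiable (by simp)) x
  have hge : Continuous fun x => fderiv ℝ φ x e := (hφ.continuous_fderiv (by simp)).clm_apply continuous_const
  have hgc : HasCompactSupport fun x => fderiv ℝ φ x e := hc.fderiv_apply (𝕜 := ℝ) e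
  have i2 : Integrable (fun x => φ x • gradient u x) :=
      hv.integrable_smul_left_of_hasCompactSupport hφ.continuous hc
  have key := integral_bilinear_hasLineDerivAt_right_eq_neg_left_of_integrable
    (μ := (volume : Measure (Euc n))) (v := e)
    (B := ContinuousLinearMap.mul ℝ ℝ) (f := u) (f' := fun x => inner ℝ (gradient u x) e)
    (g := φ) (g' := fun x => fderiv ℝ φ x e) ?_ ?_ ?_ ?_ ?_
  · simp only [ContinuousLinearMap.mul_apply'] at key
    rw [key]
    congr 1
    exact integral_congr_ae (Eventually.of_forall fun x => mul_comm _ _)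
  · refine (i2.inner_const e).congr (Eventually.of_forall fun x => ?_)
    simp [real_inner_smul_left, mul_comm]
  · exact hu.integrable_smul_right_of_hasCompactSupport hge hgc
  · exact hu.integrable_smul_right_of_hasCompactSupport hφ.continuous hc
  · intro x hx
    rw [inner_gradient_left]
    exact (hd x (hs hx)).hasFDerivAt.hasLineDerivAt e
  · intro x hx
    exact (hφd x).hasFDerivAt.hasLineDerivAt e

lemma dp_ext (n : ℕ) (d C₀ : ℝ) (hn : 2 ≤ n) (hd0 : 0 < d) (hdn : d < (n : ℝ) - 1) :
    ∃ C : ℝ≥0, ∀ Γ : Set (Euc n), DpGood n d C₀ Γ → ∀ g : Euc n → ℝ, Measurable g →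
      (∫⁻ x, ∫⁻ x', ‖g x' - g x‖ₑ ^ 2 * ENNReal.ofReal (dist x x' ^ (-(d + 1))) ∂(dpS d Γ) ∂(dpS d Γ)) < ⊤ →
      ∃ u v, LocallyIntegrable u ∧ LocallyIntegrable v ∧ DpGrad u v Γ ∧
        (∀ᵐ x ∂(dpS d Γ), HasTraceAt u x (g x)) ∧
        ∫⁻ y, ‖v y‖ₑ ^ 2 * ENNReal.ofReal (infDist y Γ ^ (d + 1 - (n : ℝ))) ≤ C *
          ∫⁻ x, ∫⁻ x', ‖g x' - g x‖ₑ ^ 2 * ENNReal.ofReal (dist x x' ^ (-(d + 1))) ∂(dpS d Γ) ∂(dpS d Γ) := by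
  obtain ⟨C1, hC1⟩ := dp_ker1 n d C₀ hd0 hdn
  obtain ⟨C2, hC2⟩ := dp_ker2 n d C₀ hd0 hdn
  obtain ⟨C3, hC3⟩ := dp_Dinv n d C₀
  refine ⟨4 * n ^ 2 * C3 ^ 2 * C1, fun Γ h g hg hN => ?_⟩
  haveI := h.locfin
  have hσ : dpS d Γ ≠ 0 := by
    obtain ⟨x, hx⟩ := h.ne
    intro h0
    have := (h.ar x hx 1 one_pos).1
    rw [inter_comm, ← Measure.restrict_apply measurableSet_ball] at this
    change _ ≤ dpS d Γ _ at this
    rw [h0] at this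
    simp at this
    have := h.hC₀
    linarith
  have hm1 : Measurable (Function.uncurry fun x x' : Euc n =>
      ‖g x' - g x‖ₑ ^ 2 * ENNReal.ofReal (dist x x' ^ (-(d + 1)))) := by
    unfold Function.uncurry; fun_prop
  have hae := ae_lt_top hm1.lintegral_prod_right hN.ne
  obtain ⟨x₀, hx₀, hx₀'⟩ : ∃ x₀ ∈ Γ, ∫⁻ x', ‖g x' - g x₀‖ₑ ^ 2 *
      ENNReal.ofReal (dist x₀ x' ^ (-(d + 1))) ∂(dpS d Γ) < ⊤ := by
    haveI : (ae (dpS d Γ)).NeBot := ae_neBot.2 hσ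
    obtain ⟨x, h1, h2⟩ := (h.aemem.and hae).exists
    exact ⟨x, h1, h2⟩
  have hI : ∀ y ∉ Γ, ∀ c, Integrable (fun x => (g x - c) * dist x y ^ (-(2 * (n : ℝ)))) (dpS d Γ) :=
    fun y hy c => dp_gk h hg hx₀ hx₀' hy c
  have hI0 : ∀ y ∉ Γ, Integrable (fun x => g x * dist x y ^ (-(2 * (n : ℝ)))) (dpS d Γ) :=
    fun y hy => by simpa using hI y hy 0
  have hum : Measurable (dpU d Γ g) := by
    unfold dpU
    refine Measurable.mul ?_ (Measurable.inv ?_)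
    · have : StronglyMeasurable (Function.uncurry fun y x : Euc n => g x * dist x y ^ (-(2 * (n : ℝ)))) := by
        apply Measurable.stronglyMeasurable; unfold Function.uncurry; fun_prop
      exact this.integral_prod_right.measurable
    · have : StronglyMeasurable (Function.uncurry fun y x : Euc n => dist x y ^ (-(2 * (n : ℝ)))) := by
        apply Measurable.stronglyMeasurable; unfold Function.uncurry; fun_prop
      exact this.integral_prod_right.measurable
  have htr : ∀ᵐ x ∂(dpS d Γ), ∫⁻ y, ‖dpU d Γ g y - g x‖ₑ ^ 2 *
      ENNReal.ofReal (dist x y ^ (-((n : ℝ) + 1))) < ⊤ := by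
    filter_upwards [hae, h.aemem] with x hx hxΓ
    refine lt_of_le_of_lt (b := C3 * (C2 * ∫⁻ x', ‖g x' - g x‖ₑ ^ 2 *
      ENNReal.ofReal (dist x x' ^ (-(d + 1))) ∂(dpS d Γ))) ?_ (ENNReal.mul_lt_top ENNReal.coe_lt_top
        (ENNReal.mul_lt_top ENNReal.coe_lt_top hx))
    calc _ ≤ ∫⁻ y, C3 * ∫⁻ x', ‖g x' - g x‖ₑ ^ 2 * (ENNReal.ofReal (infDist y Γ ^ (2 * (n : ℝ) - d)) *
          ENNReal.ofReal (dist x' y ^ (-(2 * (n : ℝ)))) * ENNReal.ofReal (dist x y ^ (-((n : ℝ) + 1)))) ∂(dpS d Γ) := by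
          refine lintegral_mono_ae ?_
          filter_upwards [h.aenot] with y hy
          calc _ ≤ ((C3 * ENNReal.ofReal (infDist y Γ ^ (2 * (n : ℝ) - d))) *
            ∫⁻ x', ‖g x' - g x‖ₑ ^ 2 * ENNReal.ofReal (dist x' y ^ (-(2 * (n : ℝ)))) ∂(dpS d Γ)) *
            ENNReal.ofReal (dist x y ^ (-((n : ℝ) + 1))) := by
                gcongr
                exact (dp_U1 h hg hy (hI0 y hy) (g x)).trans (mul_le_mul_left (hC3 Γ h y hy) _)
            _ = C3 * ((ENNReal.ofReal (infDist y Γ ^ (2 * (n : ℝ) - d)) *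
            ENNReal.ofReal (dist x y ^ (-((n : ℝ) + 1)))) *
            ∫⁻ x', ‖g x' - g x‖ₑ ^ 2 * ENNReal.ofReal (dist x' y ^ (-(2 * (n : ℝ)))) ∂(dpS d Γ)) := by ring
            _ = _ := by
                rw [← lintegral_const_mul' _ _ (by finiteness)]
                congr 2 with x'
                ring
      _ = C3 * ∫⁻ x', ‖g x' - g x‖ₑ ^ 2 * (∫⁻ y, ENNReal.ofReal (infDist y Γ ^ (2 * (n : ℝ) - d)) *
          ENNReal.ofReal (dist x' y ^ (-(2 * (n : ℝ)))) * ENNReal.ofReal (dist x y ^ (-((n : ℝ) + 1)))) ∂(dpS d Γ) := by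
          rw [lintegral_const_mul' _ _ ENNReal.coe_ne_top, lintegral_lintegral_swap]
          · congr 2 with x'
            rw [lintegral_const_mul' _ _ (by finiteness)]
          · refine Measurable.aemeasurable ?_
            unfold Function.uncurry
            fun_prop
      _ ≤ C3 * ∫⁻ x', C2 * (‖g x' - g x‖ₑ ^ 2 * ENNReal.ofReal (dist x x' ^ (-(d + 1)))) ∂(dpS d Γ) := by
          refine mul_le_mul_right (lintegral_mono_ae ?_) _
          filter_upwards [h.aemem] with x' hx'
          rcases eq_or_ne x x' with rfl | hne
          · simp
          · rw [mul_left_comm]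
            exact mul_le_mul_right (hC2 Γ h x hxΓ x' hx' hne) _
      _ = _ := by rw [lintegral_const_mul' _ _ ENNReal.coe_ne_top]
  have hTr : ∀ᵐ x ∂(dpS d Γ), LocallyIntegrable (dpU d Γ g) ∧ HasTraceAt (dpU d Γ g) x (g x) := by
    filter_upwards [htr] with x hx
    exact dp_traceT hn x (g x) hum.aestronglyMeasurable hx
  have hU : LocallyIntegrable (dpU d Γ g) := by
    haveI : (ae (dpS d Γ)).NeBot := ae_neBot.2 hσ
    exact hTr.exists.choose_spec.1
  have hgm : Measurable (gradient (dpU d Γ g)) := by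
    unfold gradient
    exact (LinearIsometryEquiv.continuous _).measurable.comp (measurable_fderiv ℝ _)
  have hbd : ∫⁻ y, ‖gradient (dpU d Γ g) y‖ₑ ^ 2 * ENNReal.ofReal (infDist y Γ ^ (d + 1 - (n : ℝ))) ≤
      (4 * n ^ 2 * C3 ^ 2 * C1 : ℝ≥0) *
        ∫⁻ x, ∫⁻ x', ‖g x' - g x‖ₑ ^ 2 * ENNReal.ofReal (dist x x' ^ (-(d + 1))) ∂(dpS d Γ) ∂(dpS d Γ) := by
    calc _ ≤ ∫⁻ y, (4 * n ^ 2 * C3 ^ 2 : ℝ≥0) * ∫⁻ x, ∫⁻ x', ‖g x' - g x‖ₑ ^ 2 *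
          (ENNReal.ofReal (infDist y Γ ^ (4 * (n : ℝ) - d - 1 - n)) *
          ENNReal.ofReal (dist x y ^ (-(2 * (n : ℝ)))) * ENNReal.ofReal (dist x' y ^ (-(2 * (n : ℝ)))))
          ∂(dpS d Γ) ∂(dpS d Γ) := by
          refine lintegral_mono_ae ?_
          filter_upwards [h.aenot] with y hy
          have hp := h.pos hy
          obtain ⟨L, hL, hLb⟩ := dp_U2 h hg hI hy
          have hn1 : ‖gradient (dpU d Γ g) y‖ₑ = ‖L‖ₑ := by
            rw [← ofReal_norm, ← ofReal_norm]
            unfold gradient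
            rw [LinearIsometryEquiv.norm_map, hL.fderiv]
          rw [hn1]
          have hJ : ∫⁻ x, ‖g x - dpU d Γ g y‖ₑ ^ 2 * ENNReal.ofReal (dist x y ^ (-(2 * (n : ℝ)))) ∂(dpS d Γ) ≤
              (dpD d Γ y)⁻¹ * ∫⁻ x, ∫⁻ x', ‖g x' - g x‖ₑ ^ 2 * (ENNReal.ofReal (dist x y ^ (-(2 * (n : ℝ)))) *
              ENNReal.ofReal (dist x' y ^ (-(2 * (n : ℝ))))) ∂(dpS d Γ) ∂(dpS d Γ) := by
            rw [← lintegral_const_mul' _ _ (ENNReal.inv_ne_top.2 (dp_D h hy).1)]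
            refine lintegral_mono fun x => ?_
            have := dp_U1 h hg hy (hI0 y hy) (g x)
            rw [← enorm_neg, neg_sub] at this
            calc _ ≤ ((dpD d Γ y)⁻¹ * ∫⁻ x', ‖g x' - g x‖ₑ ^ 2 *
                  ENNReal.ofReal (dist x' y ^ (-(2 * (n : ℝ)))) ∂(dpS d Γ)) *
                  ENNReal.ofReal (dist x y ^ (-(2 * (n : ℝ)))) := by gcongr
              _ = _ := by
                rw [mul_assoc, ← lintegral_mul_const' _ _ ENNReal.ofReal_ne_top]
                congr 2 with x'
                ring
          set I := ∫⁻ x, ∫⁻ x', ‖g x' - g x‖ₑ ^ 2 * (ENNReal.ofReal (dist x y ^ (-(2 * (n : ℝ)))) *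
              ENNReal.ofReal (dist x' y ^ (-(2 * (n : ℝ))))) ∂(dpS d Γ) ∂(dpS d Γ) with hId
          have hI2 : ∫⁻ x, ∫⁻ x', ‖g x' - g x‖ₑ ^ 2 *
              (ENNReal.ofReal (infDist y Γ ^ (4 * (n : ℝ) - d - 1 - n)) *
              ENNReal.ofReal (dist x y ^ (-(2 * (n : ℝ)))) * ENNReal.ofReal (dist x' y ^ (-(2 * (n : ℝ)))))
              ∂(dpS d Γ) ∂(dpS d Γ) = ENNReal.ofReal (infDist y Γ ^ (4 * (n : ℝ) - d - 1 - n)) * I := by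
            rw [hId, ← lintegral_const_mul' _ _ ENNReal.ofReal_ne_top]
            congr with x
            rw [← lintegral_const_mul' _ _ ENNReal.ofReal_ne_top]
            congr with x'
            ring
          rw [hI2]
          calc _ ≤ (ENNReal.ofReal ((2 * n * (infDist y Γ)⁻¹) ^ 2) *
                ((C3 * ENNReal.ofReal (infDist y Γ ^ (2 * (n : ℝ) - d))) *
                ((C3 * ENNReal.ofReal (infDist y Γ ^ (2 * (n : ℝ) - d))) * I))) *
                ENNReal.ofReal (infDist y Γ ^ (d + 1 - (n : ℝ))) := by
                refine mul_le_mul_left (hLb.trans ?_) _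
                have h3 := hC3 Γ h y hy
                gcongr
                exact hJ.trans (mul_le_mul_left h3 _)
            _ = C3 ^ 2 * (ENNReal.ofReal ((2 * n * (infDist y Γ)⁻¹) ^ 2) *
                ENNReal.ofReal (infDist y Γ ^ (2 * (n : ℝ) - d)) *
                ENNReal.ofReal (infDist y Γ ^ (2 * (n : ℝ) - d)) *
                ENNReal.ofReal (infDist y Γ ^ (d + 1 - (n : ℝ)))) * I := by ring
            _ = C3 ^ 2 * (ENNReal.ofReal (4 * n ^ 2) * ENNReal.ofReal (infDist y Γ ^ (4 * (n : ℝ) - d - 1 - n))) * I := by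
                congr 2
                rw [← ENNReal.ofReal_mul (by positivity), ← ENNReal.ofReal_mul (by positivity),
                  ← ENNReal.ofReal_mul (by positivity), ← ENNReal.ofReal_mul (by positivity)]
                congr 1
                have e : infDist y Γ ^ (4 * (n : ℝ) - d - 1 - n) = (infDist y Γ)⁻¹ ^ 2 *
                    infDist y Γ ^ (2 * (n : ℝ) - d) * infDist y Γ ^ (2 * (n : ℝ) - d) *
                    infDist y Γ ^ (d + 1 - (n : ℝ)) := by
                  rw [inv_pow, ← Real.rpow_natCast, ← Real.rpow_neg hp.le, ← Real.rpow_add hp,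
                    ← Real.rpow_add hp, ← Real.rpow_add hp]
                  congr 1; push_cast; ring
                rw [e]; ring
            _ = _ := by
                have e : ENNReal.ofReal (4 * n ^ 2) = 4 * (n : ℝ≥0∞) ^ 2 := by
                  rw [ENNReal.ofReal_mul (by norm_num), ENNReal.ofReal_pow (by positivity)]
                  simp
                rw [e]; push_cast; ring
      _ = (4 * n ^ 2 * C3 ^ 2 : ℝ≥0) * ∫⁻ x, ∫⁻ x', ‖g x' - g x‖ₑ ^ 2 *
          (∫⁻ y, ENNReal.ofReal (infDist y Γ ^ (4 * (n : ℝ) - d - 1 - n)) *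
          ENNReal.ofReal (dist x y ^ (-(2 * (n : ℝ)))) * ENNReal.ofReal (dist x' y ^ (-(2 * (n : ℝ)))))
          ∂(dpS d Γ) ∂(dpS d Γ) := by
          rw [lintegral_const_mul' _ _ ENNReal.coe_ne_top, lintegral_lintegral_swap]
          · congr 2 with x
            rw [lintegral_lintegral_swap]
            · congr with x'
              rw [lintegral_const_mul' _ _ (by finiteness)]
            · refine Measurable.aemeasurable ?_
              unfold Function.uncurry
              fun_prop
          · refine Measurable.aemeasurable ?_
            have : Measurable fun p : (Euc n × Euc n) × Euc n => ‖g p.2 - g p.1.2‖ₑ ^ 2 *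
              (ENNReal.ofReal (infDist p.1.1 Γ ^ (4 * (n : ℝ) - d - 1 - n)) *
              ENNReal.ofReal (dist p.1.2 p.1.1 ^ (-(2 * (n : ℝ)))) *
              ENNReal.ofReal (dist p.2 p.1.1 ^ (-(2 * (n : ℝ))))) := by fun_prop
            exact this.lintegral_prod_right'
      _ ≤ (4 * n ^ 2 * C3 ^ 2 : ℝ≥0) * ∫⁻ x, ∫⁻ x', C1 * (‖g x' - g x‖ₑ ^ 2 *
          ENNReal.ofReal (dist x x' ^ (-(d + 1)))) ∂(dpS d Γ) ∂(dpS d Γ) := by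
          refine mul_le_mul_right (lintegral_mono_ae ?_) _
          filter_upwards [h.aemem] with x hx
          refine lintegral_mono_ae ?_
          filter_upwards [h.aemem] with x' hx'
          rcases eq_or_ne x x' with rfl | hne
          · simp
          · rw [mul_left_comm]
            exact mul_le_mul_right (hC1 Γ h x hx x' hx' hne) _
      _ = _ := by
          simp only [lintegral_const_mul' _ _ ENNReal.coe_ne_top]
          push_cast; ring
  refine ⟨dpU d Γ g, gradient (dpU d Γ g), hU, ?_, ?_, hTr.mono fun x hx => hx.2, hbd⟩
  · refine dp_wloc h (a := d + 1 - n) (by linarith) hgm.aestronglyMeasurable (hbd.trans_lt ?_)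
    exact ENNReal.mul_lt_top ENNReal.coe_lt_top hN
  · refine dp_ibp hU (fun y hy => ?_) ?_
    · obtain ⟨L, hL, _⟩ := dp_U2 h hg hI hy
      exact hL.differentiableAt
    · refine dp_wloc h (a := d + 1 - n) (by linarith) hgm.aestronglyMeasurable (hbd.trans_lt ?_)
      exact ENNReal.mul_lt_top ENNReal.coe_lt_top hN
/-- mollification -/
def dpM {n : ℕ} (f ρ : Euc n → ℝ) : Euc n → ℝ :=
  convolution f ρ (ContinuousLinearMap.mul ℝ ℝ) volume

lemma dpM_apply {n : ℕ} (f ρ : Euc n → ℝ) (x : Euc n) : dpM f ρ x = ∫ y, f y * ρ (x - y) := rfl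

lemma dp_li_mul {n : ℕ} {E : Type*} [NormedAddCommGroup E] [NormedSpace ℝ E] {η : Euc n → ℝ} {u : Euc n → E}
    (hη : Continuous η) (hc : HasCompactSupport η)
    (hu : LocallyIntegrable u) : Integrable fun y => η y • u y :=
  hu.integrable_smul_left_of_hasCompactSupport hη hc

lemma dp_conv {n : ℕ} {Γ : Set (Euc n)} {u : Euc n → ℝ} {v : Euc n → Euc n}
    (hu : LocallyIntegrable u) (hv : LocallyIntegrable v) (hG : DpGrad u v Γ) {η ρ : Euc n → ℝ}
    (hη : ContDiff ℝ (⊤ : ℕ∞) η) (hηc : HasCompactSupport η) (hηs : tsupport η ⊆ Γᶜ)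
    (hρ : ContDiff ℝ (⊤ : ℕ∞) ρ) (hρc : HasCompactSupport ρ) :
    ContDiff ℝ (⊤ : ℕ∞) (dpM (fun y => η y * u y) ρ) ∧
    HasCompactSupport (dpM (fun y => η y * u y) ρ) ∧
    ∀ x, gradient (dpM (fun y => η y * u y) ρ) x =
      ∫ y, ρ (x - y) • (η y • v y + u y • gradient η y) := by
  have hf : LocallyIntegrable (fun y => η y * u y) := (dp_li_mul hη.continuous hηc hu).locallyIntegrable
  refine ⟨hρc.contDiff_convolution_right _ hf hρ, HasCompactSupport.convolution _ hηc.mul_right hρc, fun x => ?_⟩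
  have hd := hρc.hasFDerivAt_convolution_right (ContinuousLinearMap.mul ℝ ℝ) hf
    (hρ.of_le (by simp)) x
  have hρx : ContDiff ℝ (⊤ : ℕ∞) fun y => ρ (x - y) := hρ.comp (contDiff_const.sub contDiff_id)
  have hρxc : HasCompactSupport fun y => ρ (x - y) := hρc.comp_homeomorph (Homeomorph.subLeft x)
  have hi1 : Integrable fun y => ρ (x - y) • (η y • v y + u y • gradient η y) :=
    dp_li_mul hρx.continuous hρxc (((dp_li_mul hη.continuous hηc hv).add
      (hu.integrable_smul_right_of_hasCompactSupport (dp_cont_gradient hη) (dp_cs_gradient hηc))).locallyIntegrable)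
  refine ext_inner_right ℝ fun e => ?_
  rw [inner_gradient_left, real_inner_comm, ← integral_inner hi1]
  have h1 : fderiv ℝ (dpM (fun y => η y * u y) ρ) x e = ∫ y, (η y * u y) * fderiv ℝ ρ (x - y) e := by
    unfold dpM
    rw [hd.fderiv, convolution_def, ContinuousLinearMap.integral_apply]
    · rfl
    · exact (hρc.fderiv ℝ).convolutionExists_right _ hf (hρ.continuous_fderiv (by simp)) x
  rw [h1]
  have hdρ : ∀ y, HasFDerivAt (fun y => ρ (x - y)) (-(fderiv ℝ ρ (x - y))) y := by
    intro y
    have h2 : HasFDerivAt (fun y : Euc n => x - y) (-(ContinuousLinearMap.id ℝ (Euc n))) y :=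
      (hasFDerivAt_id y).const_sub x
    have h3 := ((hρ.differentiable (by simp)) (x - y)).hasFDerivAt.comp y h2
    have e : (fderiv ℝ ρ (x - y)).comp (-(ContinuousLinearMap.id ℝ (Euc n))) = -(fderiv ℝ ρ (x - y)) := by
      ext; simp
    rw [e] at h3
    exact h3
  have h2 := hG (fun y => η y * ρ (x - y)) (hη.mul hρx) hηc.mul_right
    ((tsupport_mul_subset_left).trans hηs) e
  have h3 : ∀ y, fderiv ℝ (fun y => η y * ρ (x - y)) y e =
      fderiv ℝ η y e * ρ (x - y) - η y * fderiv ℝ ρ (x - y) e := by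
    intro y
    have := (((hη.differentiable (by simp)) y).hasFDerivAt.mul (hdρ y)).fderiv
    change fderiv ℝ (η * fun y => ρ (x - y)) y e = _
    rw [this]
    simp
    ring
  simp only [h3] at h2
  have i1 : Integrable fun y => u y * (fderiv ℝ η y e * ρ (x - y)) := by
    have := hu.integrable_smul_right_of_hasCompactSupport
      (g := fun y => fderiv ℝ η y e * ρ (x - y))
      (((hη.continuous_fderiv (by simp)).clm_apply continuous_const).mul hρx.continuous) hρxc.mul_left
    exact this
  have i2 : Integrable fun y => u y * (η y * fderiv ℝ ρ (x - y) e) := by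
    have := hu.integrable_smul_right_of_hasCompactSupport
      (g := fun y => η y * fderiv ℝ ρ (x - y) e)
      (hη.continuous.mul (((hρ.continuous_fderiv (by simp)).comp
        (continuous_const.sub continuous_id)).clm_apply continuous_const)) hηc.mul_right
    exact this
  have i3 : Integrable fun y => η y * ρ (x - y) * inner ℝ (v y) e := by
    have := (dp_li_mul (η := fun y => η y * ρ (x - y)) (hη.continuous.mul hρx.continuous)
      hηc.mul_right hv).inner_const (𝕜 := ℝ) e
    refine this.congr (Eventually.of_forall fun y => ?_)
    simp only [inner_smul_left]
    rfl
  simp only [mul_sub] at h2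
  rw [integral_sub i1 i2] at h2
  have h4 : ∫ y, (η y * u y) * fderiv ℝ ρ (x - y) e = ∫ y, u y * (η y * fderiv ℝ ρ (x - y) e) :=
    integral_congr_ae (Eventually.of_forall fun y => by ring)
  rw [h4]
  have h5 : ∫ y, inner ℝ e (ρ (x - y) • (η y • v y + u y • gradient η y)) =
     (∫ y, u y * (fderiv ℝ η y e * ρ (x - y))) + ∫ y, η y * ρ (x - y) * inner ℝ (v y) e := by
    rw [← integral_add i1 i3]
    refine integral_congr_ae (Eventually.of_forall fun y => ?_)
    simp only [inner_smul_right, inner_add_right]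
    rw [real_inner_comm (gradient η y) e, inner_gradient_left, real_inner_comm e (v y)]
    ring
  rw [h5]
  linarith
lemma dp_c_cont {n : ℕ} {F G : Euc n → Euc n} (hF : MemLp F 2 volume) (hG : MemLp G 2 volume) :
    Continuous fun t : Euc n => ∫ y, inner ℝ (G (y + t)) (F y) := by
  have e : (fun t : Euc n => ∫ y, inner ℝ (G (y + t)) (F y)) =
      fun t => inner ℝ (DomAddAct.mk t +ᵥ hG.toLp G) (hF.toLp F) := by
    funext t
    rw [DomAddAct.mk_vadd_toLp, L2.inner_def]
    refine integral_congr_ae ?_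
    filter_upwards [MemLp.coeFn_toLp (hG.comp_measurePreserving (measurePreserving_vadd t volume)),
      hF.coeFn_toLp] with y h1 h2
    have h1' : (MemLp.toLp (fun x => G (t +ᵥ x))
      (hG.comp_measurePreserving (measurePreserving_vadd t volume))) y = G (t + y) := h1
    rw [h1', h2, add_comm]
  rw [e]
  have : Fact ((1 : ℝ≥0∞) ≤ 2) := ⟨by norm_num⟩
  have : Fact ((2 : ℝ≥0∞) ≠ ⊤) := ⟨by norm_num⟩
  have hm : Continuous fun t : Euc n => DomAddAct.mk t := DomAddAct.continuous_mk
  have h3 : Continuous fun t : Euc n => DomAddAct.mk t +ᵥ hG.toLp G := hm.vadd continuous_const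
  exact h3.inner continuous_const

lemma dp_moll0 {n : ℕ} {F G : Euc n → Euc n} (hF : MemLp F 2 volume) (hG : MemLp G 2 volume)
    (hFi : Integrable F) (hGi : Integrable G) {r : ℝ} (hr : 0 < r)
    (hz : ∀ φ : ContDiffBump (0 : Euc n), φ.rOut ≤ r →
      ∫ x, inner ℝ (G x) (∫ y, φ.normed volume (x - y) • F y) = 0) :
    ∫ y, inner ℝ (G y) (F y) = 0 := by
  set c : Euc n → ℝ := fun t => ∫ y, inner ℝ (G (y + t)) (F y) with hc
  have hcc : Continuous c := dp_c_cont hF hG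
  have h0 : c 0 = ∫ y, inner ℝ (G y) (F y) := by simp [hc]
  rw [← h0]
  have key : ∀ φ : ContDiffBump (0 : Euc n), φ.rOut ≤ r → ∫ t, φ.normed volume t * c t = 0 := by
    intro φ hφ
    have hρ : Continuous (φ.normed (volume : Measure (Euc n))) := φ.continuous_normed
    have hint : Integrable (Function.uncurry fun x y : Euc n =>
        φ.normed volume (x - y) * inner ℝ (G x) (F y)) (volume.prod volume) := by
      obtain ⟨K, hK⟩ := φ.hasCompactSupport_normed (μ := (volume : Measure (Euc n))) |>.exists_bound_of_continuous hρ
      have h1 : Integrable (fun z : Euc n × Euc n => inner ℝ (G z.1) (F z.2)) (volume.prod volume) := by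
        refine (hGi.norm.mul_prod hFi.norm).mono' ?_ (Eventually.of_forall fun z => norm_inner_le_norm _ _)
        exact (hGi.aestronglyMeasurable.comp_fst).inner (hFi.aestronglyMeasurable.comp_snd)
      exact h1.bdd_mul (c := K) (hρ.comp (continuous_fst.sub continuous_snd)).aestronglyMeasurable
        (Eventually.of_forall fun z => hK _)
    have h1 := hz φ hφ
    have h2 : ∫ x, inner ℝ (G x) (∫ y, φ.normed volume (x - y) • F y) =
        ∫ x, ∫ y, φ.normed volume (x - y) * inner ℝ (G x) (F y) := by
      refine integral_congr_ae (Eventually.of_forall fun x => ?_)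
      have hi : Integrable fun y => φ.normed volume (x - y) • F y :=
        dp_li_mul (hρ.comp (continuous_const.sub continuous_id))
          (φ.hasCompactSupport_normed.comp_homeomorph (Homeomorph.subLeft x)) hFi.locallyIntegrable
      show inner ℝ (G x) (∫ y, φ.normed volume (x - y) • F y) = _
      rw [← integral_inner hi]
      simp only [inner_smul_right]
    rw [h2, integral_integral_swap hint] at h1
    have h3 : ∀ y, ∫ x, φ.normed volume (x - y) * inner ℝ (G x) (F y) =
        ∫ t, φ.normed volume t * inner ℝ (G (y + t)) (F y) := by
      intro y
      rw [← integral_add_left_eq_self _ y]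
      simp
    simp only [h3] at h1
    have hint2 : Integrable (Function.uncurry fun y t : Euc n =>
        φ.normed volume t * inner ℝ (G (y + t)) (F y)) (volume.prod volume) := by
      have h5 := ((measurePreserving_prod_add (volume : Measure (Euc n)) (volume : Measure (Euc n))).integrable_comp
        hint.swap.aestronglyMeasurable).2 hint.swap
      refine h5.congr (Eventually.of_forall fun z => ?_)
      simp [Function.uncurry]
    rw [integral_integral_swap hint2] at h1
    simpa only [integral_const_mul] using h1
  by_contra hne
  obtain ⟨s, hs, hs2⟩ := Metric.continuousAt_iff.1 hcc.continuousAt (|c 0| / 2) (by positivity)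
  have hm : 0 < min r s := lt_min hr hs
  let φ : ContDiffBump (0 : Euc n) := ⟨min r s / 2, min r s, by linarith, by linarith⟩
  have h4 := ContDiffBump.dist_normed_convolution_le (μ := (volume : Measure (Euc n))) (φ := φ) (g := c) (x₀ := 0)
    (ε := |c 0| / 2) hcc.aestronglyMeasurable (fun x hx => (hs2 ((mem_ball.1 hx).trans_le (min_le_right _ _))).le)
  have h5 : convolution (φ.normed volume) c (ContinuousLinearMap.lsmul ℝ ℝ) volume 0 = 0 := by
    rw [convolution_def, ← key φ (min_le_left _ _), ← integral_neg_eq_self]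
    refine integral_congr_ae (Eventually.of_forall fun x => ?_)
    simp [ContDiffBump.normed_neg]
  rw [h5, dist_zero_left, Real.norm_eq_abs] at h4
  have : 0 < |c 0| := abs_pos.2 hne
  linarith

open scoped Pointwise in
lemma dp_density1 {n : ℕ} {Γ : Set (Euc n)} {u : Euc n → ℝ} {v G : Euc n → Euc n} (hΓ : IsClosed Γ)
    (hu : LocallyIntegrable u) (hv : LocallyIntegrable v) (hD : DpGrad u v Γ)
    (hu2 : ∀ K, IsCompact K → K ⊆ Γᶜ → MemLp u 2 (volume.restrict K))
    (hv2 : ∀ K, IsCompact K → K ⊆ Γᶜ → MemLp v 2 (volume.restrict K))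
    (hG2 : ∀ K, IsCompact K → K ⊆ Γᶜ → MemLp G 2 (volume.restrict K))
    (hG : ∀ φ : Euc n → ℝ, ContDiff ℝ (⊤ : ℕ∞) φ → HasCompactSupport φ → tsupport φ ⊆ Γᶜ →
      ∫ x, inner ℝ (G x) (gradient φ x) = 0) {η : Euc n → ℝ}
    (hη : ContDiff ℝ (⊤ : ℕ∞) η) (hηc : HasCompactSupport η) (hηs : tsupport η ⊆ Γᶜ) :
    ∫ x, inner ℝ (G x) (η x • v x + u x • gradient η x) = 0 := by
  obtain ⟨r, hr, hrs⟩ := hηc.isCompact.exists_cthickening_subset_open hΓ.isOpen_compl hηs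
  set K := cthickening r (tsupport η) with hK
  have hKc : IsCompact K := hηc.isCompact.cthickening
  have hKm : MeasurableSet K := hKc.measurableSet
  have hηK : tsupport η ⊆ K := self_subset_cthickening _
  set F : Euc n → Euc n := fun x => η x • v x + u x • gradient η x with hF
  have hη0 : ∀ x ∉ K, η x = 0 := fun x hx => image_eq_zero_of_notMem_tsupport fun h => hx (hηK h)
  have hgη : ∀ x ∉ tsupport η, gradient η x = 0 := by
    intro x hx
    have : fderiv ℝ η x = 0 := image_eq_zero_of_notMem_tsupport fun h => hx (tsupport_fderiv_subset ℝ h)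
    simp [gradient, this]
  have hg0 : ∀ x ∉ K, gradient η x = 0 := fun x hx => hgη x fun h => hx (hηK h)
  have hFK : K.indicator F = F := by
    refine indicator_eq_self.2 fun x hx => ?_
    by_contra h
    exact hx (by simp [hF, hη0 x h, hg0 x h])
  have hF2 : MemLp F 2 volume := by
    rw [← hFK, memLp_indicator_iff_restrict hKm]
    obtain ⟨c1, hc1⟩ := hηc.exists_bound_of_continuous hη.continuous
    obtain ⟨c2, hc2⟩ := (dp_cs_gradient hηc).exists_bound_of_continuous (dp_cont_gradient hη)
    refine MemLp.add ?_ ?_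
    · refine MemLp.of_le_mul (c := c1) (hv2 K hKc hrs)
        (hη.continuous.aestronglyMeasurable.smul (hv2 K hKc hrs).1) (Eventually.of_forall fun x => ?_)
      rw [norm_smul]
      exact mul_le_mul_of_nonneg_right (hc1 x) (norm_nonneg _)
    · refine MemLp.of_le_mul (c := c2) (hu2 K hKc hrs)
        ((hu2 K hKc hrs).1.smul (dp_cont_gradient hη).aestronglyMeasurable) (Eventually.of_forall fun x => ?_)
      rw [norm_smul, mul_comm]
      exact mul_le_mul_of_nonneg_right (hc2 x) (norm_nonneg _)
  have hfin : ∀ f : Euc n → Euc n, MemLp (K.indicator f) 2 volume → Integrable (K.indicator f) := by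
    intro f hf
    rw [memLp_indicator_iff_restrict hKm] at hf
    have : IsFiniteMeasure ((volume : Measure (Euc n)).restrict K) :=
      ⟨by simpa using hKc.measure_lt_top⟩
    exact (integrable_indicator_iff hKm).2 (hf.integrable (by norm_num))
  have hG'2 : MemLp (K.indicator G) 2 volume := (memLp_indicator_iff_restrict hKm).2 (hG2 K hKc hrs)
  have hmain := dp_moll0 hF2 hG'2 (hFK ▸ hfin F (hFK.symm ▸ hF2)) (hfin G hG'2) hr ?_
  · rw [← hmain]
    refine integral_congr_ae (Eventually.of_forall fun x => ?_)
    by_cases hx : x ∈ K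
    · simp [hx, hF]
    · simp [hx, hη0 x hx, hg0 x hx]
  intro φ hφ
  obtain ⟨m1, m2, m3⟩ := dp_conv hu hv hD hη hηc hηs φ.contDiff_normed
    (φ.hasCompactSupport_normed (μ := (volume : Measure (Euc n))))
  have hsK : tsupport (dpM (fun y => η y * u y) (φ.normed volume)) ⊆ K := by
    refine closure_minimal ((support_convolution_subset _).trans ?_) hKc.isClosed
    have e : tsupport η + closedBall (0 : Euc n) r = K := by
      rw [hηc.isCompact.add_closedBall hr.le]; simp [hK]
    rw [← e]
    refine Set.add_subset_add ?_ ?_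
    · exact fun x hx => subset_tsupport _ (fun h => hx (by simp [h]))
    · exact (subset_tsupport _).trans (φ.tsupport_normed_eq.subset.trans (closedBall_subset_closedBall hφ))
  rw [← hG _ m1 m2 (hsK.trans hrs)]
  refine integral_congr_ae (Eventually.of_forall fun x => ?_)
  simp only
  rw [← m3 x]
  by_cases hx : x ∈ K
  · simp [hx]
  · have : fderiv ℝ (dpM (fun y => η y * u y) (φ.normed volume)) x = 0 :=
      image_eq_zero_of_notMem_tsupport fun h => hx (hsK (tsupport_fderiv_subset ℝ h))
    simp [hx, gradient, this]
lemma dp_smooth {n : ℕ} {f : Euc n → ℝ} {L : ℝ≥0} (hf : LipschitzWith L f) (h01 : ∀ x, f x ∈ Icc (0 : ℝ) 1)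
    {r : ℝ} (hr : 0 < r) : ∃ g : Euc n → ℝ, ContDiff ℝ (⊤ : ℕ∞) g ∧ (∀ x, ‖fderiv ℝ g x‖ ≤ L) ∧
      (∀ x, |g x| ≤ 2) ∧ ∀ x c, (∀ y ∈ ball x r, f y = c) → g x = c := by
  let φ : ContDiffBump (0 : Euc n) := ⟨r / 2, r, by linarith, by linarith⟩
  let g := convolution (φ.normed volume) f (ContinuousLinearMap.lsmul ℝ ℝ) volume
  have hρ : Continuous (φ.normed (volume : Measure (Euc n))) := φ.continuous_normed
  have hi : ∀ x, Integrable fun t => φ.normed volume t * f (x - t) := by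
    intro x
    exact (hρ.mul (hf.continuous.comp (continuous_const.sub continuous_id))).integrable_of_hasCompactSupport
      (φ.hasCompactSupport_normed.mul_right)
  have hg : ∀ x, g x = ∫ t, φ.normed volume t * f (x - t) := fun x => rfl
  refine ⟨g, ?_, ?_, ?_, ?_⟩
  · exact φ.hasCompactSupport_normed.contDiff_convolution_left _ φ.contDiff_normed
      hf.continuous.locallyIntegrable
  · intro x
    refine norm_fderiv_le_of_lipschitz ℝ (LipschitzWith.of_dist_le_mul fun x y => ?_)
    rw [dist_eq_norm, hg, hg, ← integral_sub (hi x) (hi y)]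
    have h1 : ∫ t, φ.normed (volume : Measure (Euc n)) t * (L * dist x y) = L * dist x y := by
      rw [integral_mul_const, φ.integral_normed, one_mul]
    rw [← h1]
    refine norm_integral_le_of_norm_le (φ.integrable_normed.mul_const _) (Eventually.of_forall fun t => ?_)
    rw [← mul_sub, norm_mul, Real.norm_of_nonneg (φ.nonneg_normed t)]
    refine mul_le_mul_of_nonneg_left ?_ (φ.nonneg_normed t)
    have := hf.dist_le_mul (x - t) (y - t)
    rwa [dist_sub_right, dist_eq_norm] at this
  · intro x
    have := ContDiffBump.dist_normed_convolution_le (μ := (volume : Measure (Euc n))) (φ := φ) (g := f) (x₀ := x)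
      (ε := 1) hf.continuous.aestronglyMeasurable (fun y _ => by
        rw [Real.dist_eq, abs_le]
        have := h01 x; have := h01 y
        simp only [mem_Icc] at *
        constructor <;> linarith)
    rw [Real.dist_eq, abs_le] at this
    have h2 := h01 x
    simp only [mem_Icc] at h2
    rw [abs_le]
    change -1 ≤ g x - f x ∧ g x - f x ≤ 1 at this
    constructor <;> linarith
  · intro x c hc
    have := φ.normed_convolution_eq_right (μ := (volume : Measure (Euc n))) (g := f) (x₀ := x)
      (fun y hy => by rw [hc y hy, hc x (mem_ball_self hr)])
    rw [hc x (mem_ball_self hr)] at this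
    exact this

lemma dp_cut {n : ℕ} {d C₀ : ℝ} {Γ : Set (Euc n)} (h : DpGood n d C₀ Γ) : ∃ η : ℕ → Euc n → ℝ,
    (∀ k, ContDiff ℝ (⊤ : ℕ∞) (η k) ∧ HasCompactSupport (η k) ∧ tsupport (η k) ⊆ Γᶜ) ∧
    (∀ k x, |η k x| ≤ 4) ∧ (∀ k x, x ∉ Γ → ‖gradient (η k) x‖ ≤ 12 / infDist x Γ) ∧
    ∀ x ∉ Γ, ∀ᶠ k in atTop, η k x = 1 ∧ gradient (η k) x = 0 := by
  obtain ⟨x₀, hx₀⟩ := h.ne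
  have key : ∀ k : ℕ, ∃ a b : Euc n → ℝ, ContDiff ℝ (⊤ : ℕ∞) a ∧ ContDiff ℝ (⊤ : ℕ∞) b ∧
      (∀ x, |a x| ≤ 2) ∧ (∀ x, |b x| ≤ 2) ∧ (∀ x, ‖fderiv ℝ a x‖ ≤ k + 1) ∧
      (∀ x, ‖fderiv ℝ b x‖ ≤ 1 / (k + 1)) ∧
      (∀ x, infDist x Γ < 1 / (2 * (k + 1)) → a x = 0) ∧ (∀ x, 9 / (4 * (k + 1)) < infDist x Γ → a x = 1) ∧
      (∀ x, dist x x₀ < 3 * (k + 1) / 4 → b x = 1) ∧ (∀ x, 9 * (k + 1) / 4 < dist x x₀ → b x = 0) := by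
    intro k
    have hk : (0 : ℝ) < k + 1 := by positivity
    have hL1 : LipschitzWith (k + 1 : ℝ≥0) fun x : Euc n => max 0 (min 1 ((k + 1) * infDist x Γ - 1)) := by
      refine LipschitzWith.const_max (LipschitzWith.const_min ?_ 1) 0
      refine LipschitzWith.of_dist_le_mul fun x y => ?_
      have := (lipschitz_infDist_pt Γ).dist_le_mul x y
      rw [dist_sub_right, Real.dist_eq, ← mul_sub, abs_mul, abs_of_pos hk, ← Real.dist_eq]
      have e : ((k + 1 : ℝ≥0) : ℝ) = k + 1 := by push_cast; rfl
      rw [e]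
      exact mul_le_mul_of_nonneg_left (by simpa using this) hk.le
    have hL2 : LipschitzWith (1 / (k + 1) : ℝ≥0) fun x : Euc n => max 0 (min 1 (2 - dist x x₀ / (k + 1))) := by
      refine LipschitzWith.const_max (LipschitzWith.const_min ?_ 1) 0
      refine LipschitzWith.of_dist_le_mul fun x y => ?_
      have := dist_dist_dist_le_left x y x₀
      rw [dist_sub_left, Real.dist_eq, ← sub_div, abs_div, abs_of_pos hk, ← Real.dist_eq]
      have e : ((1 / (k + 1) : ℝ≥0) : ℝ) = 1 / (k + 1) := by push_cast; rfl
      rw [e, div_mul_eq_mul_div, one_mul]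
      exact div_le_div_of_nonneg_right this hk.le
    obtain ⟨a, a1, a2, a3, a4⟩ := dp_smooth hL1 (fun x => ⟨le_max_left _ _, max_le zero_le_one (min_le_left _ _)⟩)
      (r := 1 / (4 * (k + 1))) (by positivity)
    obtain ⟨b, b1, b2, b3, b4⟩ := dp_smooth hL2 (fun x => ⟨le_max_left _ _, max_le zero_le_one (min_le_left _ _)⟩)
      (r := (k + 1) / 4) (by positivity)
    refine ⟨a, b, a1, b1, a3, b3, fun x => by simpa using a2 x, fun x => by simpa using b2 x, ?_, ?_, ?_, ?_⟩
    · intro x hx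
      refine a4 x 0 fun y hy => ?_
      have h1 : infDist y Γ ≤ infDist x Γ + dist y x := infDist_le_infDist_add_dist
      rw [mem_ball] at hy
      have e : 1 / (2 * ((k : ℝ) + 1)) + 1 / (4 * (k + 1)) = 3 / 4 / (k + 1) := by field_simp; norm_num
      have h2 : infDist y Γ < 3 / 4 / (k + 1) := by linarith
      rw [lt_div_iff₀ hk] at h2
      rw [max_eq_left]
      exact (min_le_right _ _).trans (by linarith)
    · intro x hx
      refine a4 x 1 fun y hy => ?_
      have h1 : infDist x Γ ≤ infDist y Γ + dist x y := infDist_le_infDist_add_dist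
      rw [mem_ball, dist_comm] at hy
      have e : 9 / (4 * ((k : ℝ) + 1)) - 1 / (4 * (k + 1)) = 2 / (k + 1) := by field_simp; norm_num
      have h2 : 2 / (k + 1) < infDist y Γ := by linarith
      rw [div_lt_iff₀ hk] at h2
      rw [min_eq_left (by linarith), max_eq_right zero_le_one]
    · intro x hx
      refine b4 x 1 fun y hy => ?_
      have h1 := dist_triangle y x x₀
      rw [mem_ball] at hy
      have h2 : dist y x₀ / (k + 1) ≤ 1 := by rw [div_le_one hk]; linarith
      rw [min_eq_left (by linarith), max_eq_right zero_le_one]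
    · intro x hx
      refine b4 x 0 fun y hy => ?_
      have h1 := dist_triangle_left x x₀ y
      rw [mem_ball] at hy
      have h2 : 2 ≤ dist y x₀ / (k + 1) := by rw [le_div_iff₀ hk]; linarith
      rw [max_eq_left]
      exact (min_le_right _ _).trans (by linarith)
  choose a b ha hb a2 b2 a3 b3 a4 a5 b4 b5 using key
  have hfd : ∀ k x, fderiv ℝ (fun x => a k x * b k x) x = a k x • fderiv ℝ (b k) x + b k x • fderiv ℝ (a k) x := by
    intro k x
    exact (((ha k).differentiable (by simp) x).hasFDerivAt.mul ((hb k).differentiable (by simp) x).hasFDerivAt).fderiv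
  have hda : ∀ (k : ℕ) x, 9 / (4 * ((k : ℝ) + 1)) < infDist x Γ → fderiv ℝ (a k) x = 0 := by
    intro k x hx
    have : a k =ᶠ[𝓝 x] fun _ => 1 := by
      filter_upwards [(continuous_infDist_pt Γ).continuousAt.eventually (lt_mem_nhds hx)] with y hy
      exact a5 k y hy
    rw [this.fderiv_eq]; simp
  have hdb : ∀ (k : ℕ) x, 9 * ((k : ℝ) + 1) / 4 < dist x x₀ → fderiv ℝ (b k) x = 0 := by
    intro k x hx
    have : b k =ᶠ[𝓝 x] fun _ => 0 := by
      filter_upwards [(continuous_id.dist continuous_const).continuousAt.eventually (lt_mem_nhds hx)] with y hy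
      exact b5 k y hy
    rw [this.fderiv_eq]; simp
  have hdb1 : ∀ (k : ℕ) x, dist x x₀ < 3 * ((k : ℝ) + 1) / 4 → fderiv ℝ (b k) x = 0 := by
    intro k x hx
    have : b k =ᶠ[𝓝 x] fun _ => 1 := by
      filter_upwards [(continuous_id.dist continuous_const).continuousAt.eventually (gt_mem_nhds hx)] with y hy
      exact b4 k y hy
    rw [this.fderiv_eq]; simp
  refine ⟨fun k x => a k x * b k x, fun k => ⟨(ha k).mul (hb k), ?_, ?_⟩, ?_, ?_, ?_⟩
  · refine HasCompactSupport.of_support_subset_isCompact (isCompact_closedBall x₀ (9 * ((k : ℝ) + 1) / 4)) ?_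
    intro x hx
    by_contra hc
    rw [mem_closedBall, not_le] at hc
    exact hx (by simp [b5 k x hc])
  · have h1 : tsupport (fun x => a k x * b k x) ⊆ {x | 1 / (2 * ((k : ℝ) + 1)) ≤ infDist x Γ} := by
      refine closure_minimal ?_ (isClosed_le continuous_const (continuous_infDist_pt Γ))
      intro x hx
      by_contra hc
      rw [mem_setOf_eq, not_le] at hc
      exact hx (by simp [a4 k x hc])
    intro x hx hxΓ
    have h2 := h1 hx
    rw [mem_setOf_eq, infDist_zero_of_mem hxΓ] at h2
    have : (0 : ℝ) < 1 / (2 * ((k : ℝ) + 1)) := by positivity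
    linarith
  · intro k x
    rw [abs_mul]
    nlinarith [a2 k x, b2 k x, abs_nonneg (a k x), abs_nonneg (b k x)]
  · intro k x hx
    have hδ := h.pos hx
    have hk : (0 : ℝ) < k + 1 := by positivity
    have n1 : ‖fderiv ℝ (a k) x‖ ≤ 3 / infDist x Γ := by
      by_cases hc : 9 / (4 * ((k : ℝ) + 1)) < infDist x Γ
      · rw [hda k x hc]; simp; positivity
      · rw [not_lt, le_div_iff₀ (by positivity)] at hc
        refine (a3 k x).trans ?_
        rw [le_div_iff₀ hδ]; linarith
    have n2 : ‖fderiv ℝ (b k) x‖ ≤ 3 / infDist x Γ := by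
      by_cases hc : 9 * ((k : ℝ) + 1) / 4 < dist x x₀
      · rw [hdb k x hc]; simp; positivity
      · rw [not_lt] at hc
        refine (b3 k x).trans ?_
        have := infDist_le_dist_of_mem (x := x) hx₀
        rw [div_le_div_iff₀ hk hδ]; linarith
    have e : ‖gradient (fun x => a k x * b k x) x‖ = ‖fderiv ℝ (fun x => a k x * b k x) x‖ := by
      simp [gradient]
    rw [e, hfd]
    refine (norm_add_le _ _).trans ?_
    rw [norm_smul, norm_smul, Real.norm_eq_abs, Real.norm_eq_abs]
    have m1 := mul_le_mul (a2 k x) n2 (norm_nonneg _) (by norm_num)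
    have m2 := mul_le_mul (b2 k x) n1 (norm_nonneg _) (by norm_num)
    have : 12 / infDist x Γ = 2 * (3 / infDist x Γ) + 2 * (3 / infDist x Γ) := by ring
    linarith
  · intro x hx
    have hδ := h.pos hx
    obtain ⟨N, hN⟩ := exists_nat_gt (max (9 / infDist x Γ) (4 * dist x x₀))
    filter_upwards [eventually_ge_atTop N] with k hk
    have hkN : (N : ℝ) ≤ k := by exact_mod_cast hk
    have hk0 : (0 : ℝ) < k + 1 := by positivity
    have c1 : 9 / (4 * ((k : ℝ) + 1)) < infDist x Γ := by
      have := (le_max_left _ _).trans_lt hN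
      rw [div_lt_iff₀ hδ] at this
      rw [div_lt_iff₀ (by positivity)]
      nlinarith
    have c2 : dist x x₀ < 3 * ((k : ℝ) + 1) / 4 := by
      have := (le_max_right _ _).trans_lt hN
      linarith
    refine ⟨by simp [a5 k x c1, b4 k x c2], ?_⟩
    rw [gradient, hfd, hda k x c1, hdb1 k x c2]
    simp
/-- weighted function -/
def dpW {n : ℕ} {E : Type*} [SMul ℝ E] (Γ : Set (Euc n)) (s : ℝ) (f : Euc n → E) (y : Euc n) : E :=
  infDist y Γ ^ s • f y

section
variable {n : ℕ} {d C₀ : ℝ} {Γ : Set (Euc n)} {E : Type*} [NormedAddCommGroup E] [NormedSpace ℝ E]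

lemma dpW_meas0 (s : ℝ) : Measurable fun y : Euc n => infDist y Γ ^ s :=
  (continuous_infDist_pt Γ).measurable.pow_const s

lemma dpW_meas (s : ℝ) {f : Euc n → E} {μ : Measure (Euc n)} (hf : AEStronglyMeasurable f μ) :
    AEStronglyMeasurable (dpW Γ s f) μ :=
  (dpW_meas0 s).aestronglyMeasurable.smul hf

lemma dpW_inv (h : DpGood n d C₀ Γ) (s : ℝ) (f : Euc n → E) {y : Euc n} (hy : y ∉ Γ) :
    dpW Γ (-s) (dpW Γ s f) y = f y := by
  simp only [dpW]
  rw [smul_smul, ← Real.rpow_add (h.pos hy)]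
  simp

lemma dpW_inv2 (h : DpGood n d C₀ Γ) (s : ℝ) (f : Euc n → E) {y : Euc n} (hy : y ∉ Γ) :
    dpW Γ s (dpW Γ (-s) f) y = f y := by
  simp only [dpW]
  rw [smul_smul, ← Real.rpow_add (h.pos hy)]
  simp

lemma dpW_aem (h : DpGood n d C₀ Γ) {s : ℝ} {f : Euc n → E} (hf : AEStronglyMeasurable (dpW Γ s f) volume) :
    AEStronglyMeasurable f volume := by
  refine (dpW_meas (Γ := Γ) (-s) hf).congr ?_
  filter_upwards [h.aenot] with y hy
  exact dpW_inv h s f hy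

lemma dpW_norm (h : DpGood n d C₀ Γ) (a : ℝ) (f : Euc n → E) :
    ∫⁻ y, ‖dpW Γ (a / 2) f y‖ₑ ^ 2 = ∫⁻ y, ‖f y‖ₑ ^ 2 * ENNReal.ofReal (infDist y Γ ^ a) := by
  refine lintegral_congr_ae ?_
  filter_upwards [h.aenot] with y hy
  simp only [dpW]
  have h0 : 0 ≤ infDist y Γ ^ (a / 2) := Real.rpow_nonneg infDist_nonneg _
  rw [enorm_smul, mul_pow, mul_comm, Real.enorm_eq_ofReal h0, ← ENNReal.ofReal_pow h0,
    ← Real.rpow_natCast, ← Real.rpow_mul infDist_nonneg]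
  congr 3
  push_cast; ring

lemma dp_memLp2 {f : Euc n → E} (hf : AEStronglyMeasurable f volume) :
    MemLp f 2 volume ↔ ∫⁻ y, ‖f y‖ₑ ^ 2 < ⊤ := by
  rw [MemLp, and_iff_right hf, eLpNorm_lt_top_iff_lintegral_rpow_enorm_lt_top (by norm_num) (by norm_num)]
  simp

lemma dpW_memLp (h : DpGood n d C₀ Γ) (a : ℝ) {f : Euc n → E} (hf : AEStronglyMeasurable f volume) :
    MemLp (dpW Γ (a / 2) f) 2 volume ↔ ∫⁻ y, ‖f y‖ₑ ^ 2 * ENNReal.ofReal (infDist y Γ ^ a) < ⊤ := by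
  rw [dp_memLp2 (dpW_meas _ hf), dpW_norm h]

lemma dpW_locL2 (h : DpGood n d C₀ Γ) {s : ℝ} {f : Euc n → E} (hf : MemLp (dpW Γ s f) 2 volume)
    (K : Set (Euc n)) (hK : IsCompact K) (hKΓ : K ⊆ Γᶜ) : MemLp f 2 (volume.restrict K) := by
  have hc : ContinuousOn (fun y => infDist y Γ ^ (-s)) K := by
    refine (continuous_infDist_pt Γ).continuousOn.rpow_const fun y hy => Or.inl (h.pos (hKΓ hy)).ne'
  obtain ⟨c, hc⟩ := hK.exists_bound_of_continuousOn hc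
  refine MemLp.of_le_mul (c := c) (hf.restrict K) (dpW_aem h hf.1).restrict ?_
  filter_upwards [ae_restrict_mem hK.measurableSet] with y hy
  rw [← dpW_inv h s f (hKΓ hy), dpW, norm_smul]
  exact mul_le_mul_of_nonneg_right (hc y hy) (norm_nonneg _)

end

lemma dp_density {n : ℕ} {d C₀ : ℝ} {Γ : Set (Euc n)} (h : DpGood n d C₀ Γ) {u : Euc n → ℝ} {v G : Euc n → Euc n}
    (hu : LocallyIntegrable u) (hv : LocallyIntegrable v) (hD : DpGrad u v Γ)
    (hu2 : MemLp (dpW Γ ((d - 1 - n) / 2) u) 2 volume)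
    (hv2 : MemLp (dpW Γ ((d + 1 - n) / 2) v) 2 volume)
    (hG2 : MemLp (dpW Γ (-((d + 1 - n) / 2)) G) 2 volume)
    (hG : ∀ φ : Euc n → ℝ, ContDiff ℝ (⊤ : ℕ∞) φ → HasCompactSupport φ → tsupport φ ⊆ Γᶜ →
      ∫ x, inner ℝ (G x) (gradient φ x) = 0) :
    ∫ x, inner ℝ (G x) (v x) = 0 := by
  obtain ⟨η, e1, e2, e3, e4⟩ := dp_cut h
  have hz : ∀ k, ∫ x, inner ℝ (G x) (η k x • v x + u x • gradient (η k) x) = 0 := fun k =>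
    dp_density1 h.cl hu hv hD (dpW_locL2 h hu2) (dpW_locL2 h hv2) (dpW_locL2 h hG2) hG
      (e1 k).1 (e1 k).2.1 (e1 k).2.2
  have hGm := dpW_aem h hG2.1
  have hlim := tendsto_integral_of_dominated_convergence
    (F := fun k x => inner ℝ (G x) (η k x • v x + u x • gradient (η k) x)) (f := fun x => inner ℝ (G x) (v x))
    (μ := (volume : Measure (Euc n)))
    (fun x => 4 * (‖dpW Γ (-((d + 1 - n) / 2)) G x‖ * ‖dpW Γ ((d + 1 - n) / 2) v x‖) +
      12 * (‖dpW Γ (-((d + 1 - n) / 2)) G x‖ * ‖dpW Γ ((d - 1 - n) / 2) u x‖)) ?_ ?_ ?_ ?_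
  · simp only [hz] at hlim
    exact (tendsto_nhds_unique hlim tendsto_const_nhds)
  · intro k
    exact hGm.inner (((e1 k).1.continuous.aestronglyMeasurable.smul hv.aestronglyMeasurable).add
      (hu.aestronglyMeasurable.smul (dp_cont_gradient (e1 k).1).aestronglyMeasurable))
  · exact ((hG2.norm.integrable_mul hv2.norm).const_mul 4).add ((hG2.norm.integrable_mul hu2.norm).const_mul 12)
  · intro k
    filter_upwards [h.aenot] with x hx
    have hδ := h.pos hx
    have hβ : 0 < infDist x Γ ^ ((d + 1 - n) / 2) := Real.rpow_pos_of_pos hδ _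
    have hα : infDist x Γ ^ ((d - 1 - n) / 2) = infDist x Γ ^ ((d + 1 - n) / 2) / infDist x Γ := by
      rw [show (d - 1 - n) / 2 = (d + 1 - n) / 2 - 1 by ring, Real.rpow_sub_one hδ.ne']
    simp only [dpW, norm_smul]
    rw [hα, Real.rpow_neg hδ.le, norm_div, norm_inv, Real.norm_of_nonneg hβ.le, Real.norm_of_nonneg hδ.le]
    set β := infDist x Γ ^ ((d + 1 - n) / 2)
    have t1 : ‖η k x • v x + u x • gradient (η k) x‖ ≤ 4 * ‖v x‖ + ‖u x‖ * (12 / infDist x Γ) := by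
      refine (norm_add_le _ _).trans (add_le_add ?_ ?_)
      · rw [norm_smul]; exact mul_le_mul_of_nonneg_right (e2 k x) (norm_nonneg _)
      · rw [norm_smul]; exact mul_le_mul_of_nonneg_left (e3 k x hx) (norm_nonneg _)
    refine (norm_inner_le_norm _ _).trans ((mul_le_mul_of_nonneg_left t1 (norm_nonneg _)).trans (le_of_eq ?_))
    field_simp
  · filter_upwards [h.aenot] with x hx
    refine tendsto_const_nhds.congr' ?_
    filter_upwards [e4 x hx] with k hk
    rw [hk.1, hk.2]; simp
lemma dp_lm {H : Type*} [NormedAddCommGroup H] [InnerProductSpace ℝ H] (V : Submodule ℝ H) [CompleteSpace V]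
    (B : H →L[ℝ] H →L[ℝ] ℝ) {c : ℝ} (hc : 0 < c) (hco : ∀ p ∈ V, c * ‖p‖ * ‖p‖ ≤ B p p) (l : H →L[ℝ] ℝ) :
    ∃ p ∈ V, ∀ q ∈ V, B p q = l q := by
  let B' : V →L[ℝ] V →L[ℝ] ℝ := B.bilinearComp V.subtypeL V.subtypeL
  have hB : IsCoercive B' := ⟨c, hc, fun p => hco p p.2⟩
  let l' : StrongDual ℝ V := l.comp V.subtypeL
  refine ⟨(hB.continuousLinearEquivOfBilin.symm ((InnerProductSpace.toDual ℝ V).symm l') : V), Subtype.mem _, ?_⟩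
  intro q hq
  have h1 := hB.continuousLinearEquivOfBilin_apply
    (hB.continuousLinearEquivOfBilin.symm ((InnerProductSpace.toDual ℝ V).symm l')) ⟨q, hq⟩
  rw [ContinuousLinearEquiv.apply_symm_apply, InnerProductSpace.toDual_symm_apply] at h1
  exact h1.symm

lemma dp_sum_inner {n : ℕ} (x y : Euc n) : ∑ i, x i * y i = inner ℝ x y := by
  rw [PiLp.inner_apply]
  simp [mul_comm]

lemma dp_ell {n : ℕ} {d C₁ : ℝ} {Γ : Set (Euc n)} {A : Euc n → Euc n →L[ℝ] Euc n} 
    (hA : EllipticOn n d Γ A C₁) {x : Euc n} (hx : x ∉ Γ) (ξ : Euc n) :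
    ‖A x ξ‖ ≤ C₁ * infDist x Γ ^ (d + 1 - n) * ‖ξ‖ ∧
    C₁⁻¹ * infDist x Γ ^ (d + 1 - n) * ‖ξ‖ ^ 2 ≤ inner ℝ (A x ξ) ξ := by
  obtain ⟨h1, h2⟩ := hA x hx
  simp only [dp_sum_inner, weightW] at h1 h2
  refine ⟨?_, h2 ξ⟩
  have := h1 ξ (A x ξ)
  rw [real_inner_self_eq_norm_sq, abs_of_nonneg (by positivity), sq] at this
  by_cases h0 : ‖A x ξ‖ = 0
  · have h3 := h1 ξ ξ
    rw [h0]
    by_cases h4 : ‖ξ‖ = 0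
    · simp [h4]
    · have h5 := (abs_nonneg _).trans h3
      exact nonneg_of_mul_nonneg_left h5 (lt_of_le_of_ne (norm_nonneg _) (Ne.symm h4))
  · exact le_of_mul_le_mul_right this (lt_of_le_of_ne (norm_nonneg _) (Ne.symm h0))

lemma dp_M {n : ℕ} {d C₀ C₁ : ℝ} {Γ : Set (Euc n)} (h : DpGood n d C₀ Γ) (hC₁ : 1 ≤ C₁)
    {A : Euc n → Euc n →L[ℝ] Euc n} (hAm : AEStronglyMeasurable A volume)
    (hA : EllipticOn n d Γ A C₁) : ∃ M : Lp (Euc n) 2 (volume : Measure (Euc n)) →L[ℝ] Lp (Euc n) 2 (volume : Measure (Euc n)),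
      (∀ p, M p =ᵐ[volume] fun x => infDist x Γ ^ (-(d + 1 - n)) • A x (p x)) ∧ (∀ p, ‖M p‖ ≤ C₁ * ‖p‖) ∧
      ∀ p, C₁⁻¹ * ‖p‖ ^ 2 ≤ inner ℝ (M p) p := by
  have hb : ∀ x ∉ Γ, ∀ ξ, ‖infDist x Γ ^ (-(d + 1 - n)) • A x ξ‖ ≤ C₁ * ‖ξ‖ := by
    intro x hx ξ
    have hδ := h.pos hx
    have h1 := (dp_ell hA hx ξ).1
    have hw : 0 < infDist x Γ ^ (d + 1 - n) := Real.rpow_pos_of_pos hδ _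
    rw [norm_smul, Real.rpow_neg hδ.le, norm_inv, Real.norm_of_nonneg hw.le, inv_mul_le_iff₀ hw]
    linarith
  have hm : MemLp (fun x => infDist x Γ ^ (-(d + 1 - n)) • A x) ⊤ volume := by
    refine memLp_top_of_bound ((dpW_meas0 _).aestronglyMeasurable.smul hAm) C₁ ?_
    filter_upwards [h.aenot] with x hx
    exact ContinuousLinearMap.opNorm_le_bound _ (by linarith) fun ξ => hb x hx ξ
  let B : (Euc n →L[ℝ] Euc n) →L[ℝ] Euc n →L[ℝ] Euc n := ContinuousLinearMap.id ℝ _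
  have he : ∀ p, B.holderL volume ⊤ 2 2 (hm.toLp _) p =ᵐ[volume]
      fun x => infDist x Γ ^ (-(d + 1 - n)) • A x (p x) := by
    intro p
    filter_upwards [B.coeFn_holder (r := 2) (hm.toLp _) p, hm.coeFn_toLp] with x h1 h2
    have h1' : (B.holderL volume ⊤ 2 2 (hm.toLp _) p) x = B ((hm.toLp _) x) (p x) := h1
    rw [h1', h2]
    rfl
  refine ⟨B.holderL volume ⊤ 2 2 (hm.toLp _), he, fun p => ?_, fun p => ?_⟩
  · refine Lp.norm_le_mul_norm_of_ae_le_mul ?_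
    filter_upwards [he p, h.aenot] with x h1 hx
    rw [h1]
    exact hb x hx _
  · rw [← real_inner_self_eq_norm_sq, L2.inner_def, L2.inner_def, ← integral_const_mul]
    refine integral_mono_ae ((L2.integrable_inner p p).const_mul _) (L2.integrable_inner _ p) ?_
    filter_upwards [he p, h.aenot] with x h1 hx
    have hδ := h.pos hx
    have h2 := (dp_ell hA hx (p x)).2
    have hw : 0 < infDist x Γ ^ (d + 1 - n) := Real.rpow_pos_of_pos hδ _
    rw [h1, inner_smul_left, real_inner_self_eq_norm_sq, Real.rpow_neg hδ.le]
    simp only [conj_trivial]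
    rw [le_inv_mul_iff₀ hw]
    linarith

lemma dpW_test {n : ℕ} {d C₀ : ℝ} {Γ : Set (Euc n)} {E : Type*} [NormedAddCommGroup E] [NormedSpace ℝ E]
    (h : DpGood n d C₀ Γ) (s : ℝ) {f : Euc n → E}
    (hf : Continuous f) (hc : HasCompactSupport f) (hs : tsupport f ⊆ Γᶜ) : MemLp (dpW Γ s f) 2 volume := by
  have hK := hc.isCompact
  have hc' : ContinuousOn (dpW Γ s f) (tsupport f) := by
    refine ContinuousOn.smul ?_ hf.continuousOn
    exact (continuous_infDist_pt Γ).continuousOn.rpow_const fun y hy => Or.inl (h.pos (hs hy)).ne'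
  obtain ⟨c, hcb⟩ := hK.exists_bound_of_continuousOn hc'
  have e : (tsupport f).indicator (dpW Γ s f) = dpW Γ s f := by
    refine indicator_eq_self.2 fun x hx => ?_
    by_contra hh
    exact hx (by simp [dpW, image_eq_zero_of_notMem_tsupport hh])
  rw [← e, memLp_indicator_iff_restrict hK.measurableSet]
  have : IsFiniteMeasure ((volume : Measure (Euc n)).restrict (tsupport f)) :=
      ⟨by simpa using hK.measure_lt_top⟩
  refine MemLp.of_bound (hc'.aestronglyMeasurable_of_isCompact hK hK.measurableSet) c ?_
  filter_upwards [ae_restrict_mem hK.measurableSet] with x hx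
  exact hcb x hx
section
variable {n : ℕ} {d C₀ : ℝ} {Γ : Set (Euc n)}

lemma dpW_li {E : Type*} [NormedAddCommGroup E] [NormedSpace ℝ E] (h : DpGood n d C₀ Γ) {a : ℝ} (ha : a ≤ 0)
    {f : Euc n → E} (hf : MemLp (dpW Γ (a / 2) f) 2 volume) : LocallyIntegrable f :=
  dp_wloc h ha (dpW_aem h hf.1) ((dpW_memLp h a (dpW_aem h hf.1)).1 hf)

lemma dp_Lpsq {E : Type*} [NormedAddCommGroup E] (p : Lp E 2 (volume : Measure (Euc n))) :
    ‖p‖ₑ ^ 2 = ∫⁻ x, ‖p x‖ₑ ^ 2 := by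
  have := eLpNorm_nnreal_pow_eq_lintegral (f := p) (μ := (volume : Measure (Euc n))) (p := 2) (by norm_num)
  rw [Lp.enorm_def]
  simpa using this

lemma dpW_lp {E : Type*} [NormedAddCommGroup E] [NormedSpace ℝ E] (h : DpGood n d C₀ Γ) (s : ℝ)
    (p : Lp E 2 (volume : Measure (Euc n))) : dpW Γ s (dpW Γ (-s) p) =ᵐ[volume] p := by
  filter_upwards [h.aenot] with x hx
  exact dpW_inv2 h s p hx

lemma dpW_lpm {E : Type*} [NormedAddCommGroup E] [NormedSpace ℝ E] (h : DpGood n d C₀ Γ) (s : ℝ)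
    (p : Lp E 2 (volume : Measure (Euc n))) : MemLp (dpW Γ s (dpW Γ (-s) p)) 2 volume :=
  (memLp_congr_ae (dpW_lp h s p)).2 (Lp.memLp p)

/-- the Hilbert space -/
abbrev DpH (n : ℕ) := WithLp 2 (Lp ℝ 2 (volume : Measure (Euc n)) × Lp (Euc n) 2 (volume : Measure (Euc n)))

/-- test vectors -/
def dpT (d : ℝ) (Γ : Set (Euc n)) : Set (DpH n) :=
  {t | ∃ φ : Euc n → ℝ, ∃ e : Euc n, ContDiff ℝ (⊤ : ℕ∞) φ ∧ HasCompactSupport φ ∧ tsupport φ ⊆ Γᶜ ∧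
    t.fst =ᵐ[volume] dpW Γ (-((d - 1 - n) / 2)) (fun x => fderiv ℝ φ x e) ∧
    t.snd =ᵐ[volume] dpW Γ (-((d + 1 - n) / 2)) (fun x => φ x • e)}

lemma dp_memV (h : DpGood n d C₀ Γ) (p : DpH n) : p ∈ (Submodule.span ℝ (dpT d Γ))ᗮ ↔
    DpGrad (dpW Γ (-((d - 1 - n) / 2)) p.fst) (dpW Γ (-((d + 1 - n) / 2)) p.snd) Γ := by
  have h1 : p ∈ (Submodule.span ℝ (dpT d Γ))ᗮ ↔ ∀ t ∈ dpT d Γ, inner ℝ t p = 0 := by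
    constructor
    · intro hp t ht
      exact (Submodule.mem_orthogonal _ _).1 hp t (Submodule.subset_span ht)
    · intro hp
      rw [Submodule.mem_orthogonal]
      intro t ht
      induction ht using Submodule.span_induction with
      | mem x hx => exact hp x hx
      | zero => simp
      | add x y _ _ h1 h2 => rw [inner_add_left, h1, h2, add_zero]
      | smul c x _ h1 => rw [inner_smul_left, h1, mul_zero]
  have key : ∀ (t : DpH n) (φ : Euc n → ℝ) (e : Euc n),
      t.fst =ᵐ[volume] dpW Γ (-((d - 1 - n) / 2)) (fun x => fderiv ℝ φ x e) →
      t.snd =ᵐ[volume] dpW Γ (-((d + 1 - n) / 2)) (fun x => φ x • e) →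
      inner ℝ t p = (∫ x, dpW Γ (-((d - 1 - n) / 2)) p.fst x * fderiv ℝ φ x e) +
        ∫ x, φ x * inner ℝ (dpW Γ (-((d + 1 - n) / 2)) p.snd x) e := by
    intro t φ e t1 t2
    have e1 : inner ℝ t p = inner ℝ t.fst p.fst + inner ℝ t.snd p.snd := WithLp.prod_inner_apply t p
    rw [e1, L2.inner_def, L2.inner_def]
    congr 1
    · refine integral_congr_ae ?_
      filter_upwards [t1] with x hx
      rw [hx]
      simp only [dpW, smul_eq_mul, RCLike.inner_apply, conj_trivial]
      ring
    · refine integral_congr_ae ?_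
      filter_upwards [t2] with x hx
      rw [hx]
      simp only [dpW, inner_smul_left, conj_trivial]
      rw [real_inner_comm]
      ring
  rw [h1]
  constructor
  · intro hp φ f1 f2 f3 e
    have m1 : MemLp (dpW Γ (-((d - 1 - n) / 2)) (fun x => fderiv ℝ φ x e)) 2 volume :=
      dpW_test h _ ((f1.continuous_fderiv (by simp)).clm_apply continuous_const) (f2.fderiv_apply (𝕜 := ℝ) e)
        ((tsupport_fderiv_apply_subset ℝ e).trans f3)
    have m2 : MemLp (dpW Γ (-((d + 1 - n) / 2)) (fun x => φ x • e)) 2 volume :=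
      dpW_test h _ (f1.continuous.smul continuous_const) f2.smul_right
        ((tsupport_smul_subset_left φ fun _ => e).trans f3)
    have ht := hp (WithLp.toLp 2 (m1.toLp _, m2.toLp _)) ⟨φ, e, f1, f2, f3, m1.coeFn_toLp, m2.coeFn_toLp⟩
    rw [key (WithLp.toLp 2 (m1.toLp _, m2.toLp _)) φ e m1.coeFn_toLp m2.coeFn_toLp] at ht
    linarith
  · rintro hp t ⟨φ, e, f1, f2, f3, t1, t2⟩
    rw [key t φ e t1 t2, hp φ f1 f2 f3 e]
    ring

lemma dp_gradtest {φ : Euc n → ℝ} (h1 : ContDiff ℝ (⊤ : ℕ∞) φ) (h2 : HasCompactSupport φ) :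
    DpGrad φ (gradient φ) Γ :=
  dp_ibp h1.continuous.locallyIntegrable (fun y _ => (h1.differentiable (by simp)) y)
    (dp_cont_gradient h1).locallyIntegrable

lemma dp_tsgrad {φ : Euc n → ℝ} : tsupport (gradient φ) ⊆ tsupport φ := by
  refine closure_minimal (fun x hx => ?_) (isClosed_tsupport φ)
  by_contra hc
  refine hx ?_
  have : fderiv ℝ φ x = 0 := image_eq_zero_of_notMem_tsupport fun h => hc (tsupport_fderiv_subset ℝ h)
  simp [gradient, this]

end

lemma dp_solve {n : ℕ} {d C₀ C₁ : ℝ} {Γ : Set (Euc n)} (h : DpGood n d C₀ Γ) (hC₁ : 1 ≤ C₁)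
    {A : Euc n → Euc n →L[ℝ] Euc n} (hAm : AEStronglyMeasurable A volume)
    (hA : EllipticOn n d Γ A C₁) {v₀ : Euc n → Euc n} (hv₀ : MemLp (dpW Γ ((d + 1 - n) / 2) v₀) 2 volume) :
    ∃ (u : Euc n → ℝ) (v : Euc n → Euc n), MemLp (dpW Γ ((d - 1 - n) / 2) u) 2 volume ∧
      MemLp (dpW Γ ((d + 1 - n) / 2) v) 2 volume ∧ DpGrad u v Γ ∧
      (∀ φ : Euc n → ℝ, ContDiff ℝ (⊤ : ℕ∞) φ → HasCompactSupport φ → tsupport φ ⊆ Γᶜ →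
        ∫ x, inner ℝ (A x (v₀ x + v x)) (gradient φ x) = 0) ∧
      ∫⁻ y, ‖dpW Γ ((d + 1 - n) / 2) v y‖ₑ ^ 2 ≤ ENNReal.ofReal (C₁ ^ 4) * 
        ∫⁻ y, ‖dpW Γ ((d + 1 - n) / 2) v₀ y‖ₑ ^ 2 := by
  obtain ⟨M, M1, M2, M3⟩ := dp_M h hC₁ hAm hA
  obtain ⟨CH, hCH⟩ := dp_hardy n d C₀ h.hn h.hd0 h.hdn
  have ha : d - 1 - n ≤ 0 := by have := h.hdn; linarith
  have hb : d + 1 - n ≤ 0 := by have := h.hdn; linarith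
  have hC0 : 0 < C₁ := by linarith
  set V : Submodule ℝ (DpH n) := (Submodule.span ℝ (dpT d Γ))ᗮ with hV
  have hcl : IsClosed (V : Set (DpH n)) := Submodule.isClosed_orthogonal _
  haveI : CompleteSpace V := hcl.completeSpace_coe
  have hard : ∀ p ∈ V, ‖p.fst‖ ^ 2 ≤ CH * ‖p.snd‖ ^ 2 := by
    intro p hp
    rw [hV, dp_memV h] at hp
    have m1 := dpW_lpm h ((d - 1 - n) / 2) p.fst
    have m2 := dpW_lpm h ((d + 1 - n) / 2) p.snd
    have q := (dpW_memLp h _ (dpW_aem h m1.1)).1 m1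
    have := hCH Γ h _ _ (dpW_li h ha m1) (dpW_li h hb m2) hp (dp_trace0 h (dpW_aem h m1.1) q)
    rw [← dpW_norm h, ← dpW_norm h] at this
    have e1 : ∫⁻ y, ‖dpW Γ ((d - 1 - n) / 2) (dpW Γ (-((d - 1 - n) / 2)) p.fst) y‖ₑ ^ 2 = ‖p.fst‖ₑ ^ 2 := by
      rw [dp_Lpsq]
      refine lintegral_congr_ae ?_
      filter_upwards [dpW_lp h ((d - 1 - n) / 2) p.fst] with x hx
      rw [hx]
    have e2 : ∫⁻ y, ‖dpW Γ ((d + 1 - n) / 2) (dpW Γ (-((d + 1 - n) / 2)) p.snd) y‖ₑ ^ 2 = ‖p.snd‖ₑ ^ 2 := by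
      rw [dp_Lpsq]
      refine lintegral_congr_ae ?_
      filter_upwards [dpW_lp h ((d + 1 - n) / 2) p.snd] with x hx
      rw [hx]
    rw [e1, e2] at this
    have h3 : ‖p.fst‖₊ ^ 2 ≤ CH * ‖p.snd‖₊ ^ 2 := by
      rw [← ENNReal.coe_le_coe]
      push_cast
      exact this
    exact_mod_cast h3
  let S : DpH n →L[ℝ] Lp (Euc n) 2 (volume : Measure (Euc n)) := WithLp.sndL 2 ℝ _ _
  have hS : ∀ p : DpH n, S p = p.snd := fun p => rfl
  let B : DpH n →L[ℝ] DpH n →L[ℝ] ℝ := (innerSL ℝ).bilinearComp (M.comp S) S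
  have hB : ∀ p q, B p q = inner ℝ (M p.snd) q.snd := fun p q => rfl
  let l : DpH n →L[ℝ] ℝ := -((innerSL ℝ (M (hv₀.toLp _))).comp S)
  have hl : ∀ q, l q = -inner ℝ (M (hv₀.toLp _)) q.snd := fun q => rfl
  obtain ⟨p, hp, hpq⟩ := dp_lm V B (c := (C₁ * (1 + CH))⁻¹) (by positivity) (by
    intro p hp
    rw [hB, mul_assoc, ← sq, WithLp.prod_norm_sq_eq_of_L2]
    have h1 := M3 p.snd
    have h2 := hard p hp
    refine le_trans ?_ h1
    rw [mul_inv, mul_assoc]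
    refine mul_le_mul_of_nonneg_left ?_ (by positivity)
    rw [inv_mul_le_iff₀ (by positivity)]
    linarith) l
  have m1 := dpW_lpm h ((d - 1 - n) / 2) p.fst
  have m2 := dpW_lpm h ((d + 1 - n) / 2) p.snd
  refine ⟨_, _, m1, m2, (dp_memV h p).1 hp, ?_, ?_⟩
  · intro φ f1 f2 f3
    have t1 := dpW_test h ((d - 1 - n) / 2) f1.continuous f2 f3
    have t2 := dpW_test h ((d + 1 - n) / 2) (dp_cont_gradient f1) (dp_cs_gradient f2) (dp_tsgrad.trans f3)
    have hq : (WithLp.toLp 2 (t1.toLp _, t2.toLp _) : DpH n) ∈ V := by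
      rw [hV, dp_memV h]
      refine dp_grad_congr ?_ ?_ (dp_gradtest f1 f2)
      · filter_upwards [h.aenot, t1.coeFn_toLp] with x hx h2
        rw [dpW]
        change φ x = _ • ((t1.toLp _) x)
        rw [h2]
        exact (dpW_inv h _ _ hx).symm
      · filter_upwards [h.aenot, t2.coeFn_toLp] with x hx h2
        rw [dpW]
        change gradient φ x = _ • ((t2.toLp _) x)
        rw [h2]
        exact (dpW_inv h _ _ hx).symm
    have h5 := hpq _ hq
    rw [hB, hl] at h5
    have h6 : inner ℝ (M (hv₀.toLp _ + p.snd)) (t2.toLp _) = 0 := by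
      rw [map_add, inner_add_left]
      change inner ℝ (M p.snd) (t2.toLp _) = -inner ℝ (M (hv₀.toLp _)) (t2.toLp _) at h5
      linarith
    rw [← h6, L2.inner_def]
    refine integral_congr_ae ?_
    filter_upwards [h.aenot, t2.coeFn_toLp, M1 (hv₀.toLp _ + p.snd), hv₀.coeFn_toLp,
      Lp.coeFn_add (hv₀.toLp _) p.snd] with x hx g1 g2 g3 g4
    rw [g1, g2, g4, Pi.add_apply, g3]
    have hδ := h.pos hx
    simp only [dpW]
    rw [map_add, map_add, map_smul, map_smul]
    simp only [inner_smul_left, inner_smul_right, inner_add_left, smul_add, conj_trivial]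
    set w := infDist x Γ ^ ((d + 1 - n) / 2) with hw
    have hw0 : 0 < w := Real.rpow_pos_of_pos hδ _
    have e1 : infDist x Γ ^ (-((d + 1 - n) / 2)) = w⁻¹ := Real.rpow_neg hδ.le _
    have e2 : infDist x Γ ^ (-(d + 1 - n)) = (w * w)⁻¹ := by
      rw [Real.rpow_neg hδ.le, hw, ← Real.rpow_add hδ]; congr 2; ring
    rw [e1, e2]
    field_simp
  · have h5 := hpq p hp
    rw [hB, hl] at h5
    have h6 := M3 p.snd
    have h7 := abs_real_inner_le_norm (M (hv₀.toLp _)) p.snd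
    have h8 := M2 (hv₀.toLp _)
    have h9 : ‖p.snd‖ ≤ C₁ ^ 2 * ‖hv₀.toLp _‖ := by
      rw [h5] at h6
      have h10 : C₁⁻¹ * ‖p.snd‖ ^ 2 ≤ C₁ * ‖hv₀.toLp _‖ * ‖p.snd‖ :=
        h6.trans ((neg_le_abs _).trans (h7.trans (mul_le_mul_of_nonneg_right h8 (norm_nonneg _))))
      rw [inv_mul_le_iff₀ hC0] at h10
      by_cases h0 : ‖p.snd‖ = 0
      · rw [h0]; positivity
      · have : 0 < ‖p.snd‖ := lt_of_le_of_ne (norm_nonneg _) (Ne.symm h0)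
        refine le_of_mul_le_mul_right ?_ this
        rw [← sq]; linarith
    have e1 : ∫⁻ y, ‖dpW Γ ((d + 1 - n) / 2) (dpW Γ (-((d + 1 - n) / 2)) p.snd) y‖ₑ ^ 2 = ‖p.snd‖ₑ ^ 2 := by
      rw [dp_Lpsq]
      refine lintegral_congr_ae ?_
      filter_upwards [dpW_lp h ((d + 1 - n) / 2) p.snd] with x hx
      rw [hx]
    have e2 : ∫⁻ y, ‖dpW Γ ((d + 1 - n) / 2) v₀ y‖ₑ ^ 2 = ‖hv₀.toLp _‖ₑ ^ 2 := by
      rw [dp_Lpsq]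
      refine lintegral_congr_ae ?_
      filter_upwards [hv₀.coeFn_toLp] with x hx
      rw [hx]
    rw [e1, e2, ← ofReal_norm_eq_enorm, ← ofReal_norm_eq_enorm, ← ENNReal.ofReal_pow (norm_nonneg _),
      ← ENNReal.ofReal_pow (norm_nonneg _), ← ENNReal.ofReal_mul (by positivity)]
    refine ENNReal.ofReal_le_ofReal ?_
    calc ‖p.snd‖ ^ 2 ≤ (C₁ ^ 2 * ‖hv₀.toLp _‖) ^ 2 := pow_le_pow_left₀ (norm_nonneg _) h9 2
      _ = _ := by ring
section
variable {n : ℕ} {d C₀ C₁ : ℝ} {Γ : Set (Euc n)} {A : Euc n → Euc n →L[ℝ] Euc n}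

lemma dp_energy (h : DpGood n d C₀ Γ) (v : Euc n → Euc n) :
    ∫⁻ x in Γᶜ, ENNReal.ofReal (‖v x‖ ^ 2) ∂(measW n d Γ) =
      ∫⁻ y, ‖v y‖ₑ ^ 2 * ENNReal.ofReal (infDist y Γ ^ (d + 1 - (n : ℝ))) := by
  rw [measW, restrict_withDensity h.cl.isOpen_compl.measurableSet, h.restr,
    lintegral_withDensity_eq_lintegral_mul_non_measurable _
      (show Measurable fun x => ENNReal.ofReal (weightW n d Γ x) from (dpW_meas0 _).ennreal_ofReal)
      (Eventually.of_forall fun x => ENNReal.ofReal_lt_top)]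
  refine lintegral_congr fun x => ?_
  rw [Pi.mul_apply, mul_comm, ENNReal.ofReal_pow (norm_nonneg _), ofReal_norm_eq_enorm]
  rfl

lemma dp_data (h : DpGood n d C₀ Γ) {g g' : Euc n → ℝ} (hg : g =ᵐ[dpS d Γ] g') :
    (∫⁻ x in Γ, ∫⁻ y in Γ, ENNReal.ofReal (|g x - g y| ^ 2) / ENNReal.ofReal (dist x y ^ (d + 1))
      ∂(μH[d]) ∂(μH[d])) =
    ∫⁻ x, ∫⁻ x', ‖g' x' - g' x‖ₑ ^ 2 * ENNReal.ofReal (dist x x' ^ (-(d + 1))) ∂(dpS d Γ) ∂(dpS d Γ) := by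
  refine lintegral_congr_ae ?_
  filter_upwards [hg] with x hx
  refine lintegral_congr_ae ?_
  filter_upwards [hg] with y hy
  rw [hx, hy]
  by_cases hxy : x = y
  · subst hxy; simp
  · have hp : 0 < dist x y := dist_pos.2 hxy
    rw [Real.rpow_neg hp.le, ENNReal.ofReal_inv_of_pos (Real.rpow_pos_of_pos hp _), div_eq_mul_inv,
      abs_sub_comm, ENNReal.ofReal_pow (abs_nonneg _), ← Real.norm_eq_abs, ofReal_norm_eq_enorm]

lemma dp_sol_iff (h : DpGood n d C₀ Γ) {v : Euc n → Euc n} : SolOn Γ A v Γᶜ ↔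
    ∀ φ : Euc n → ℝ, ContDiff ℝ (⊤ : ℕ∞) φ → HasCompactSupport φ → tsupport φ ⊆ Γᶜ →
      ∫ x, inner ℝ (A x (v x)) (gradient φ x) = 0 := by
  unfold SolOn
  rw [h.restr]
  simp only [dp_sum_inner]

lemma dp_grad_lin {u₁ u₂ : Euc n → ℝ} {v₁ v₂ : Euc n → Euc n} (hu₁ : LocallyIntegrable u₁)
    (hu₂ : LocallyIntegrable u₂) (hv₁ : LocallyIntegrable v₁) (hv₂ : LocallyIntegrable v₂)
    (h₁ : DpGrad u₁ v₁ Γ) (h₂ : DpGrad u₂ v₂ Γ) (c : ℝ) :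
    DpGrad (fun x => u₁ x + c * u₂ x) (fun x => v₁ x + c • v₂ x) Γ := by
  intro φ f1 f2 f3 e
  have hge : Continuous fun x => fderiv ℝ φ x e := (f1.continuous_fderiv (by simp)).clm_apply continuous_const
  have hgc : HasCompactSupport fun x => fderiv ℝ φ x e := f2.fderiv_apply (𝕜 := ℝ) e
  have i1 : ∀ u : Euc n → ℝ, LocallyIntegrable u → Integrable fun x => u x * fderiv ℝ φ x e := fun u hu =>
    hu.integrable_smul_right_of_hasCompactSupport hge hgc
  have i2 : ∀ v : Euc n → Euc n, LocallyIntegrable v → Integrable fun x => φ x * inner ℝ (v x) e := by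
    intro v hv
    have := (dp_li_mul f1.continuous f2 hv).inner_const (𝕜 := ℝ) e
    refine this.congr (Eventually.of_forall fun y => ?_)
    simp only [inner_smul_left]
    rfl
  have e1 : ∀ x, (u₁ x + c * u₂ x) * fderiv ℝ φ x e = u₁ x * fderiv ℝ φ x e + c * (u₂ x * fderiv ℝ φ x e) := by
    intro x; ring
  have e2 : ∀ x, φ x * inner ℝ (v₁ x + c • v₂ x) e = φ x * inner ℝ (v₁ x) e + c * (φ x * inner ℝ (v₂ x) e) := by
    intro x; rw [inner_add_left, real_inner_smul_left]; ring
  simp only [e1, e2]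
  rw [integral_add (i1 _ hu₁) ((i1 _ hu₂).const_mul c), integral_add (i2 _ hv₁) ((i2 _ hv₂).const_mul c),
    integral_const_mul, integral_const_mul, h₁ φ f1 f2 f3 e, h₂ φ f1 f2 f3 e]
  ring

lemma dp_trace_lin {u₁ u₂ : Euc n → ℝ} (hu₁ : LocallyIntegrable u₁) (hu₂ : LocallyIntegrable u₂)
    {x : Euc n} {t₁ t₂ : ℝ} (h₁ : HasTraceAt u₁ x t₁) (h₂ : HasTraceAt u₂ x t₂) (c : ℝ) :
    HasTraceAt (fun y => u₁ y + c * u₂ y) x (t₁ + c * t₂) := by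
  unfold HasTraceAt at *
  refine (h₁.add (h₂.const_mul c)).congr fun ρ => ?_
  have hi : ∀ u : Euc n → ℝ, LocallyIntegrable u → IntegrableOn u (ball x ρ) := fun u hu =>
    (hu.integrableOn_isCompact (isCompact_closedBall x ρ)).mono_set ball_subset_closedBall
  rw [setAverage_eq, setAverage_eq, setAverage_eq, integral_add (hi _ hu₁) ((hi _ hu₂).const_mul c),
    integral_const_mul]
  simp only [smul_eq_mul]
  ring

lemma dp_AL2 (h : DpGood n d C₀ Γ) (hAm : AEStronglyMeasurable A volume) (hA : EllipticOn n d Γ A C₁)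
    {v : Euc n → Euc n} (hv : MemLp (dpW Γ ((d + 1 - n) / 2) v) 2 volume) :
    MemLp (dpW Γ (-((d + 1 - n) / 2)) (fun x => A x (v x))) 2 volume := by
  refine MemLp.of_le_mul (c := C₁) hv (dpW_meas _ ?_) ?_
  · exact (ContinuousLinearMap.id ℝ (Euc n →L[ℝ] Euc n)).aestronglyMeasurable_comp₂ hAm (dpW_aem h hv.1)
  · filter_upwards [h.aenot] with x hx
    have hδ := h.pos hx
    have h1 := (dp_ell hA hx (v x)).1
    simp only [dpW, norm_smul]
    set w := infDist x Γ ^ ((d + 1 - n) / 2) with hw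
    have hw0 : 0 < w := Real.rpow_pos_of_pos hδ _
    have e2 : infDist x Γ ^ (d + 1 - n) = w * w := by
      rw [hw, ← Real.rpow_add hδ]; congr 1; ring
    rw [Real.rpow_neg hδ.le, norm_inv, Real.norm_of_nonneg hw0.le, inv_mul_le_iff₀ hw0]
    rw [e2] at h1
    linarith

lemma dp_pair (h : DpGood n d C₀ Γ) {s : ℝ} {G f : Euc n → Euc n} (hG : MemLp (dpW Γ (-s) G) 2 volume)
    (hf : MemLp (dpW Γ s f) 2 volume) : Integrable fun x => inner ℝ (G x) (f x) := by
  refine (hG.norm.integrable_mul hf.norm).mono' ((dpW_aem h hG.1).inner (dpW_aem h hf.1)) ?_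
  filter_upwards [h.aenot] with x hx
  have hδ := h.pos hx
  have hw : 0 < infDist x Γ ^ s := Real.rpow_pos_of_pos hδ _
  refine (norm_inner_le_norm _ _).trans (le_of_eq ?_)
  simp only [dpW, norm_smul, Pi.mul_apply]
  rw [Real.rpow_neg hδ.le, norm_inv, Real.norm_of_nonneg hw.le]
  field_simp

lemma dp_uniq (h : DpGood n d C₀ Γ) (hC₁ : 1 ≤ C₁) (hAm : AEStronglyMeasurable A volume)
    (hA : EllipticOn n d Γ A C₁) {u₁ u₂ g : Euc n → ℝ} {v₁ v₂ : Euc n → Euc n} (hu₁ : LocallyIntegrable u₁)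
    (hu₂ : LocallyIntegrable u₂) (h₁ : DpGrad u₁ v₁ Γ) (h₂ : DpGrad u₂ v₂ Γ)
    (m₁ : MemLp (dpW Γ ((d + 1 - n) / 2) v₁) 2 volume) (m₂ : MemLp (dpW Γ ((d + 1 - n) / 2) v₂) 2 volume)
    (t₁ : ∀ᵐ x ∂(dpS d Γ), HasTraceAt u₁ x (g x)) (t₂ : ∀ᵐ x ∂(dpS d Γ), HasTraceAt u₂ x (g x))
    (s₁ : SolOn Γ A v₁ Γᶜ) (s₂ : SolOn Γ A v₂ Γᶜ) : u₁ =ᵐ[volume] u₂ := by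
  have hb : d + 1 - n ≤ 0 := by have := h.hdn; linarith
  have hC0 : 0 < C₁ := by linarith
  rw [dp_sol_iff h] at s₁ s₂
  set u : Euc n → ℝ := fun x => u₁ x + (-1) * u₂ x with hu
  set v : Euc n → Euc n := fun x => v₁ x + (-1 : ℝ) • v₂ x with hv
  have hD : DpGrad u v Γ := dp_grad_lin hu₁ hu₂ (dpW_li h hb m₁) (dpW_li h hb m₂) h₁ h₂ (-1)
  have hul : LocallyIntegrable u := hu₁.add (hu₂.smul (-1 : ℝ))
  have hm : MemLp (dpW Γ ((d + 1 - n) / 2) v) 2 volume := by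
    refine (memLp_congr_ae (Eventually.of_forall fun x => ?_)).1 (m₁.sub m₂)
    simp only [Pi.sub_apply, dpW, hv, smul_add, smul_neg, neg_smul, one_smul]
    abel
  have hvl : LocallyIntegrable v := dpW_li h hb hm
  have ht : ∀ᵐ x ∂(dpS d Γ), HasTraceAt u x 0 := by
    filter_upwards [t₁, t₂] with x a b
    have := dp_trace_lin hu₁ hu₂ a b (-1)
    rwa [show g x + -1 * g x = 0 by ring] at this
  obtain ⟨CH, hCH⟩ := dp_hardy n d C₀ h.hn h.hd0 h.hdn
  have hH := hCH Γ h u v hul hvl hD ht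
  have hm' := (dpW_memLp h (d + 1 - n) hvl.aestronglyMeasurable).1 hm
  have hu2 : MemLp (dpW Γ ((d - 1 - n) / 2) u) 2 volume :=
    (dpW_memLp h (d - 1 - n) hul.aestronglyMeasurable).2
      (hH.trans_lt (ENNReal.mul_lt_top ENNReal.coe_lt_top hm'))
  have hG2 := dp_AL2 h hAm hA hm
  have hz := dp_density h hul hvl hD hu2 hm hG2 (by
    intro φ f1 f2 f3
    have t2 := dpW_test h ((d + 1 - n) / 2) (dp_cont_gradient f1) (dp_cs_gradient f2) (dp_tsgrad.trans f3)
    have i1 := dp_pair h (dp_AL2 h hAm hA m₁) t2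
    have i2 := dp_pair h (dp_AL2 h hAm hA m₂) t2
    have e : ∀ x, inner ℝ (A x (v x)) (gradient φ x) =
        inner ℝ (A x (v₁ x)) (gradient φ x) - inner ℝ (A x (v₂ x)) (gradient φ x) := by
      intro x
      simp only [hv, map_add, map_smul, map_neg, neg_smul, one_smul, inner_add_left, inner_neg_left]
      ring
    simp only [e]
    rw [integral_sub i1 i2, s₁ φ f1 f2 f3, s₂ φ f1 f2 f3, sub_zero])
  have hnn : ∀ x ∉ Γ, C₁⁻¹ * infDist x Γ ^ (d + 1 - n) * ‖v x‖ ^ 2 ≤ inner ℝ (A x (v x)) (v x) :=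
    fun x hx => (dp_ell hA hx (v x)).2
  rw [integral_eq_zero_iff_of_nonneg_ae ?_ (dp_pair h hG2 hm)] at hz
  · have hv0 : ∀ᵐ x, v x = 0 := by
      filter_upwards [hz, h.aenot] with x hx hxΓ
      have h1 := hnn x hxΓ
      have hw : 0 < C₁⁻¹ * infDist x Γ ^ (d + 1 - n) := by
        have := Real.rpow_pos_of_pos (h.pos hxΓ) (d + 1 - n)
        positivity
      simp only [Pi.zero_apply] at hx
      rw [hx] at h1
      have h2 : ‖v x‖ ^ 2 ≤ 0 := nonpos_of_mul_nonpos_right h1 hw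
      have h3 : ‖v x‖ = 0 := by nlinarith [norm_nonneg (v x)]
      exact norm_eq_zero.1 h3
    have h0 : ∫⁻ y, ‖v y‖ₑ ^ 2 * ENNReal.ofReal (infDist y Γ ^ (d + 1 - (n : ℝ))) = 0 := by
      rw [← lintegral_zero (μ := (volume : Measure (Euc n)))]
      refine lintegral_congr_ae ?_
      filter_upwards [hv0] with x hx
      rw [hx]; simp
    have hae : AEMeasurable (fun y => ‖u y‖ₑ ^ 2 * ENNReal.ofReal (infDist y Γ ^ (d - 1 - (n : ℝ)))) volume :=
      (hul.aestronglyMeasurable.enorm.pow_const 2).mul (dpW_meas0 _).ennreal_ofReal.aemeasurable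
    rw [h0, mul_zero, nonpos_iff_eq_zero, lintegral_eq_zero_iff' hae] at hH
    filter_upwards [hH, h.aenot] with x hx hxΓ
    have := Real.rpow_pos_of_pos (h.pos hxΓ) (d - 1 - n)
    simp only [Pi.zero_apply, mul_eq_zero, ENNReal.ofReal_eq_zero, not_le.2 this, or_false,
      pow_eq_zero_iff (two_ne_zero), enorm_eq_zero] at hx
    simp only [hu] at hx
    linarith
  · filter_upwards [h.aenot] with x hx
    refine le_trans ?_ (hnn x hx)
    have := Real.rpow_pos_of_pos (h.pos hx) (d + 1 - n)
    simp only [Pi.zero_apply]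
    positivity

end
section
variable {n : ℕ} {d C₀ C₁ : ℝ} {Γ : Set (Euc n)} {A : Euc n → Euc n →L[ℝ] Euc n}

lemma dp_memW (h : DpGood n d C₀ Γ) {u : Euc n → ℝ} {v : Euc n → Euc n} (hu : LocallyIntegrable u) :
    MemW n d Γ u v ↔ DpGrad u v Γ ∧ MemLp (dpW Γ ((d + 1 - n) / 2) v) 2 volume := by
  have hb : d + 1 - n ≤ 0 := by have := h.hdn; linarith
  constructor
  · intro H
    have hvm : AEStronglyMeasurable v volume := by
      have := H.gradLocInt.aestronglyMeasurable
      rwa [h.restr] at this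
    have hl := H.l2
    rw [dp_energy h] at hl
    have hm := (dpW_memLp h (d + 1 - n) hvm).2 hl
    exact ⟨(dp_grad_iff h hu (dpW_li h hb hm)).1 H.isGrad, hm⟩
  · rintro ⟨hD, hm⟩
    have hvl := dpW_li h hb hm
    refine ⟨hu.locallyIntegrableOn _, hvl.locallyIntegrableOn _, (dp_grad_iff h hu hvl).2 hD, ?_⟩
    rw [dp_energy h]
    exact (dpW_memLp h (d + 1 - n) hvl.aestronglyMeasurable).1 hm

lemma dp_esq {E : Type*} [NormedAddCommGroup E] (a b : E) :
    ‖a + b‖ₑ ^ 2 ≤ 2 * (‖a‖ₑ ^ 2 + ‖b‖ₑ ^ 2) := by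
  have h1 : ‖a + b‖₊ ^ 2 ≤ 2 * (‖a‖₊ ^ 2 + ‖b‖₊ ^ 2) :=
    (pow_le_pow_left₀ (by positivity) (nnnorm_add_le a b) 2).trans add_sq_le
  simp only [enorm_eq_nnnorm]
  exact_mod_cast h1

end
/-- solvability (and uniqueness) of the Dirichlet problem with data in `H`. -/
theorem statement12 (n : ℕ) (hn : 2 ≤ n) (d C₀ C₁ : ℝ) (hd0 : 0 < d)
    (hdn : d < (n : ℝ) - 1) (hC₀ : 1 ≤ C₀) (hC₁ : 1 ≤ C₁) :
    ∃ C : ℝ, 0 < C ∧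
      ∀ Γ : Set (Euc n), Γ.Nonempty → IsClosed Γ → AhlforsRegular n d C₀ Γ →
        ∀ A : Euc n → Euc n →L[ℝ] Euc n, AEStronglyMeasurable A volume →
          EllipticOn n d Γ A C₁ →
          ∀ g : Euc n → ℝ, AEMeasurable g (μH[d].restrict Γ) →
            (∫⁻ x in Γ, ∫⁻ y in Γ,
                ENNReal.ofReal (|g x - g y| ^ 2) / ENNReal.ofReal (dist x y ^ (d + 1))
                  ∂(μH[d]) ∂(μH[d])) < ⊤ →
            ∃ u v, MemW n d Γ u v ∧ LocallyIntegrable u volume ∧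
              (∀ᵐ x ∂(μH[d].restrict Γ), HasTraceAt u x (g x)) ∧
              SolOn Γ A v Γᶜ ∧
              (∫⁻ x in Γᶜ, ENNReal.ofReal (‖v x‖ ^ 2) ∂(measW n d Γ)) ^ ((1 : ℝ) / 2)
                ≤ ENNReal.ofReal C *
                  (∫⁻ x in Γ, ∫⁻ y in Γ,
                    ENNReal.ofReal (|g x - g y| ^ 2) / ENNReal.ofReal (dist x y ^ (d + 1))
                      ∂(μH[d]) ∂(μH[d])) ^ ((1 : ℝ) / 2) ∧
              ∀ u' v', MemW n d Γ u' v' → LocallyIntegrable u' volume →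
                (∀ᵐ x ∂(μH[d].restrict Γ), HasTraceAt u' x (g x)) →
                SolOn Γ A v' Γᶜ → u' =ᵐ[volume] u := by
  obtain ⟨CE, hCE⟩ := dp_ext n d C₀ hn hd0 hdn
  have hK0 : 0 < 2 * (1 + C₁ ^ 4) * (CE : ℝ) + 1 := by positivity
  refine ⟨(2 * (1 + C₁ ^ 4) * (CE : ℝ) + 1) ^ ((1 : ℝ) / 2), Real.rpow_pos_of_pos hK0 _, ?_⟩
  intro Γ ne cl ar A hAm hA g hg hQ
  have h : DpGood n d C₀ Γ := ⟨hn, hd0, hdn, hC₀, ne, cl, ar⟩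
  have hb : d + 1 - n ≤ 0 := by linarith
  have hb' : d - 1 - n ≤ 0 := by linarith
  have hgg : g =ᵐ[dpS d Γ] hg.mk g := hg.ae_eq_mk
  rw [dp_data h hgg] at hQ ⊢
  obtain ⟨u₀, v₀, hu₀, hv₀, hD₀, ht₀, he₀⟩ := hCE Γ h (hg.mk g) hg.measurable_mk hQ
  set N := ∫⁻ x, ∫⁻ x', ‖hg.mk g x' - hg.mk g x‖ₑ ^ 2 * ENNReal.ofReal (dist x x' ^ (-(d + 1)))
    ∂(dpS d Γ) ∂(dpS d Γ) with hN
  have m₀ : MemLp (dpW Γ ((d + 1 - n) / 2) v₀) 2 volume :=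
    (dpW_memLp h (d + 1 - n) hv₀.aestronglyMeasurable).2
      (he₀.trans_lt (ENNReal.mul_lt_top ENNReal.coe_lt_top hQ))
  obtain ⟨p, q, mp, mq, hDp, hsol, hen⟩ := dp_solve h hC₁ hAm hA m₀
  have hp := dpW_li h hb' mp
  have hq := dpW_li h hb mq
  have tp : ∀ᵐ x ∂(dpS d Γ), HasTraceAt p x 0 :=
    dp_trace0 h hp.aestronglyMeasurable ((dpW_memLp h (d - 1 - n) hp.aestronglyMeasurable).1 mp)
  have hu : LocallyIntegrable (fun x => u₀ x + 1 * p x) := hu₀.add (hp.smul (1 : ℝ))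
  have hD := dp_grad_lin hu₀ hp hv₀ hq hD₀ hDp 1
  have ew : ∀ x, dpW Γ ((d + 1 - n) / 2) (fun x => v₀ x + (1 : ℝ) • q x) x =
      dpW Γ ((d + 1 - n) / 2) v₀ x + dpW Γ ((d + 1 - n) / 2) q x := by
    intro x
    simp only [dpW, smul_add, one_smul]
  have hm : MemLp (dpW Γ ((d + 1 - n) / 2) (fun x => v₀ x + (1 : ℝ) • q x)) 2 volume :=
    (memLp_congr_ae (Eventually.of_forall ew)).2 (m₀.add mq)
  have ht : ∀ᵐ x ∂(dpS d Γ), HasTraceAt (fun x => u₀ x + 1 * p x) x (g x) := by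
    filter_upwards [ht₀, tp, hgg] with x a b c
    have := dp_trace_lin hu₀ hp a b 1
    rwa [mul_zero, add_zero, ← c] at this
  have hs : SolOn Γ A (fun x => v₀ x + (1 : ℝ) • q x) Γᶜ := by
    rw [dp_sol_iff h]
    intro φ f1 f2 f3
    simpa only [one_smul] using hsol φ f1 f2 f3
  refine ⟨_, _, (dp_memW h hu).2 ⟨hD, hm⟩, hu, ht, hs, ?_, ?_⟩
  · have hE : ∫⁻ x in Γᶜ, ENNReal.ofReal (‖v₀ x + (1 : ℝ) • q x‖ ^ 2) ∂(measW n d Γ) ≤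
        ENNReal.ofReal (2 * (1 + C₁ ^ 4) * (CE : ℝ) + 1) * N := by
      rw [dp_energy h (fun x => v₀ x + (1 : ℝ) • q x), ← dpW_norm h]
      rw [← dpW_norm h] at he₀
      have hmm : AEMeasurable (fun y => ‖dpW Γ ((d + 1 - n) / 2) v₀ y‖ₑ ^ 2) volume := m₀.1.enorm.pow_const 2
      calc ∫⁻ y, ‖dpW Γ ((d + 1 - n) / 2) (fun x => v₀ x + (1 : ℝ) • q x) y‖ₑ ^ 2
          ≤ ∫⁻ y, 2 * (‖dpW Γ ((d + 1 - n) / 2) v₀ y‖ₑ ^ 2 + ‖dpW Γ ((d + 1 - n) / 2) q y‖ₑ ^ 2) :=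
            lintegral_mono fun y => by rw [ew]; exact dp_esq _ _
        _ = 2 * ((∫⁻ y, ‖dpW Γ ((d + 1 - n) / 2) v₀ y‖ₑ ^ 2) + ∫⁻ y, ‖dpW Γ ((d + 1 - n) / 2) q y‖ₑ ^ 2) := by
            rw [lintegral_const_mul' _ _ (by simp), lintegral_add_left' hmm]
        _ ≤ 2 * (CE * N + ENNReal.ofReal (C₁ ^ 4) * (CE * N)) := by
            gcongr
            exact hen.trans (by gcongr)
        _ = ENNReal.ofReal (2 * (1 + C₁ ^ 4) * (CE : ℝ)) * N := by
            rw [ENNReal.ofReal_mul (by positivity), ENNReal.ofReal_mul (by positivity),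
              ENNReal.ofReal_add (by positivity) (by positivity), ENNReal.ofReal_coe_nnreal,
              ENNReal.ofReal_one, ENNReal.ofReal_ofNat]
            ring
        _ ≤ _ := by
            gcongr
            linarith
    calc _ ≤ (ENNReal.ofReal (2 * (1 + C₁ ^ 4) * (CE : ℝ) + 1) * N) ^ ((1 : ℝ) / 2) :=
          ENNReal.rpow_le_rpow hE (by norm_num)
      _ = _ := by
          rw [ENNReal.mul_rpow_of_nonneg _ _ (by norm_num), ENNReal.ofReal_rpow_of_pos hK0]
  · intro u' v' hW hu' ht' hs'
    obtain ⟨hD', hm'⟩ := (dp_memW h hu').1 hW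
    exact dp_uniq h hC₁ hAm hA hu' hu hD' hD hm' hm ht' ht hs' hs
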